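/- arXiv:2001.05051 — 4 statements merged into one kernel-verified Lean document; each statement's English description precedes it below -/
import Mathlib

section
/- Let H be a (finite simple) graph with maximum degree at most 2 which either contains at most one odd cycle of length exceeding 3, or contains at most 3 triangles. Then H is strongly 4-colorable. -/
open SimpleGraph

/-- `s` is the vertex set of a cycle subgraph of `H`. -/
def IsCycleSet {V : Type} [DecidableEq V] (H : SimpleGraph V) (s : Finset V) : Prop :=
  ∃ (v : V) (w : H.Walk v v), w.IsCycle ∧ w.support.toFinset = s

/-- `H` is strongly `t`-colorable: after padding `H` with `t⌈n/t⌉ - n` isolated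
vertices (so that the number of vertices is divisible by `t`), for every partition of
the vertex set into parts of size `t` there is a proper `t`-coloring in which every
color class contains exactly one vertex of each part. -/
def StronglyColorable {V : Type} [Fintype V] [DecidableEq V]
    (H : SimpleGraph V) (t : ℕ) : Prop :=
  ∀ P : V ⊕ Fin (t * ((Fintype.card V + t - 1) / t) - Fintype.card V) →
      Fin ((Fintype.card V + t - 1) / t),
    (∀ j, (Finset.univ.filter fun w => P w = j).card = t) →
    ∃ c : V ⊕ Fin (t * ((Fintype.card V + t - 1) / t) - Fintype.card V) → Fin t,
      (∀ u v : V, H.Adj u v → c (Sum.inl u) ≠ c (Sum.inl v)) ∧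
      ∀ j k, (Finset.univ.filter fun w => P w = j ∧ c w = k).card = 1

theorem sum_pi_eq_zero_of_sum_update {T K R : Type*} [Fintype T] [DecidableEq T] [Fintype K]
    [DecidableEq K] [AddCommMonoid R] (F : (T → K) → R) (i : T)
    (h : ∀ r : T → K, ∑ x, F (Function.update r i x) = 0) : ∑ r, F r = 0 := by
  rw [← (Equiv.funSplitAt i K).symm.sum_comp, Fintype.sum_prod_type_right]
  refine Finset.sum_eq_zero fun g _ => ?_
  by_cases hK : Nonempty K
  · obtain ⟨k⟩ := hK
    rw [← h ((Equiv.funSplitAt i K).symm (k, g))]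
    refine Finset.sum_congr rfl fun x _ => congrArg F ?_
    ext j
    by_cases hj : j = i
    · subst hj; simp [Equiv.funSplitAt]
    · simp [Equiv.funSplitAt, hj]
  · have := not_nonempty_iff.mp hK
    simp

theorem sum_prod_sum_eq_one {T : Type*} [Fintype T] [DecidableEq T]
    (a : T → T → Fin 3 → Fin 3 → ZMod 2)
    (hsum : ∀ s t, s ≠ t → ∀ y, ∑ x, a s t x y = 0)
    (hsymm : ∀ s t x y, s ≠ t → a s t x y = a t s y x)
    (hdiag : ∀ t x, a t t x x = 1) :
    ∑ r : T → Fin 3, ∏ t, ∑ s, a t s (r t) (r s) = 1 := by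
  set G : (T → T) → ZMod 2 := fun φ => ∑ r : T → Fin 3, ∏ t, a t (φ t) (r t) (r (φ t)) with hG
  have h1 : ∑ r : T → Fin 3, ∏ t, ∑ s, a t s (r t) (r s) = ∑ φ, G φ := by
    simp only [hG, Finset.prod_univ_sum, Fintype.piFinset_univ]
    exact Finset.sum_comm
  have hns : ∀ φ : T → T, ¬ Function.Bijective φ → G φ = 0 := by
    intro φ hφ
    have hs : ¬ Function.Surjective φ := fun h => hφ (Finite.injective_iff_bijective.mp
      (Finite.injective_iff_surjective.mpr h))
    simp only [Function.Surjective, not_forall, not_exists] at hs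
    obtain ⟨i, hi⟩ := hs
    refine sum_pi_eq_zero_of_sum_update _ i fun r => ?_
    have : ∀ x, ∏ t, a t (φ t) (Function.update r i x t) (Function.update r i x (φ t)) =
        a i (φ i) x (r (φ i)) * ∏ t ∈ Finset.univ.erase i, a t (φ t) (r t) (r (φ t)) := by
      intro x
      rw [← Finset.mul_prod_erase _ _ (Finset.mem_univ i)]
      congr 1
      · simp [Function.update_of_ne (hi i)]
      · refine Finset.prod_congr rfl fun t ht => ?_
        rw [Function.update_of_ne (hi t), Function.update_of_ne (Finset.ne_of_mem_erase ht)]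
    simp only [this]
    rw [← Finset.sum_mul, hsum _ _ (fun h => hi i h.symm), zero_mul]
  have h2 : ∑ φ, G φ = ∑ σ : Equiv.Perm T, G σ := by
    rw [← Finset.sum_filter_of_ne (p := Function.Bijective)
      (fun φ _ h => by by_contra h'; exact h (hns φ h'))]
    refine (Finset.sum_bij (fun (σ : Equiv.Perm T) _ => (σ : T → T)) ?_ ?_ ?_ ?_).symm
    · intro σ _; simp
    · intro σ _ ρ _ h; exact DFunLike.coe_injective h
    · intro φ hφ
      exact ⟨Equiv.ofBijective φ (by simpa using hφ), Finset.mem_univ _, rfl⟩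
    · intro σ _; rfl
  have hinv : ∀ σ : Equiv.Perm T, G (σ⁻¹ : Equiv.Perm T) = G σ := by
    intro σ
    refine Finset.sum_congr rfl fun r _ => ?_
    rw [← Equiv.prod_comp σ]
    refine Finset.prod_congr rfl fun t _ => ?_
    rw [show σ⁻¹ (σ t) = t from σ.symm_apply_apply t]
    by_cases h : σ t = t
    · rw [h]
    · exact hsymm _ _ _ _ h
  have h3 : ∑ σ ∈ Finset.univ.erase (1 : Equiv.Perm T), G σ = 0 := by
    refine Finset.sum_involution (fun σ _ => σ⁻¹) ?_ ?_ ?_ ?_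
    · intro σ _
      rw [hinv]; exact CharTwo.add_self_eq_zero _
    · intro σ hσ h0 hσσ
      apply h0
      have hσ1 : σ ≠ 1 := Finset.ne_of_mem_erase hσ
      obtain ⟨i, hi⟩ : ∃ i, σ i ≠ i := by
        by_contra! h; exact hσ1 (Equiv.ext h)
      have hii : σ (σ i) = i :=
        (DFunLike.congr_fun hσσ (σ i)).symm.trans (σ.symm_apply_apply i)
      refine sum_pi_eq_zero_of_sum_update _ i fun r => ?_
      have : ∀ x, ∏ t, a t (σ t) (Function.update r i x t) (Function.update r i x (σ t)) =
          a i (σ i) x (r (σ i)) *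
            ∏ t ∈ (Finset.univ.erase i).erase (σ i), a t (σ t) (r t) (r (σ t)) := by
        intro x
        rw [← Finset.mul_prod_erase _ _ (Finset.mem_univ i),
          ← Finset.mul_prod_erase (Finset.univ.erase i) _ (by simp [hi] : σ i ∈ _), ← mul_assoc]
        congr 1
        · rw [hii, Function.update_self, Function.update_of_ne hi, hsymm (σ i) i _ _ hi]
          generalize a i (σ i) x (r (σ i)) = z
          revert z; decide
        · refine Finset.prod_congr rfl fun t ht => ?_
          simp only [Finset.mem_erase, Finset.mem_univ, and_true] at ht
          rw [Function.update_of_ne ht.2, Function.update_of_ne]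
          intro h
          exact ht.1 (σ.injective (h.trans hii.symm))
      simp only [this]
      rw [← Finset.sum_mul, hsum _ _ (Ne.symm hi), zero_mul]
    · intro σ hσ
      simpa using hσ
    · intro σ _; simp
  rw [h1, h2, ← Finset.add_sum_erase _ _ (Finset.mem_univ (1 : Equiv.Perm T)), h3, add_zero]
  simp only [hG, Equiv.Perm.one_apply, hdiag, Finset.prod_const_one, Finset.sum_const,
    Finset.card_univ, Fintype.card_fun, Fintype.card_fin, nsmul_eq_mul, mul_one, Nat.cast_pow]
  rw [show ((3 : ℕ) : ZMod 2) = 1 from by decide, one_pow]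

/-- The in-degree of vertex `j` of a path on the natural numbers (with a half-edge entering `0`)
when exactly the edges `{i, i + 1}` with `i ∈ t` are directed towards `i`. -/
def inDeg (t : Finset ℕ) (j : ℕ) : ℕ :=
  (if j ∈ t then 1 else 0) + (if j = 0 ∨ j - 1 ∉ t then 1 else 0)

/-- The parity of the number of positions at most `i` of the elements not selected by `r`. -/
def keptParity {T : Type*} {m : ℕ} (p : T × Fin 3 ≃ Fin m) (r : T → Fin 3) (i : ℕ) : ZMod 2 :=
  ∑ j ∈ Finset.range (i + 1),
    if h : j < m then (if (p.symm ⟨j, h⟩).2 = r (p.symm ⟨j, h⟩).1 then 0 else 1) else 0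

theorem fin3_sum_ne {R : Type*} [AddCommMonoid R] (k : Fin 3) (g : Fin 3 → R) :
    ∑ x, (if x = k then 0 else g x) = g (k + 1) + g (k + 2) := by
  fin_cases k <;> simp [Fin.sum_univ_three, add_comm]

theorem keptParity_eq {T : Type*} [Fintype T] {m : ℕ} (p : T × Fin 3 ≃ Fin m) (r : T → Fin 3)
    {i : ℕ} (hi : i < m) :
    keptParity p r i = ∑ t, ((if (p (t, r t + 1) : ℕ) ≤ i then 1 else 0) +
      (if (p (t, r t + 2) : ℕ) ≤ i then 1 else 0)) := by
  have h1 : keptParity p r i = ∑ j : Fin m, if (p.symm j).2 = r (p.symm j).1 then 0 else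
      (if (j : ℕ) ≤ i then (1 : ZMod 2) else 0) := by
    have : keptParity p r i = ∑ j ∈ (Finset.range m).filter (· ≤ i),
      if h : j < m then (if (p.symm ⟨j, h⟩).2 = r (p.symm ⟨j, h⟩).1 then 0 else 1) else 0 := by
      unfold keptParity
      congr 1
      ext j
      simp only [Finset.mem_range, Finset.mem_filter]
      omega
    rw [this, Finset.sum_filter, Finset.sum_range]
    refine Finset.sum_congr rfl fun j _ => ?_
    simp only [j.2, dif_pos, Fin.eta]
    split_ifs <;> rfl
  rw [h1, ← p.sum_comp, Fintype.sum_prod_type]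
  refine Finset.sum_congr rfl fun t _ => ?_
  simp only [Equiv.symm_apply_apply]
  exact fin3_sum_ne (r t) fun x => if (p (t, x) : ℕ) ≤ i then (1 : ZMod 2) else 0

theorem keptParity_last {T : Type*} [Fintype T] {m : ℕ} (p : T × Fin 3 ≃ Fin m) (r : T → Fin 3)
    (hm : 0 < m) : keptParity p r (m - 1) = 0 := by
  rw [keptParity_eq p r (by omega)]
  refine Finset.sum_eq_zero fun t _ => ?_
  rw [if_pos (by have := (p (t, r t + 1)).2; omega), if_pos (by have := (p (t, r t + 2)).2; omega)]
  decide

/-- The edges directed backwards in the orientation encoded by the selection `r`. -/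
def backEdges {T : Type*} {m : ℕ} (p : T × Fin 3 ≃ Fin m) (r : T → Fin 3) : Finset ℕ :=
  (Finset.range (m - 1)).filter fun i => keptParity p r i = 1

theorem mem_backEdges {T : Type*} [Fintype T] {m : ℕ} (p : T × Fin 3 ≃ Fin m) (r : T → Fin 3)
    {i : ℕ} (hi : i < m) : i ∈ backEdges p r ↔ keptParity p r i = 1 := by
  simp only [backEdges, Finset.mem_filter, Finset.mem_range, and_iff_right_iff_imp]
  intro h
  by_contra h'
  obtain rfl : i = m - 1 := by omega
  rw [keptParity_last p r (by omega)] at h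
  exact absurd h (by decide)

theorem inDeg_backEdges {T : Type*} [Fintype T] {m : ℕ} (p : T × Fin 3 ≃ Fin m) (r : T → Fin 3)
    (x : T × Fin 3) : inDeg (backEdges p r) (p x) =
      if x.2 = r x.1 then 1 else if keptParity p r (p x) = 1 then 2 else 0 := by
  have hx := (p x).2
  have hstep : ∀ z w : ZMod 2, z = w + 1 → (z = 1 ↔ ¬ w = 1) := by decide
  unfold inDeg
  simp only [mem_backEdges p r hx]
  have hlast : (if h : (p x : ℕ) < m then
      (if (p.symm ⟨p x, h⟩).2 = r (p.symm ⟨p x, h⟩).1 then (0 : ZMod 2) else 1) else 0) =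
      if x.2 = r x.1 then 0 else 1 := by simp
  rcases Nat.eq_zero_or_pos (p x : ℕ) with h0 | h0
  · have hb : keptParity p r (p x) = if x.2 = r x.1 then 0 else 1 := by
      rw [← hlast, h0]
      simp [keptParity]
    rw [h0] at hb ⊢
    by_cases h : x.2 = r x.1
    · simp only [h, if_true] at hb ⊢
      simp [hb]
    · simp only [h, if_false] at hb ⊢
      simp [hb]
  · obtain ⟨j, hj⟩ : ∃ j, (p x : ℕ) = j + 1 := ⟨p x - 1, by omega⟩
    have hb : keptParity p r (p x) = keptParity p r j + if x.2 = r x.1 then 0 else 1 := by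
      rw [← hlast, keptParity, Finset.sum_range_succ, keptParity, hj]
    have hj1 : (p x : ℕ) - 1 = j := by omega
    simp only [hj1, mem_backEdges p r (by omega : j < m)]
    have hne : ¬ (p x : ℕ) = 0 := by omega
    simp only [hne, false_or]
    by_cases h : x.2 = r x.1
    · simp only [h, if_true, add_zero] at hb ⊢
      rw [hb]
      split_ifs <;> simp_all
    · simp only [h, if_false] at hb ⊢
      have := hstep _ _ hb
      by_cases hk : keptParity p r (p x) = 1
      · simp [hk, this.mp hk]
      · have : keptParity p r j = 1 := by by_contra h'; exact hk (this.mpr h')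
        simp [hk, this]

theorem fin3_injective_iff (k : Fin 3) (g : Fin 3 → ℕ) (b : Fin 3 → ZMod 2)
    (hg : ∀ x, g x = if x = k then 1 else if b x = 1 then 2 else 0) :
    Function.Injective g ↔ b (k + 1) + b (k + 2) = 1 := by
  obtain rfl : g = _ := funext hg
  revert k b
  decide

theorem eq_backEdges {T : Type*} [Fintype T] {m : ℕ} (p : T × Fin 3 ≃ Fin m) (r : T → Fin 3)
    (t : Finset ℕ) (ht : t ⊆ Finset.range (m - 1))
    (hr : ∀ x, inDeg t (p x) = 1 ↔ x.2 = r x.1) : t = backEdges p r := by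
  have key : ∀ i, i < m → (i ∈ t ↔ keptParity p r i = 1) := by
    intro i
    have hz : ∀ z : ZMod 2, ¬ z = 1 → z = 0 := by decide
    induction i with
    | zero =>
      intro hi
      have := hr (p.symm ⟨0, hi⟩)
      simp only [Equiv.apply_symm_apply, inDeg, true_or, if_true] at this
      simp only [keptParity, zero_add, Finset.sum_range_one, hi, dif_pos, ← this]
      by_cases h : 0 ∈ t <;> simp [h]
    | succ i ih =>
      intro hi
      have ih := ih (by omega)
      have := hr (p.symm ⟨i + 1, hi⟩)
      simp only [Equiv.apply_symm_apply, inDeg, Nat.add_sub_cancel, Nat.succ_ne_zero,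
        false_or] at this
      rw [keptParity, Finset.sum_range_succ, dif_pos hi, ← keptParity]
      simp only [← this]
      by_cases h : i ∈ t
      · rw [ih.mp h]
        by_cases h' : i + 1 ∈ t <;> simp [h, h', CharTwo.add_self_eq_zero]
      · rw [hz _ (fun h' => h (ih.mpr h'))]
        by_cases h' : i + 1 ∈ t <;> simp [h, h']
  ext i
  constructor
  · intro hi
    have := Finset.mem_range.mp (ht hi)
    exact (mem_backEdges p r (by omega)).mpr ((key i (by omega)).mp hi)
  · intro hi
    have : i < m - 1 := by
      simp only [backEdges, Finset.mem_filter, Finset.mem_range] at hi; exact hi.1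
    exact (key i (by omega)).mpr ((mem_backEdges p r (by omega)).mp hi)

theorem sum_add_add_eq_zero (g : Fin 3 → ZMod 2) : ∑ x, (g (x + 1) + g (x + 2)) = 0 := by
  revert g; decide

theorem inDeg_le_two (t : Finset ℕ) (j : ℕ) : inDeg t j ≤ 2 := by
  unfold inDeg; split_ifs <;> simp

theorem card_orientations {T : Type*} [Fintype T] [DecidableEq T] {m : ℕ}
    (p : T × Fin 3 ≃ Fin m) :
    (((Finset.range (m - 1)).powerset.filter fun t =>
      ∀ τ, Function.Injective fun k => inDeg t (p (τ, k))).card : ZMod 2) = 1 := by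
  set a : T → T → Fin 3 → Fin 3 → ZMod 2 := fun s t x y =>
    ((if (p (t, y + 1) : ℕ) ≤ p (s, x + 1) then 1 else 0) +
      (if (p (t, y + 2) : ℕ) ≤ p (s, x + 1) then 1 else 0)) +
    ((if (p (t, y + 1) : ℕ) ≤ p (s, x + 2) then 1 else 0) +
      (if (p (t, y + 2) : ℕ) ≤ p (s, x + 2) then 1 else 0)) with ha
  have hval : ∀ r : T → Fin 3, ∀ s, keptParity p r (p (s, r s + 1)) +
      keptParity p r (p (s, r s + 2)) = ∑ t, a s t (r s) (r t) := by
    intro r s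
    rw [keptParity_eq p r (Fin.is_lt _), keptParity_eq p r (Fin.is_lt _),
      ← Finset.sum_add_distrib]
  have hinj : ∀ r : T → Fin 3, ∀ s, (Function.Injective fun k => inDeg (backEdges p r) (p (s, k))) ↔
      ∑ t, a s t (r s) (r t) = 1 := by
    intro r s
    rw [← hval]
    exact fin3_injective_iff (r s) _ (fun k => keptParity p r (p (s, k)))
      fun x => inDeg_backEdges p r (s, x)
  have hcard : ((Finset.range (m - 1)).powerset.filter fun t =>
      ∀ τ, Function.Injective fun k => inDeg t (p (τ, k))).card =
      (Finset.univ.filter fun r : T → Fin 3 => ∀ s, ∑ t, a s t (r s) (r t) = 1).card := by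
    symm
    refine Finset.card_bij (fun r _ => backEdges p r) ?_ ?_ ?_
    · intro r hr
      simp only [Finset.mem_filter, Finset.mem_univ, true_and, Finset.mem_powerset] at hr ⊢
      exact ⟨Finset.filter_subset _ _, fun s => (hinj r s).mpr (hr s)⟩
    · intro r _ r' _ h
      ext1 s
      have h1 := inDeg_backEdges p r (s, r s)
      have h2 := inDeg_backEdges p r' (s, r s)
      rw [h, h2] at h1
      by_contra hne
      simp only [if_true, hne, if_false] at h1
      split_ifs at h1
      omega
    · intro t ht
      simp only [Finset.mem_filter, Finset.mem_powerset] at ht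
      have : ∀ s, ∃ k, inDeg t (p (s, k)) = 1 := by
        intro s
        by_contra! hne
        have hi := ht.2 s
        have h0 := inDeg_le_two t (p (s, 0))
        have h1 := inDeg_le_two t (p (s, 1))
        have h2 := inDeg_le_two t (p (s, 2))
        have n0 := hne 0
        have n1 := hne 1
        have n2 := hne 2
        have d01 : inDeg t (p (s, 0)) ≠ inDeg t (p (s, 1)) := fun h => absurd (hi h) (by decide)
        have d02 : inDeg t (p (s, 0)) ≠ inDeg t (p (s, 2)) := fun h => absurd (hi h) (by decide)
        have d12 : inDeg t (p (s, 1)) ≠ inDeg t (p (s, 2)) := fun h => absurd (hi h) (by decide)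
        omega
      choose r hr using this
      have heq := eq_backEdges p r t ht.1 fun x => by
        constructor
        · intro h; exact ht.2 x.1 (h.trans (hr x.1).symm)
        · intro h
          have := hr x.1
          rwa [← h] at this
      refine ⟨r, ?_, heq.symm⟩
      simp only [Finset.mem_filter, Finset.mem_univ, true_and]
      intro s
      rw [← hinj, ← heq]
      exact ht.2 s
  rw [hcard, Finset.card_filter, Nat.cast_sum]
  refine Eq.trans (Finset.sum_congr rfl fun r _ => ?_) (sum_prod_sum_eq_one a ?_ ?_ ?_)
  · have hz : ∀ z : ZMod 2, z ≠ 1 → z = 0 := by decide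
    by_cases h : ∀ s, ∑ t, a s t (r s) (r t) = 1
    · rw [if_pos h, Finset.prod_congr rfl fun s _ => h s]; simp
    · rw [if_neg h]
      push Not at h
      obtain ⟨s, hs⟩ := h
      rw [Finset.prod_eq_zero (Finset.mem_univ s) (hz _ hs), Nat.cast_zero]
  · intro s t _ y
    exact sum_add_add_eq_zero fun x => (if (p (t, y + 1) : ℕ) ≤ p (s, x) then 1 else 0) +
      (if (p (t, y + 2) : ℕ) ≤ p (s, x) then 1 else 0)
  · intro s t x y hst
    have hle : ∀ u v, (if (p (t, v) : ℕ) ≤ p (s, u) then (1 : ZMod 2) else 0) =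
        1 + if (p (s, u) : ℕ) ≤ p (t, v) then 1 else 0 := by
      intro u v
      have : (p (t, v) : ℕ) ≠ p (s, u) := fun h => hst (by
        have := p.injective (Fin.ext h); simp only [Prod.mk.injEq] at this; exact this.1.symm)
      rcases lt_or_gt_of_ne this with h | h
      · rw [if_pos h.le, if_neg (by omega)]; decide
      · rw [if_neg (by omega), if_pos h.le]; decide
    simp only [ha, hle]
    have : ∀ z1 z2 z3 z4 : ZMod 2, 1 + z1 + (1 + z2) + (1 + z3 + (1 + z4)) =
        z1 + z3 + (z2 + z4) := by decide
    exact this _ _ _ _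
  · intro t x
    simp only [ha, le_refl, if_true]
    have hne : (p (t, x + 1) : ℕ) ≠ p (t, x + 2) := fun h => by
      have := p.injective (Fin.ext h)
      simp at this
    rcases lt_or_gt_of_ne hne with h | h
    · rw [if_neg (by omega), if_pos h.le]; decide
    · rw [if_pos h.le, if_neg (by omega)]; decide

theorem prod_pow_inDeg {R : Type*} [CommMonoid R] (c : ℕ → R) {n : ℕ} {t : Finset ℕ}
    (ht : t ⊆ Finset.range n) :
    c 0 * ((∏ i ∈ t, c i) * ∏ i ∈ Finset.range n \ t, c (i + 1)) =
      ∏ j ∈ Finset.range (n + 1), c j ^ inDeg t j := by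
  have h1 : ∏ j ∈ Finset.range (n + 1), (if j ∈ t then c j else 1) = ∏ i ∈ t, c i := by
    rw [Finset.prod_ite_mem]
    congr 1
    refine Finset.inter_eq_right.mpr (ht.trans ?_)
    exact Finset.range_subset_range.mpr (Nat.le_succ n)
  have h2 : ∏ j ∈ Finset.range (n + 1), (if j = 0 ∨ j - 1 ∉ t then c j else 1) =
      (∏ i ∈ Finset.range n \ t, c (i + 1)) * c 0 := by
    rw [Finset.prod_range_succ']
    simp only [Nat.succ_ne_zero, false_or, Nat.add_sub_cancel, true_or, if_true]
    rw [← Finset.prod_filter, Finset.sdiff_eq_filter]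
  have h3 : ∀ j, c j ^ inDeg t j =
      (if j ∈ t then c j else 1) * (if j = 0 ∨ j - 1 ∉ t then c j else 1) := by
    intro j
    unfold inDeg
    split_ifs <;> simp [pow_two]
  simp only [h3, Finset.prod_mul_distrib, h1, h2]
  rw [mul_comm, mul_assoc]

theorem sum_perm_fin_three {R : Type*} [CommRing R] [CharP R 2] (ω : R) (hω : ω ^ 2 + ω + 1 = 0)
    (d : Fin 3 → ℕ) (hd : ∀ k, d k ≤ 2) :
    ∑ σ : Equiv.Perm (Fin 3), ∏ k, (ω ^ (σ k : ℕ)) ^ d k =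
      if Function.Injective d then 1 else 0 := by
  have h2 : (2 : R) = 0 := CharTwo.two_eq_zero
  have hdet : ∑ σ : Equiv.Perm (Fin 3), ∏ k, (ω ^ (σ k : ℕ)) ^ d k =
      (Matrix.of fun i k : Fin 3 => (ω ^ (i : ℕ)) ^ d k).det := by
    rw [Matrix.det_apply]
    refine Finset.sum_congr rfl fun σ _ => ?_
    rcases Int.units_eq_one_or (Equiv.Perm.sign σ) with h | h <;> simp [h, CharTwo.neg_eq]
  rw [hdet]
  split_ifs with h
  · have d01 : d 0 ≠ d 1 := fun h' => absurd (h h') (by decide)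
    have d02 : d 0 ≠ d 2 := fun h' => absurd (h h') (by decide)
    have d12 : d 1 ≠ d 2 := fun h' => absurd (h h') (by decide)
    have h0 := hd 0
    have h1 := hd 1
    have h2 := hd 2
    rw [Matrix.det_fin_three]
    simp only [Matrix.of_apply, Fin.val_zero, Fin.val_one, Fin.val_two]
    generalize d 0 = a at *
    generalize d 1 = b at *
    generalize d 2 = c at *
    interval_cases a <;> interval_cases b <;>
      first | omega | (interval_cases c <;> first | omega | grind)
  · simp only [Function.Injective, not_forall] at h
    obtain ⟨i, j, hij, hne⟩ := h
    exact Matrix.det_zero_of_column_eq hne fun k => by simp [hij]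

theorem exists_perm_coloring {T : Type*} [Fintype T] [DecidableEq T] {m : ℕ}
    (p : T × Fin 3 ≃ Fin m) : ∃ π : T → Equiv.Perm (Fin 3),
      ∀ x y, (p x : ℕ) + 1 = p y → π x.1 x.2 ≠ π y.1 y.2 := by
  rcases Nat.eq_zero_or_pos m with rfl | hm
  · exact ⟨fun _ => 1, fun x => (p x).elim0⟩
  obtain ⟨n, rfl⟩ : ∃ n, m = n + 1 := ⟨m - 1, by omega⟩
  obtain ⟨ω, hω⟩ : ∃ ω : AlgebraicClosure (ZMod 2), ω ^ 2 + ω + 1 = 0 := by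
    obtain ⟨ω, h⟩ := IsAlgClosed.exists_root
      (Polynomial.X ^ 2 + Polynomial.X + 1 : Polynomial (AlgebraicClosure (ZMod 2)))
      (by
        have : (Polynomial.X ^ 2 + Polynomial.X + 1 :
          Polynomial (AlgebraicClosure (ZMod 2))).degree = 2 := by compute_degree!
        rw [this]; decide)
    exact ⟨ω, by simpa using h⟩
  have : CharP (AlgebraicClosure (ZMod 2)) 2 :=
    charP_of_injective_algebraMap (algebraMap (ZMod 2) _).injective 2
  by_contra! hcon
  set c : (T → Equiv.Perm (Fin 3)) → ℕ → AlgebraicClosure (ZMod 2) := fun π j =>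
    if h : j < n + 1 then ω ^ (π (p.symm ⟨j, h⟩).1 (p.symm ⟨j, h⟩).2 : ℕ) else 1 with hc
  have hzero : ∑ π, c π 0 * ∏ i ∈ Finset.range n, (c π i + c π (i + 1)) = 0 := by
    refine Finset.sum_eq_zero fun π _ => ?_
    obtain ⟨x, y, hxy, he⟩ := hcon π
    have hy := (p y).2
    have hx := (p x).2
    rw [Finset.prod_eq_zero (i := (p x : ℕ)) (Finset.mem_range.mpr (by omega)), mul_zero]
    have : c π (p x) = c π (p x + 1) := by
      simp only [hc, hxy, hx, hy, dif_pos, Fin.eta, Equiv.symm_apply_apply, he]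
    rw [this, CharTwo.add_self_eq_zero]
  have hone : ∑ π, c π 0 * ∏ i ∈ Finset.range n, (c π i + c π (i + 1)) = 1 := by
    have h1 : ∀ π, c π 0 * ∏ i ∈ Finset.range n, (c π i + c π (i + 1)) =
        ∑ t ∈ (Finset.range n).powerset,
          ∏ τ, ∏ k, (ω ^ (π τ k : ℕ)) ^ inDeg t (p (τ, k)) := by
      intro π
      rw [Finset.prod_add, Finset.mul_sum]
      refine Finset.sum_congr rfl fun t ht => ?_
      rw [prod_pow_inDeg (c π) (Finset.mem_powerset.mp ht), Finset.prod_range, ← p.prod_comp,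
        Fintype.prod_prod_type]
      simp only [hc, Fin.is_lt, dif_pos, Fin.eta, Equiv.symm_apply_apply]
    simp only [h1]
    rw [Finset.sum_comm]
    have h2 : ∀ t ∈ (Finset.range n).powerset, ∑ π : T → Equiv.Perm (Fin 3),
        ∏ τ, ∏ k, (ω ^ (π τ k : ℕ)) ^ inDeg t (p (τ, k)) =
        if ∀ τ, Function.Injective fun k => inDeg t (p (τ, k)) then 1 else 0 := by
      intro t _
      have : ∑ π : T → Equiv.Perm (Fin 3),
          ∏ τ, ∏ k, (ω ^ (π τ k : ℕ)) ^ inDeg t (p (τ, k)) = ∏ τ, ∑ σ : Equiv.Perm (Fin 3),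
          ∏ k, (ω ^ (σ k : ℕ)) ^ inDeg t (p (τ, k)) := by
        rw [Finset.prod_univ_sum, Fintype.piFinset_univ]
      rw [this]
      simp only [sum_perm_fin_three ω hω _ fun k => inDeg_le_two t _]
      rw [Finset.prod_ite_zero]
      simp
    rw [Finset.sum_congr rfl h2, ← Finset.sum_filter, Finset.sum_const, nsmul_one]
    have h3 := card_orientations p
    rw [Nat.add_sub_cancel] at h3
    have h4 := congrArg (ZMod.castHom (dvd_refl 2) (AlgebraicClosure (ZMod 2))) h3
    simpa only [map_natCast, map_one] using h4
  rw [hzero] at hone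
  exact zero_ne_one hone

/-- A version of the "cycle plus triangles" theorem for paths: if a finite linear order is
partitioned into triples, then it has a `3`-coloring in which the elements of each triple have
different colors and consecutive elements have different colors. -/
theorem exists_three_coloring {V α T : Type*} [Fintype V] [DecidableEq V] [LinearOrder α]
    [Fintype T] [DecidableEq T] (key : V → α) (hkey : Function.Injective key) (P : V → T)
    (hP : ∀ t, (Finset.univ.filter fun v => P v = t).card = 3) :
    ∃ c : V → Fin 3, (∀ x y, key x < key y → (∀ z, ¬ (key x < key z ∧ key z < key y)) →
      c x ≠ c y) ∧ ∀ x y, P x = P y → c x = c y → x = y := by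
  have e : ∀ t, Nonempty ({v // P v = t} ≃ Fin 3) := fun t =>
    ⟨Fintype.equivFinOfCardEq (by rw [Fintype.card_subtype]; exact hP t)⟩
  let E : V ≃ T × Fin 3 := (Equiv.sigmaFiberEquiv P).symm.trans
    ((Equiv.sigmaCongrRight fun t => (e t).some).trans (Equiv.sigmaEquivProd T (Fin 3)))
  have hE : ∀ v, (E v).1 = P v := fun v => rfl
  let s : Finset α := Finset.univ.map ⟨key, hkey⟩
  let o : Fin s.card ≃o s := s.orderIsoOfFin rfl
  let q : V ≃ Fin s.card := (Equiv.ofBijective (fun v => (⟨key v, by simp [s]⟩ : s)) (by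
    constructor
    · intro a b h; exact hkey (by simpa using h)
    · rintro ⟨a, ha⟩
      obtain ⟨v, -, hv⟩ := Finset.mem_map.mp ha
      exact ⟨v, Subtype.ext hv⟩)).trans o.symm.toEquiv
  have hq : ∀ x y, q x < q y ↔ key x < key y := by
    intro x y
    change o.symm _ < o.symm _ ↔ _
    rw [OrderIso.lt_iff_lt]
    exact Iff.rfl
  obtain ⟨π, hπ⟩ := exists_perm_coloring (E.symm.trans q)
  refine ⟨fun v => π (E v).1 (E v).2, ?_, ?_⟩
  · intro x y hxy hz
    refine hπ (E x) (E y) ?_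
    simp only [Equiv.trans_apply, Equiv.symm_apply_apply]
    have h1 : (q x : ℕ) < q y := (hq x y).mpr hxy
    by_contra hne
    have hlt : (q x : ℕ) + 1 < s.card := by have := (q y).2; omega
    apply hz (q.symm ⟨q x + 1, hlt⟩)
    rw [← hq, ← hq, Equiv.apply_symm_apply, Fin.lt_def, Fin.lt_def]
    simp only
    omega
  · intro x y hP hc
    simp only [hE, hP] at hc
    have := (π (P y)).injective hc
    exact E.injective (Prod.ext ((hE x).trans (hP.trans (hE y).symm)) this)

/-- `l` enumerates the vertices of a path of `G`, in order. -/
structure IsPathList {W : Type*} (G : SimpleGraph W) (l : List W) : Prop where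
  nodup : l.Nodup
  adj : ∀ i (h : i + 1 < l.length), G.Adj l[i] l[i + 1]

/-- `l` enumerates the vertices of a cycle of `G`, in cyclic order. -/
structure IsCycleList {W : Type*} (G : SimpleGraph W) (l : List W) : Prop
    extends IsPathList G l where
  three_le : 3 ≤ l.length
  adj_last : G.Adj l[l.length - 1] l[0]

/-- Every vertex of `G` has at most two neighbours. -/
def DegreeLeTwo {W : Type*} (G : SimpleGraph W) : Prop :=
  ∀ x a b c, G.Adj x a → G.Adj x b → G.Adj x c → a = b ∨ a = c ∨ b = c

theorem IsPathList.eq_iff {W : Type*} {G : SimpleGraph W} {l : List W} (hl : IsPathList G l)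
    {i j : ℕ} (hi : i < l.length) (hj : j < l.length) : l[i] = l[j] ↔ i = j :=
  hl.nodup.getElem_inj_iff

theorem IsPathList.cons {W : Type*} {G : SimpleGraph W} {l : List W} (hl : IsPathList G l) {y : W}
    (hy : y ∉ l) (h : ∀ h0 : 0 < l.length, G.Adj y l[0]) : IsPathList G (y :: l) := by
  refine ⟨List.nodup_cons.mpr ⟨hy, hl.nodup⟩, fun i hi => ?_⟩
  cases i with
  | zero => simpa using h (by simpa using hi)
  | succ i => simpa using hl.adj i (by simpa using hi)

theorem IsPathList.reverse {W : Type*} {G : SimpleGraph W} {l : List W} (hl : IsPathList G l) :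
    IsPathList G l.reverse := by
  refine ⟨List.nodup_reverse.mpr hl.nodup, fun i hi => ?_⟩
  rw [List.length_reverse] at hi
  rw [List.getElem_reverse, List.getElem_reverse]
  have := hl.adj (l.length - 1 - (i + 1)) (by omega)
  rw [G.adj_comm]
  convert this using 3
  omega

theorem IsPathList.eq_succ_of_adj {W : Type*} {G : SimpleGraph W} (hG : DegreeLeTwo G) {l : List W}
    (hl : IsPathList G l) {i j : ℕ} (hij : i < j) (hj : j < l.length) (h : G.Adj l[i] l[j]) :
    j = i + 1 ∨ i = 0 ∧ j + 1 = l.length := by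
  by_contra! hc
  by_cases hi : i = 0
  · subst hi
    have h1 := hl.adj (j - 1) (by omega)
    have h2 := hl.adj j (by omega)
    simp only [Nat.sub_add_cancel (show 1 ≤ j by omega)] at h1
    rcases hG _ _ _ _ h1.symm h2 h.symm with h | h | h <;> rw [hl.eq_iff] at h <;> omega
  · have h1 := hl.adj (i - 1) (by omega)
    have h2 := hl.adj i (by omega)
    simp only [Nat.sub_add_cancel (show 1 ≤ i by omega)] at h1
    rcases hG _ _ _ _ h1.symm h2 h with h | h | h <;> rw [hl.eq_iff] at h <;> omega

theorem IsCycleList.adj_mod {W : Type*} {G : SimpleGraph W} {l : List W} (hl : IsCycleList G l)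
    (m : ℕ) : G.Adj (l[m % l.length]'(Nat.mod_lt _ (by have := hl.three_le; omega)))
      (l[(m + 1) % l.length]'(Nat.mod_lt _ (by have := hl.three_le; omega))) := by
  have h3 := hl.three_le
  have hm := Nat.mod_lt m (show 0 < l.length by omega)
  by_cases h : m % l.length + 1 < l.length
  · have := hl.adj _ h
    convert this using 2
    rw [Nat.add_mod, Nat.mod_eq_of_lt (show 1 < l.length by omega), Nat.mod_eq_of_lt h]
  · have := hl.adj_last
    convert this using 2
    · omega
    · rw [Nat.add_mod, Nat.mod_eq_of_lt (show 1 < l.length by omega),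
        show m % l.length + 1 = l.length by omega, Nat.mod_self]

theorem IsCycleList.exists_rotate {W : Type*} {G : SimpleGraph W} {l : List W}
    (hl : IsCycleList G l) {u : W} (hu : u ∈ l) :
    ∃ l', IsCycleList G l' ∧ (∀ x, x ∈ l' ↔ x ∈ l) ∧ ∀ h : l'.length - 1 < l'.length,
      l'[l'.length - 1] = u := by
  obtain ⟨n, hn, rfl⟩ := List.getElem_of_mem hu
  have h3 := hl.three_le
  refine ⟨l.rotate (n + 1), ⟨⟨List.nodup_rotate.mpr hl.nodup, fun i hi => ?_⟩, ?_, ?_⟩, ?_, ?_⟩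
  · rw [List.getElem_rotate, List.getElem_rotate]
    convert hl.adj_mod (i + (n + 1)) using 3
    omega
  · rwa [List.length_rotate]
  · rw [List.getElem_rotate, List.getElem_rotate]
    convert hl.adj_mod ((l.rotate (n + 1)).length - 1 + (n + 1)) using 2
    rw [List.length_rotate, show l.length - 1 + (n + 1) + 1 = 0 + (n + 1) + l.length by omega,
      Nat.add_mod_right]
  · intro x; exact List.mem_rotate
  · intro h
    rw [List.getElem_rotate]
    congr 1
    rw [List.length_rotate, show l.length - 1 + (n + 1) = n + l.length by omega, Nat.add_mod_right,
      Nat.mod_eq_of_lt hn]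

theorem exists_isPathList_component {W : Type*} [Fintype W] {G : SimpleGraph W}
    (hG : DegreeLeTwo G) (c : G.ConnectedComponent) :
    ∃ l, IsPathList G l ∧ ∀ x, x ∈ l ↔ G.connectedComponentMk x = c := by
  classical
  obtain ⟨v, rfl⟩ := c.exists_rep
  change ∃ l, IsPathList G l ∧ ∀ x, x ∈ l ↔ G.connectedComponentMk x = G.connectedComponentMk v
  let S : Set ℕ := {n | ∃ l, IsPathList G l ∧ l ≠ [] ∧
    (∀ x ∈ l, G.connectedComponentMk x = G.connectedComponentMk v) ∧ l.length = n}
  have hne : S.Nonempty := ⟨1, [v], ⟨by simp, fun i h => by simp at h⟩, by simp, by simp, rfl⟩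
  have hbd : BddAbove S := ⟨Fintype.card W, by
    rintro n ⟨l, hl, -, -, rfl⟩; exact hl.nodup.length_le_card⟩
  obtain ⟨l, hl, hl0, hlv, hlen⟩ := Nat.sSup_mem hne hbd
  have hmax : ∀ l', IsPathList G l' → l' ≠ [] →
      (∀ x ∈ l', G.connectedComponentMk x = G.connectedComponentMk v) →
      l'.length ≤ l.length := fun l' h1 h2 h3 => hlen ▸ le_csSup hbd ⟨l', h1, h2, h3, rfl⟩
  have hcl : ∀ x ∈ l, ∀ y, G.Adj x y → y ∈ l := by
    intro x hx y hxy
    by_contra hy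
    have hyv : G.connectedComponentMk y = G.connectedComponentMk v := by
      rw [← hlv x hx]
      exact (SimpleGraph.ConnectedComponent.connectedComponentMk_eq_of_adj hxy).symm
    obtain ⟨i, hi, rfl⟩ := List.getElem_of_mem hx
    by_cases h0 : i = 0
    · subst h0
      have := hmax (y :: l) (hl.cons hy fun _ => hxy.symm) (by simp)
        (List.forall_mem_cons.mpr ⟨hyv, hlv⟩)
      simp at this
    by_cases h1 : i + 1 = l.length
    · have := hmax (y :: l.reverse) (hl.reverse.cons (by simpa using hy) fun _ => ?_) (by simp)
        (List.forall_mem_cons.mpr ⟨hyv, by simpa using hlv⟩)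
      · simp at this
      · rw [List.getElem_reverse, G.adj_comm]
        convert hxy using 2
        omega
    have h2 := hl.adj (i - 1) (by omega)
    have h3 := hl.adj i (by omega)
    simp only [Nat.sub_add_cancel (show 1 ≤ i by omega)] at h2
    rcases hG _ _ _ _ h2.symm h3 hxy with h | h | h
    · rw [hl.eq_iff] at h; omega
    · exact hy (h ▸ List.getElem_mem _)
    · exact hy (h ▸ List.getElem_mem _)
  refine ⟨l, hl, fun x => ⟨hlv x, fun hx => ?_⟩⟩
  obtain ⟨u, hu⟩ := List.exists_mem_of_ne_nil l hl0
  have : G.Reachable u x := SimpleGraph.ConnectedComponent.exact ((hlv u hu).trans hx.symm)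
  obtain ⟨w⟩ := this
  clear hx
  induction w with
  | nil => exact hu
  | cons h _ ih => exact ih (hcl _ hu _ h)

theorem exists_three_coloring_compl {W ι : Type*} [Fintype W] [DecidableEq W] [Fintype ι]
    [DecidableEq ι] {G : SimpleGraph W} (hG : DegreeLeTwo G) (P : W → ι)
    (hP : ∀ i, (Finset.univ.filter fun v => P v = i).card = 4)
    (L : G.ConnectedComponent → List W) (hL : ∀ c, IsPathList G (L c))
    (hLm : ∀ c x, x ∈ L c ↔ G.connectedComponentMk x = c) (T : ι → W) (hT : ∀ i, P (T i) = i)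
    (hit : ∀ c, IsCycleList G (L c) → ∃ i, T i ∈ L c) :
    ∃ c : W → Fin 3, (∀ x y, G.Adj x y → x ∉ Set.range T → y ∉ Set.range T → c x ≠ c y) ∧
      ∀ x y, P x = P y → x ∉ Set.range T → y ∉ Set.range T → c x = c y → x = y := by
  classical
  have hL' : ∀ c, ∃ l, IsPathList G l ∧ (∀ x, x ∈ l ↔ G.connectedComponentMk x = c) ∧
      ∀ h : 3 ≤ l.length, G.Adj l[l.length - 1] l[0] → l[l.length - 1] ∈ Set.range T := by
    intro c
    by_cases hc : IsCycleList G (L c)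
    · obtain ⟨i, hi⟩ := hit c hc
      obtain ⟨l, hl, hm, hlast⟩ := hc.exists_rotate hi
      exact ⟨l, hl.toIsPathList, fun x => (hm x).trans (hLm c x), fun h _ => ⟨i, (hlast _).symm⟩⟩
    · exact ⟨L c, hL c, hLm c, fun h h' => absurd ⟨hL c, h, h'⟩ hc⟩
  choose L' hL' hLm' hlast using hL'
  let key : W → ℕ ×ₗ ℕ := fun x => toLex ((Fintype.equivFin G.ConnectedComponent
    (G.connectedComponentMk x) : ℕ), (L' (G.connectedComponentMk x)).idxOf x)
  have hmem : ∀ x, x ∈ L' (G.connectedComponentMk x) := fun x => (hLm' _ x).mpr rfl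
  have hkey : Function.Injective key := by
    intro x y h
    have h := toLex.injective h
    rw [Prod.mk.injEq, Fin.val_inj, EmbeddingLike.apply_eq_iff_eq] at h
    obtain ⟨h1, h2⟩ := h
    rw [h1] at h2
    exact (List.idxOf_inj (h1 ▸ hmem x)).mp h2
  obtain ⟨c, hc1, hc2⟩ := exists_three_coloring (V := {x // x ∉ Set.range T})
    (fun x => key x) (fun x y h => Subtype.ext (hkey h)) (fun x => P x) (by
      intro t
      have : (Finset.univ.filter fun v : {x // x ∉ Set.range T} => P v = t).card =
          ((Finset.univ.filter fun v => P v = t).erase (T t)).card := by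
        rw [← Finset.card_map (Function.Embedding.subtype _)]
        congr 1
        ext x
        simp only [Finset.mem_map, Finset.mem_filter, Finset.mem_univ, true_and, Finset.mem_erase,
          Function.Embedding.coe_subtype, Subtype.exists, exists_and_right, exists_eq_right,
          Set.mem_range, not_exists, exists_prop]
        refine ⟨fun ⟨h1, h2⟩ => ⟨fun h => h1 t h.symm, h2⟩, fun ⟨h1, h2⟩ => ⟨fun i hi => h1 ?_, h2⟩⟩
        rw [← hi, ← h2, ← hi, hT]
      rw [this, Finset.card_erase_of_mem (by simp [hT]), hP])
  refine ⟨fun x => if h : x ∉ Set.range T then c ⟨x, h⟩ else 0, ?_, ?_⟩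
  · have main : ∀ x y, G.Adj x y → ∀ (hx : x ∉ Set.range T) (hy : y ∉ Set.range T),
        (L' (G.connectedComponentMk x)).idxOf x < (L' (G.connectedComponentMk x)).idxOf y →
        c ⟨x, hx⟩ ≠ c ⟨y, hy⟩ := by
      intro x y hxy hx hy hlt
      have hcc : G.connectedComponentMk x = G.connectedComponentMk y :=
        SimpleGraph.ConnectedComponent.connectedComponentMk_eq_of_adj hxy
      set l := L' (G.connectedComponentMk x) with hl
      have hyl : y ∈ l := by rw [hl, hcc]; exact hmem y
      have hi := List.idxOf_lt_length_of_mem (hmem x)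
      have hj := List.idxOf_lt_length_of_mem hyl
      rw [← hl] at hi
      have hadj : G.Adj l[l.idxOf x] l[l.idxOf y] := by
        rwa [List.getElem_idxOf hi, List.getElem_idxOf hj]
      have hsucc : l.idxOf y = l.idxOf x + 1 := by
        by_contra hne
        obtain ⟨h0, h1⟩ := ((hL' _).eq_succ_of_adj hG hlt hj hadj).resolve_left hne
        refine hy ?_
        have := hlast (G.connectedComponentMk x) (by omega) ?_
        · convert this
          refine (List.getElem_idxOf hj).symm.trans ?_
          rw [← hl] at h1
          simp only [← hl]
          congr 1
          omega
        · convert hadj.symm using 2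
          · omega
          · exact h0.symm
      have hkx : key x = toLex ((Fintype.equivFin _ (G.connectedComponentMk x) : ℕ), l.idxOf x) := rfl
      have hky : key y = toLex ((Fintype.equivFin _ (G.connectedComponentMk x) : ℕ), l.idxOf y) := by
        simp only [key, ← hcc, ← hl]
      refine hc1 _ _ ?_ ?_
      · simp only [hkx, hky, Prod.Lex.toLex_lt_toLex]
        exact Or.inr ⟨trivial, hlt⟩
      · rintro z ⟨hz1, hz2⟩
        simp only [hkx, hky, key, Prod.Lex.toLex_lt_toLex] at hz1 hz2
        omega
    intro x y hxy hx hy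
    simp only [dif_pos hx, dif_pos hy]
    have hcc : G.connectedComponentMk x = G.connectedComponentMk y :=
      SimpleGraph.ConnectedComponent.connectedComponentMk_eq_of_adj hxy
    rcases lt_trichotomy ((L' (G.connectedComponentMk x)).idxOf x)
      ((L' (G.connectedComponentMk x)).idxOf y) with h | h | h
    · exact main x y hxy hx hy h
    · exact absurd ((List.idxOf_inj (hmem x)).mp h) hxy.ne
    · exact (main y x hxy.symm hy hx (hcc ▸ h)).symm
  · intro x y hP hx hy h
    simp only [dif_pos hx, dif_pos hy] at h
    exact congrArg Subtype.val (hc2 _ _ hP h)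

theorem exists_cycle_representatives {W ι : Type*} [Fintype W] [DecidableEq W] [Fintype ι]
    [DecidableEq ι] {G : SimpleGraph W} (P : W → ι)
    (hP : ∀ i, (Finset.univ.filter fun v => P v = i).card = 4)
    (L : G.ConnectedComponent → List W)
    (hLm : ∀ c x, x ∈ L c ↔ G.connectedComponentMk x = c)
    (h3 : ∀ S : Finset (Finset W), (∀ s ∈ S, s.card = 3 ∧ ∃ l, IsCycleList G l ∧ l.toFinset = s) →
      S.card ≤ 3) :
    ∃ r : {c // IsCycleList G (L c)} → W, (∀ c, r c ∈ L c.1) ∧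
      Function.Injective fun c => P (r c) := by
  classical
  have hdisj : ∀ c c', c ≠ c' → Disjoint (L c).toFinset (L c').toFinset := by
    intro c c' hne
    rw [Finset.disjoint_left]
    intro x hx hx'
    simp only [List.mem_toFinset, hLm] at hx hx'
    exact hne (hx.symm.trans hx')
  obtain ⟨f, hf, hfm⟩ := (Finset.all_card_le_biUnion_card_iff_exists_injective
    fun c : {c // IsCycleList G (L c)} => (L c.1).toFinset.image P).mp (by
      intro s
      have h1 : (s.biUnion fun c => (L c.1).toFinset).card = ∑ c ∈ s, (L c.1).toFinset.card :=
        Finset.card_biUnion fun c _ c' _ hne => hdisj _ _ fun h => hne (Subtype.ext h)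
      have h2 : (s.biUnion fun c => (L c.1).toFinset).card ≤
          4 * (s.biUnion fun c => (L c.1).toFinset.image P).card := by
        refine Finset.card_le_mul_card_image_of_maps_to (f := P) ?_ 4 fun i _ => ?_
        · intro x hx
          simp only [Finset.mem_biUnion, Finset.mem_image] at hx ⊢
          obtain ⟨c, hc, hx⟩ := hx
          exact ⟨c, hc, x, hx, rfl⟩
        · rw [← hP i]
          exact Finset.card_le_card (Finset.filter_subset_filter _ (Finset.subset_univ _))
      have h4 : (s.filter fun c => (L c.1).toFinset.card = 3).card ≤ 3 := by
        refine le_trans (Finset.card_image_of_injOn (f := fun c => (L c.1).toFinset) ?_).ge (h3 _ ?_)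
        · intro c _ c' _ h
          by_contra hne
          have h : (L c.1).toFinset = (L c'.1).toFinset := h
          have := hdisj _ _ fun h => hne (Subtype.ext h)
          rw [← h, disjoint_self, Finset.bot_eq_empty, List.toFinset_eq_empty_iff] at this
          have h3 := c.2.three_le
          simp [this] at h3
        · simp only [Finset.mem_image, Finset.mem_filter]
          rintro _ ⟨c, ⟨-, hc⟩, rfl⟩
          exact ⟨hc, _, c.2, rfl⟩
      have h5 : ∑ c ∈ s, 4 ≤ ∑ c ∈ s, ((L c.1).toFinset.card +
          if (L c.1).toFinset.card = 3 then 1 else 0) := by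
        refine Finset.sum_le_sum fun c _ => ?_
        have h3 := c.2.three_le
        rw [← List.toFinset_card_of_nodup c.2.nodup] at h3
        split_ifs <;> omega
      rw [Finset.sum_add_distrib, ← Finset.card_filter, Finset.sum_const, smul_eq_mul] at h5
      omega)
  simp only [Finset.mem_image, List.mem_toFinset] at hfm
  choose r hr hrf using hfm
  exact ⟨r, hr, by simpa only [hrf] using hf⟩

theorem exists_coloring_of_few_triangles {W ι : Type*} [Fintype W] [DecidableEq W] [Fintype ι]
    [DecidableEq ι] {G : SimpleGraph W} (hG : DegreeLeTwo G) (P : W → ι)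
    (hP : ∀ i, (Finset.univ.filter fun v => P v = i).card = 4)
    (h3 : ∀ S : Finset (Finset W), (∀ s ∈ S, s.card = 3 ∧ ∃ l, IsCycleList G l ∧ l.toFinset = s) →
      S.card ≤ 3) :
    ∃ c : W → Fin 4, (∀ x y, G.Adj x y → c x ≠ c y) ∧ ∀ x y, P x = P y → c x = c y → x = y := by
  classical
  choose L hL hLm using exists_isPathList_component hG
  obtain ⟨r, hr, hinj⟩ := exists_cycle_representatives P hP L hLm h3
  have hne : ∀ i, ∃ x, P x = i := by
    intro i
    have : (Finset.univ.filter fun v => P v = i).Nonempty := by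
      rw [← Finset.card_pos, hP]; norm_num
    obtain ⟨x, hx⟩ := this
    exact ⟨x, by simpa using hx⟩
  choose T₀ hT₀ using hne
  obtain ⟨T, hT, hTr⟩ : ∃ T : ι → W, (∀ i, P (T i) = i) ∧ ∀ c, T (P (r c)) = r c := by
    refine ⟨fun i => if h : ∃ c, P (r c) = i then r h.choose else T₀ i, fun i => ?_, fun c => ?_⟩
    · dsimp only
      split_ifs with h
      · exact h.choose_spec
      · exact hT₀ i
    · have h : ∃ c', P (r c') = P (r c) := ⟨c, rfl⟩
      simp only [dif_pos h]
      exact congrArg r (hinj h.choose_spec)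
  obtain ⟨c₀, hc1, hc2⟩ := exists_three_coloring_compl hG P hP L hL hLm T hT
    fun c hc => ⟨P (r ⟨c, hc⟩), by rw [hTr]; exact hr ⟨c, hc⟩⟩
  let S : Finset (ι → W) := Finset.univ.filter fun T => (∀ i, P (T i) = i) ∧
    ∀ i j, ¬ G.Adj (T i) (T j)
  have hS : S.Nonempty := by
    have : ∀ i, ∃ x, P x = i ∧ x ∉ Set.range T ∧ c₀ x = 0 := by
      intro i
      have hcard : ((Finset.univ.filter fun v => P v = i).erase (T i)).card = 3 := by
        rw [Finset.card_erase_of_mem (by simp [hT]), hP]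
      have hmem : ∀ x ∈ (Finset.univ.filter fun v => P v = i).erase (T i),
          P x = i ∧ x ∉ Set.range T := by
        intro x hx
        simp only [Finset.mem_erase, Finset.mem_filter, Finset.mem_univ, true_and] at hx
        refine ⟨hx.2, fun ⟨j, hj⟩ => hx.1 ?_⟩
        rw [← hj, ← hx.2, ← hj, hT]
      have himg : ((Finset.univ.filter fun v => P v = i).erase (T i)).image c₀ = Finset.univ := by
        rw [← Finset.card_eq_iff_eq_univ, Finset.card_image_of_injOn, hcard, Fintype.card_fin]
        intro x hx y hy h
        obtain ⟨hx1, hx2⟩ := hmem x hx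
        obtain ⟨hy1, hy2⟩ := hmem y hy
        exact hc2 x y (hx1.trans hy1.symm) hx2 hy2 h
      obtain ⟨x, hx, hx0⟩ := Finset.mem_image.mp (himg ▸ Finset.mem_univ (0 : Fin 3))
      exact ⟨x, (hmem x hx).1, (hmem x hx).2, hx0⟩
    choose T₁ h1 h2 h3 using this
    refine ⟨T₁, ?_⟩
    simp only [S, Finset.mem_filter, Finset.mem_univ, true_and]
    exact ⟨h1, fun i j h => hc1 _ _ h (h2 i) (h2 j) ((h3 i).trans (h3 j).symm)⟩
  obtain ⟨T₂, hT₂, hmax⟩ := Finset.exists_max_image S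
    (fun T => (Finset.univ.filter fun c => T (P (r c)) = r c).card) hS
  simp only [S, Finset.mem_filter, Finset.mem_univ, true_and] at hT₂
  obtain ⟨hT₂, hind⟩ := hT₂
  have hhit : ∀ c, IsCycleList G (L c) → ∃ i, T₂ i ∈ L c := by
    intro c hc
    by_contra! hno
    set x := r ⟨c, hc⟩ with hx
    have hxc : x ∈ L c := hr ⟨c, hc⟩
    have hnadj : ∀ i, ¬ G.Adj (T₂ i) x := by
      intro i h
      refine hno i ((hLm _ _).mpr ?_)
      rw [SimpleGraph.ConnectedComponent.connectedComponentMk_eq_of_adj h]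
      exact (hLm _ _).mp hxc
    have hmem : Function.update T₂ (P x) x ∈ S := by
      simp only [S, Finset.mem_filter, Finset.mem_univ, true_and]
      constructor
      · intro i
        by_cases h : i = P x
        · subst h; simp
        · rw [Function.update_of_ne h, hT₂]
      · intro i j
        by_cases h : i = P x <;> by_cases h' : j = P x
        · subst h; subst h'; simp
        · subst h; rw [Function.update_self, Function.update_of_ne h', G.adj_comm]; exact hnadj j
        · subst h'; rw [Function.update_self, Function.update_of_ne h]; exact hnadj i
        · rw [Function.update_of_ne h, Function.update_of_ne h']; exact hind i j
    refine absurd (hmax _ hmem) (not_le.mpr (Finset.card_lt_card ?_))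
    rw [Finset.ssubset_iff_of_subset]
    · refine ⟨⟨c, hc⟩, ?_, ?_⟩
      · simp [← hx]
      · simp only [Finset.mem_filter, Finset.mem_univ, true_and]
        intro h
        exact hno _ (h ▸ hr ⟨c, hc⟩)
    · intro c' hc'
      simp only [Finset.mem_filter, Finset.mem_univ, true_and] at hc' ⊢
      by_cases h : c' = ⟨c, hc⟩
      · subst h; simp [← hx]
      · rw [Function.update_of_ne (fun h' => h (hinj h')), hc']
  obtain ⟨c₁, hd1, hd2⟩ := exists_three_coloring_compl hG P hP L hL hLm T₂ hT₂ hhit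
  refine ⟨fun x => if x ∈ Set.range T₂ then Fin.last 3 else (c₁ x).castSucc, ?_, ?_⟩
  · intro x y h
    dsimp only
    split_ifs with hx hy hy
    · obtain ⟨i, rfl⟩ := hx; obtain ⟨j, rfl⟩ := hy
      exact absurd h (hind i j)
    · exact (Fin.castSucc_lt_last _).ne'
    · exact (Fin.castSucc_lt_last _).ne
    · exact fun h' => hd1 x y h hx hy (Fin.castSucc_injective _ h')
  · intro x y h
    dsimp only
    split_ifs with hx hy hy
    · obtain ⟨i, rfl⟩ := hx; obtain ⟨j, rfl⟩ := hy
      rw [hT₂, hT₂] at h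
      exact fun _ => h ▸ rfl
    · exact fun h' => absurd h' (Fin.castSucc_lt_last _).ne'
    · exact fun h' => absurd h' (Fin.castSucc_lt_last _).ne
    · exact fun h' => hd2 x y h hx hy (Fin.castSucc_injective _ h')

theorem exists_alternating_extension {W : Type*} [DecidableEq W] (M : W → W) (S : Finset W)
    (hM : ∀ x ∈ S, M x ∈ S ∧ M (M x) = x) (P : W → W)
    (hP : ∀ x ∈ S, P x ∈ S ∧ P (P x) = x ∧ P x ≠ x) :
    ∃ τ : W → W, (∀ x ∈ S, M x = x → τ x ∈ S ∧ M (τ x) = τ x ∧ τ (τ x) = x ∧ τ x ≠ x) ∧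
      ∀ f₀ : W → Bool, (∀ x ∈ S, M x = x → f₀ (τ x) ≠ f₀ x) →
        ∃ f : W → Bool, (∀ x ∈ S, M x = x → f x = f₀ x) ∧
          ∀ x ∈ S, f (P x) ≠ f x ∧ (M x ≠ x → f (M x) ≠ f x) := by
  induction hn : S.card using Nat.strong_induction_on generalizing S P with
  | _ n ih =>
  by_cases hfix : ∀ x ∈ S, M x = x
  · exact ⟨P, fun x hx _ => ⟨(hP x hx).1, hfix _ (hP x hx).1, (hP x hx).2⟩, fun f₀ hf₀ =>
      ⟨f₀, fun _ _ _ => rfl, fun x hx => ⟨hf₀ x hx (hfix x hx), fun h => absurd (hfix x hx) h⟩⟩⟩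
  push Not at hfix
  obtain ⟨a, ha, hab⟩ := hfix
  obtain ⟨b, hb⟩ : ∃ b, M a = b := ⟨_, rfl⟩
  rw [hb] at hab
  have hbS : b ∈ S := hb ▸ (hM a ha).1
  have hba : M b = a := hb ▸ (hM a ha).2
  have hmem : ∀ x, x ∈ S \ {a, b} ↔ x ∈ S ∧ x ≠ a ∧ x ≠ b := by simp
  obtain ⟨τ, h1, h2⟩ := ih (S \ {a, b}).card
    (hn ▸ Finset.card_lt_card ((Finset.ssubset_iff_of_subset Finset.sdiff_subset).mpr
      ⟨a, ha, by simp⟩)) (S \ {a, b})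
    (by
      intro x hx
      rw [hmem] at hx ⊢
      obtain ⟨hx, hxa, hxb⟩ := hx
      have := hM x hx
      exact ⟨⟨this.1, fun h => hxb (by rw [← this.2, h, hb]),
        fun h => hxa (by rw [← this.2, h, hba])⟩,
        this.2⟩)
    (fun x => if P x = a then P b else if P x = b then P a else P x)
    (by
      intro x hx
      rw [hmem] at hx
      have hPx := hP x hx.1
      have hPa := hP a ha
      have hPb := hP b hbS
      simp only [hmem]
      grind) rfl
  refine ⟨τ, fun x hx hMx => ?_, fun f₀ hf₀ => ?_⟩
  · have hx' : x ∈ S \ {a, b} := by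
      rw [hmem]; exact ⟨hx, by rintro rfl; exact hab (hb ▸ hMx), by rintro rfl; grind⟩
    obtain ⟨h3, h4⟩ := h1 x hx' hMx
    exact ⟨((hmem _).mp h3).1, h4⟩
  · obtain ⟨f, hf1, hf2⟩ := h2 f₀ fun x hx hMx => hf₀ x ((hmem x).mp hx).1 hMx
    simp only [hmem] at hf1 hf2
    refine ⟨fun x => if x = a then (if P a = b then true else !f (P a)) else
      if x = b then (if P a = b then false else !f (P b)) else f x, ?_, ?_⟩
    · intro x hx hMx
      have := hf1 x
      grind
    · have hPa := hP a ha
      have hPb := hP b hbS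
      have hab' : (if P a = b then true else !f (P a)) ≠ (if P a = b then false else !f (P b)) := by
        split_ifs with h
        · decide
        · have := (hf2 (P a) ⟨hPa.1, hPa.2.2, h⟩).1
          rw [hPa.2.1, if_pos rfl] at this
          simpa using this.symm
      intro x hx
      have hPx := hP x hx
      have hMx := hM x hx
      have hfx := hf2 x
      clear ih h1 h2 hf₀ hf1 hf2 hmem hP hM hn
      constructor
      · dsimp only
        grind
      · intro hMne
        dsimp only
        by_cases hxa : x = a
        · subst hxa
          rw [hb, if_pos rfl, if_neg hab, if_pos rfl]
          exact hab'.symm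
        by_cases hxb : x = b
        · subst hxb
          rw [hba, if_pos rfl, if_neg hab, if_pos rfl]
          exact hab'
        have h1 : M x ≠ a := fun h => hxb (by rw [← hMx.2, h, hb])
        have h2 : M x ≠ b := fun h => hxa (by rw [← hMx.2, h, hba])
        rw [if_neg h1, if_neg h2, if_neg hxa, if_neg hxb]
        exact (hfx ⟨hx, hxa, hxb⟩).2 hMne

theorem exists_bool_ne_of_involution {W : Type*} [Fintype W] (τ : W → W) (p : W → Prop)
    (hτ : ∀ x, p x → τ (τ x) = x ∧ τ x ≠ x) : ∃ f : W → Bool, ∀ x, p x → f (τ x) ≠ f x := by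
  refine ⟨fun x => decide (Fintype.equivFin W x < Fintype.equivFin W (τ x)), fun x hx => ?_⟩
  obtain ⟨h1, h2⟩ := hτ x hx
  have h3 : Fintype.equivFin W (τ x) ≠ Fintype.equivFin W x := fun h => h2 (Equiv.injective _ h)
  simp only [h1, ne_eq, decide_eq_decide]
  omega

theorem exists_alternating {W : Type*} [Fintype W] [DecidableEq W] (S : Finset W) (P M : W → W)
    (hP : ∀ x ∈ S, P x ∈ S ∧ P (P x) = x ∧ P x ≠ x) (hM : ∀ x ∈ S, M x ∈ S ∧ M (M x) = x) :
    ∃ f : W → Bool, ∀ x ∈ S, f (P x) ≠ f x ∧ (M x ≠ x → f (M x) ≠ f x) := by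
  obtain ⟨τ, h1, h2⟩ := exists_alternating_extension M S hM P hP
  obtain ⟨f₀, hf₀⟩ := exists_bool_ne_of_involution τ (fun x => x ∈ S ∧ M x = x)
    fun x hx => (h1 x hx.1 hx.2).2.2
  obtain ⟨f, -, hf⟩ := h2 f₀ fun x hx hMx => hf₀ x ⟨hx, hMx⟩
  exact ⟨f, hf⟩

theorem exists_coloring_of_bool {W ι : Type*} [Fintype W] [DecidableEq W]
    {G : SimpleGraph W} (e : W ≃ ι × Fin 4) (f : W → Bool)
    (h01 : ∀ i, f (e.symm (i, 0)) ≠ f (e.symm (i, 1)))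
    (h23 : ∀ i, f (e.symm (i, 2)) ≠ f (e.symm (i, 3)))
    (hf : ∀ x y z, G.Adj x y → G.Adj x z → f y = f x → f z = f x → y = z) :
    ∃ c : W → Fin 4, (∀ x y, G.Adj x y → c x ≠ c y) ∧
      ∀ x y, (e x).1 = (e y).1 → c x = c y → x = y := by
  classical
  have key : ∀ h : Fin 4 → Bool, h 0 ≠ h 1 → h 2 ≠ h 3 → ∀ k, ∃ k', k' ≠ k ∧ h k' = h k ∧
      ∀ m, m ≠ k → h m = h k → m = k' := by decide
  have hP : ∀ x, ∃ y, y ≠ x ∧ (e y).1 = (e x).1 ∧ f y = f x ∧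
      ∀ z, z ≠ x → (e z).1 = (e x).1 → f z = f x → z = y := by
    intro x
    obtain ⟨⟨i, k⟩, rfl⟩ := e.symm.surjective x
    obtain ⟨k', h1, h2, h3⟩ := key (fun k => f (e.symm (i, k))) (h01 i) (h23 i) k
    refine ⟨e.symm (i, k'), by simpa using h1, by simp, h2, fun z hz hz1 hz2 => ?_⟩
    obtain ⟨⟨j, m⟩, rfl⟩ := e.symm.surjective z
    simp only [Equiv.apply_symm_apply] at hz1
    subst hz1
    rw [h3 m (by simpa using hz) hz2]
  choose P hP1 hP2 hP3 hP4 using hP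
  let M : W → W := fun x => if h : ∃ y, G.Adj x y ∧ f y = f x then h.choose else x
  have hM : ∀ x y, G.Adj x y → f y = f x → M x = y := by
    intro x y hxy hfy
    have h : ∃ y, G.Adj x y ∧ f y = f x := ⟨y, hxy, hfy⟩
    simp only [M, dif_pos h]
    exact hf x _ _ h.choose_spec.1 hxy h.choose_spec.2 hfy
  obtain ⟨g, hg⟩ := exists_alternating Finset.univ P M
    (fun x _ => ⟨Finset.mem_univ _, (hP4 (P x) x (hP1 x).symm (hP2 x).symm (hP3 x).symm).symm,
      hP1 x⟩)
    (fun x _ => ⟨Finset.mem_univ _, by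
      by_cases h : ∃ y, G.Adj x y ∧ f y = f x
      · obtain ⟨y, hy, hfy⟩ := h
        rw [hM x y hy hfy, hM y x hy.symm hfy.symm]
      · have : M x = x := dif_neg h
        rw [this, this]⟩)
  let E : Bool × Bool ≃ Fin 4 := Fintype.equivFinOfCardEq rfl
  refine ⟨fun x => E (f x, g x), fun x y hxy h => ?_, fun x y hxy h => ?_⟩
  · obtain ⟨h1, h2⟩ := Prod.mk.inj (E.injective h)
    have := hM x y hxy h1.symm
    refine (hg x (Finset.mem_univ _)).2 ?_ ?_
    · rw [this]; exact hxy.ne'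
    · rw [this, h2]
  · obtain ⟨h1, h2⟩ := Prod.mk.inj (E.injective h)
    by_contra hne
    have := hP4 x y (Ne.symm hne) hxy.symm h1.symm
    exact (hg x (Finset.mem_univ _)).1 (by rw [← this, h2])

/-- The partner of `x` when the entries of `l` at positions `2 * i` and `2 * i + 1` are paired up;
an unpaired last entry, and any element not in `l`, is its own partner. -/
def List.mate {W : Type*} [DecidableEq W] (l : List W) (x : W) : W :=
  if x ∈ l then l.getD (if Even (l.idxOf x) then l.idxOf x + 1 else l.idxOf x - 1) x else x

theorem List.mate_getElem_even {W : Type*} [DecidableEq W] {l : List W} (hl : l.Nodup) {i : ℕ}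
    (hi : i + 1 < l.length) (he : Even i) : l.mate l[i] = l[i + 1] := by
  rw [List.mate, if_pos (List.getElem_mem _), hl.idxOf_getElem, if_pos he,
    List.getD_eq_getElem _ _ hi]

theorem List.mate_getElem_odd {W : Type*} [DecidableEq W] {l : List W} (hl : l.Nodup) {i : ℕ}
    (hi : i + 1 < l.length) (he : Even i) : l.mate l[i + 1] = l[i] := by
  rw [List.mate, if_pos (List.getElem_mem _), hl.idxOf_getElem,
    if_neg (by rw [Nat.even_add_one]; exact not_not.mpr he), Nat.add_sub_cancel,
    List.getD_eq_getElem _ _ (by omega)]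

theorem List.mate_getElem_last {W : Type*} [DecidableEq W] {l : List W} (hl : l.Nodup) {i : ℕ}
    (hi : i < l.length) (hi' : i + 1 = l.length) (he : Even i) : l.mate l[i] = l[i] := by
  rw [List.mate, if_pos (List.getElem_mem _), hl.idxOf_getElem, if_pos he,
    List.getD_eq_default _ _ hi'.ge]

/-- The three possible relations between an entry of a list and its partner. -/
theorem List.mate_cases {W : Type*} [DecidableEq W] {l : List W} (hl : l.Nodup) {x : W}
    (hx : x ∈ l) :
    (∃ (i : ℕ) (h : i + 1 < l.length), x = l[i] ∧ l.mate x = l[i + 1] ∧ l.mate (l.mate x) = x) ∨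
    (∃ (i : ℕ) (h : i + 1 < l.length), x = l[i + 1] ∧ l.mate x = l[i] ∧ l.mate (l.mate x) = x) ∨
    (Odd l.length ∧ ∃ h : l.length - 1 < l.length, x = l[l.length - 1] ∧ l.mate x = x) := by
  obtain ⟨i, hi, rfl⟩ := List.getElem_of_mem hx
  by_cases he : Even i
  · by_cases h : i + 1 < l.length
    · refine Or.inl ⟨i, h, rfl, List.mate_getElem_even hl h he, ?_⟩
      rw [List.mate_getElem_even hl h he, List.mate_getElem_odd hl h he]
    · have h' : i + 1 = l.length := by omega
      refine Or.inr (Or.inr ⟨h' ▸ he.add_one, by omega, ?_, List.mate_getElem_last hl hi h' he⟩)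
      congr 1
      omega
  · obtain ⟨j, rfl⟩ : ∃ j, i = j + 1 := ⟨i - 1, by
      have : i ≠ 0 := by rintro rfl; simp at he
      omega⟩
    rw [Nat.even_add_one, not_not] at he
    refine Or.inr (Or.inl ⟨j, hi, rfl, List.mate_getElem_odd hl hi he, ?_⟩)
    rw [List.mate_getElem_odd hl hi he, List.mate_getElem_even hl hi he]

theorem List.mate_mem {W : Type*} [DecidableEq W] {l : List W} (hl : l.Nodup) {x : W}
    (hx : x ∈ l) : l.mate x ∈ l := by
  rcases List.mate_cases hl hx with ⟨i, h, -, h', -⟩ | ⟨i, h, -, h', -⟩ | ⟨-, h, -, h'⟩ <;> rw [h']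
  · exact List.getElem_mem _
  · exact List.getElem_mem _
  · exact hx

theorem List.mate_mate {W : Type*} [DecidableEq W] {l : List W} (hl : l.Nodup) {x : W}
    (hx : x ∈ l) : l.mate (l.mate x) = x := by
  rcases List.mate_cases hl hx with ⟨i, h, -, -, h'⟩ | ⟨i, h, -, -, h'⟩ | ⟨-, h, -, h'⟩
  · exact h'
  · exact h'
  · rw [h', h']

theorem IsPathList.adj_mate {W : Type*} [DecidableEq W] {G : SimpleGraph W} {l : List W}
    (hl : IsPathList G l) {x : W} (hx : x ∈ l) (hne : l.mate x ≠ x) : G.Adj x (l.mate x) := by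
  rcases List.mate_cases hl.nodup hx with ⟨i, h, h1, h', -⟩ | ⟨i, h, h1, h', -⟩ | ⟨-, h, -, h'⟩
  · rw [h', h1]; exact hl.adj i h
  · rw [h', h1]; exact (hl.adj i h).symm
  · exact absurd h' hne

theorem eq_of_alternating {W : Type*} [DecidableEq W] {G : SimpleGraph W} (hG : DegreeLeTwo G)
    {l : List W} (hl : IsPathList G l) (f : W → Bool)
    (hf : ∀ x ∈ l, l.mate x ≠ x → f (l.mate x) ≠ f x)
    (hcyc : ∀ (_ : IsCycleList G l) (_ : Odd l.length) (_ : 3 < l.length),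
      f l[l.length - 1] ≠ f l[0])
    {x y z : W} (hx : x ∈ l) (hy : y ∈ l) (hz : z ∈ l) (hxy : G.Adj x y) (hxz : G.Adj x z)
    (hfy : f y = f x) (hfz : f z = f x) : y = z := by
  by_cases hm : l.mate x = x
  swap
  · have h1 := hf x hx hm
    rcases hG x _ _ _ (hl.adj_mate hx hm) hxy hxz with h | h | h
    · exact absurd (h ▸ hfy) h1
    · exact absurd (h ▸ hfz) h1
    · exact h
  have hlast : Odd l.length ∧ ∃ h : l.length - 1 < l.length, x = l[l.length - 1] := by
    rcases List.mate_cases hl.nodup hx with ⟨i, h, h1, h', -⟩ | ⟨i, h, h1, h', -⟩ | ⟨h0, h, h1, h'⟩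
    · rw [hm, h1, hl.eq_iff] at h'; omega
    · rw [hm, h1, hl.eq_iff] at h'; omega
    · exact ⟨h0, h, h1⟩
  obtain ⟨hodd, hlt, rfl⟩ := hlast
  have hnotadj0 : ∀ h3 : 3 ≤ l.length, G.Adj l[l.length - 1] l[0] → f l[0] ≠ f l[l.length - 1] ∨
      l.length = 3 := by
    intro h3 h
    by_cases h4 : l.length = 3
    · exact Or.inr h4
    · exact Or.inl (hcyc ⟨hl, h3, h⟩ hodd (by omega)).symm
  obtain ⟨i, hi, rfl⟩ := List.getElem_of_mem hy
  obtain ⟨j, hj, rfl⟩ := List.getElem_of_mem hz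
  have hine : i ≠ l.length - 1 := by rintro rfl; exact hxy.ne rfl
  have hjne : j ≠ l.length - 1 := by rintro rfl; exact hxz.ne rfl
  rw [hl.eq_iff]
  have hi' := hl.eq_succ_of_adj hG (show i < l.length - 1 by omega) hlt hxy.symm
  have hj' := hl.eq_succ_of_adj hG (show j < l.length - 1 by omega) hlt hxz.symm
  by_contra hij
  have key : ∀ a b : ℕ, ∀ (ha : a < l.length) (hb : b < l.length), a = 0 → l.length - 1 = b + 1 →
      a ≠ b → G.Adj l[l.length - 1] l[a] → f l[a] = f l[l.length - 1] →
      f l[b] = f l[l.length - 1] → False := by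
    rintro a b ha hb rfl hb' hab hadj h1 h2
    rcases hnotadj0 (by omega) hadj with h | h
    · exact h h1
    · obtain rfl : b = 1 := by omega
      have hmate := List.mate_getElem_even hl.nodup (i := 0) (by omega) (by simp)
      have := hf l[0] (List.getElem_mem _) (by rw [hmate, ne_eq, hl.eq_iff]; omega)
      rw [hmate] at this
      exact this (h2.trans h1.symm)
  rcases hi' with hi' | hi' <;> rcases hj' with hj' | hj'
  · omega
  · exact key j i hj hi hj'.1 hi' (Ne.symm hij) hxz hfz hfy
  · exact key i j hi hj hi'.1 hj' hij hxy hfy hfz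
  · omega

theorem exists_mem_apply_notMem_of_odd {W : Type*} {C : Finset W} (hC : Odd C.card) (τ : W → W)
    (hτ : ∀ x ∈ C, τ (τ x) = x ∧ τ x ≠ x) : ∃ u ∈ C, τ u ∉ C := by
  by_contra! h
  have h0 : ∑ x ∈ C, (1 : ZMod 2) = 0 :=
    Finset.sum_involution (fun x _ => τ x) (fun _ _ => by decide) (fun x hx _ => (hτ x hx).2)
      (fun x hx => h x hx) fun x hx => (hτ x hx).1
  rw [Finset.sum_const, nsmul_eq_mul, mul_one, ZMod.natCast_eq_zero_iff_even] at h0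
  exact Nat.not_even_iff_odd.mpr hC h0

theorem exists_alternating_of_listing {W : Type*} [Fintype W] [DecidableEq W] {G : SimpleGraph W}
    (P : W → W) (hP : ∀ x, P (P x) = x ∧ P x ≠ x)
    (L : G.ConnectedComponent → List W) (hL : ∀ c, (L c).Nodup)
    (hLm : ∀ c x, x ∈ L c ↔ G.connectedComponentMk x = c) :
    ∃ f : W → Bool, (∀ x, f (P x) ≠ f x) ∧
      ∀ c, ∀ x ∈ L c, (L c).mate x ≠ x → f ((L c).mate x) ≠ f x := by
  have hmem : ∀ x, x ∈ L (G.connectedComponentMk x) := fun x => (hLm _ x).mpr rfl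
  obtain ⟨f, hf⟩ := exists_alternating Finset.univ P
    (fun x => (L (G.connectedComponentMk x)).mate x)
    (fun x _ => ⟨Finset.mem_univ _, hP x⟩)
    (fun x _ => ⟨Finset.mem_univ _, by
      rw [(hLm _ _).mp (List.mate_mem (hL _) (hmem x)), List.mate_mate (hL _) (hmem x)]⟩)
  simp only [Finset.mem_univ, true_imp_iff] at hf
  refine ⟨f, fun x => (hf x).1, fun c x hx => ?_⟩
  obtain rfl := (hLm c x).mp hx
  exact (hf x).2

theorem exists_alternating_of_odd_cycle {W : Type*} [Fintype W] [DecidableEq W]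
    {G : SimpleGraph W} (P : W → W) (hP : ∀ x, P (P x) = x ∧ P x ≠ x)
    (L : G.ConnectedComponent → List W) (hL : ∀ c, IsPathList G (L c))
    (hLm : ∀ c x, x ∈ L c ↔ G.connectedComponentMk x = c)
    (c₀ : G.ConnectedComponent) (hc₀ : IsCycleList G (L c₀)) (hodd : Odd (L c₀).length) :
    ∃ (l : List W) (f : W → Bool), IsCycleList G l ∧ (∀ x, x ∈ l ↔ x ∈ L c₀) ∧
      (∀ x, f (P x) ≠ f x) ∧
      (∀ c ≠ c₀, ∀ x ∈ L c, (L c).mate x ≠ x → f ((L c).mate x) ≠ f x) ∧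
      (∀ x ∈ l, l.mate x ≠ x → f (l.mate x) ≠ f x) ∧
      ∀ _ : 3 ≤ l.length, f l[l.length - 1] ≠ f l[0] := by
  classical
  have hmem : ∀ x, x ∈ L (G.connectedComponentMk x) := fun x => (hLm _ x).mpr rfl
  let M : W → W := fun x => if x ∈ L c₀ then x else (L (G.connectedComponentMk x)).mate x
  have hMpos : ∀ x ∈ L c₀, M x = x := fun x hx => if_pos hx
  have hMneg : ∀ x ∉ L c₀, M x = (L (G.connectedComponentMk x)).mate x := fun x hx => if_neg hx
  obtain ⟨τ, hτ, hext⟩ := exists_alternating_extension M Finset.univ (fun x _ => by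
    refine ⟨Finset.mem_univ _, ?_⟩
    by_cases hx : x ∈ L c₀
    · rw [hMpos x hx, hMpos x hx]
    · have h1 := (hLm _ _).mp (List.mate_mem (hL _).nodup (hmem x))
      have h2 : (L (G.connectedComponentMk x)).mate x ∉ L c₀ := by
        rwa [hLm, h1, ← hLm]
      rw [hMneg x hx, hMneg _ h2, h1, List.mate_mate (hL _).nodup (hmem x)]) P
    fun x _ => ⟨Finset.mem_univ _, hP x⟩
  simp only [Finset.mem_univ, true_imp_iff, true_and] at hτ hext
  obtain ⟨u, hu, hτu⟩ := exists_mem_apply_notMem_of_odd (C := (L c₀).toFinset)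
    (by rwa [List.toFinset_card_of_nodup hc₀.nodup]) τ
    fun x hx => (hτ x (hMpos x (List.mem_toFinset.mp hx))).2
  rw [List.mem_toFinset] at hu hτu
  obtain ⟨l, hl, hlm, hlast⟩ := hc₀.exists_rotate hu
  have hlen : l.length = (L c₀).length := by
    rw [← List.toFinset_card_of_nodup hl.nodup, ← List.toFinset_card_of_nodup hc₀.nodup]
    congr 1
    ext x
    simp [hlm]
  have h3 := hl.three_le
  have hMu := hMpos u hu
  have hlast := hlast (by omega)
  have hmateu : l.mate u = u := by
    rw [← hlast]
    exact List.mate_getElem_last hl.nodup (by omega) (by omega)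
      (hlen ▸ Nat.Odd.sub_odd hodd odd_one)
  have hmate_mem : ∀ x ∈ l, l.mate x ∈ l := fun x hx => List.mate_mem hl.nodup hx
  have hmate_mate : ∀ x ∈ l, l.mate (l.mate x) = x := fun x hx => List.mate_mate hl.nodup hx
  have hmate_not : ∀ x ∉ l, l.mate x = x := fun x hx => if_neg hx
  have hmate_ne : ∀ x, x ≠ u → l.mate x ≠ u := by
    intro x hx h
    by_cases hxl : x ∈ l
    · exact hx (by rw [← hmate_mate x hxl, h, hmateu])
    · exact hx (by rw [← hmate_not x hxl, h])
  have hlM : ∀ x ∈ l, M x = x := fun x hx => hMpos x ((hlm x).mp hx)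
  have hul : u ∈ l := (hlm u).mpr hu
  have hτul : τ u ∉ l := fun h => hτu ((hlm _).mp h)
  let S : Finset W := Finset.univ.filter fun x => M x = x ∧ x ≠ u ∧ x ≠ τ u
  have hS : ∀ x, x ∈ S ↔ M x = x ∧ x ≠ u ∧ x ≠ τ u := by simp [S]
  obtain ⟨f₁, hf₁⟩ := exists_alternating S τ l.mate
    (fun x hx => by
      rw [hS] at hx
      obtain ⟨h1, h2, h3⟩ := hτ x hx.1
      obtain ⟨h4, h5, h6⟩ := hτ u hMu
      exact ⟨(hS _).mpr ⟨h1, fun h => hx.2.2 (by rw [← h2, h]),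
        fun h => hx.2.1 (by rw [← h2, h, h5])⟩, h2, h3⟩)
    (fun x hx => by
      by_cases hxl : x ∈ l
      · rw [hS] at hx ⊢
        exact ⟨⟨hlM _ (hmate_mem x hxl), hmate_ne x hx.2.1, fun h => hτul (h ▸ hmate_mem x hxl)⟩,
          hmate_mate x hxl⟩
      · rw [hmate_not x hxl, hmate_not x hxl]
        exact ⟨hx, rfl⟩)
  have h0u : l[0] ≠ u := by
    rw [← hlast, ne_eq, hl.eq_iff]; omega
  have h0S : l[0] ∈ S := (hS _).mpr ⟨hlM _ (List.getElem_mem _), h0u,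
    fun h => hτul (h ▸ List.getElem_mem _)⟩
  obtain ⟨hMτu, hττu, hτuu⟩ := hτ u hMu
  obtain ⟨f, hf, hf'⟩ := hext
    (fun x => if x = u then !f₁ l[0] else if x = τ u then f₁ l[0] else f₁ x) (by
      intro x hx
      by_cases hxu : x = u
      · subst hxu
        simp [hτuu]
      by_cases hxτ : x = τ u
      · subst hxτ
        simp [hτuu, hττu]
      have h1 : τ x ≠ u := fun h => hxτ (by rw [← h, (hτ x hx).2.1])
      have h2 : τ x ≠ τ u := fun h => hxu (by rw [← (hτ x hx).2.1, h, hττu])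
      simp only [hxu, hxτ, h1, h2, if_false]
      exact (hf₁ x ((hS x).mpr ⟨hx, hxu, hxτ⟩)).1)
  have hfS : ∀ x ∈ S, f x = f₁ x := by
    intro x hx
    rw [hS] at hx
    rw [hf x hx.1, if_neg hx.2.1, if_neg hx.2.2]
  refine ⟨l, f, hl, hlm, fun x => (hf' x).1, ?_, ?_, ?_⟩
  · intro c hc x hx
    obtain rfl := (hLm c x).mp hx
    have hx0 : x ∉ L c₀ := fun h => hc ((hLm _ _).mp h)
    rw [← hMneg x hx0]
    exact (hf' x).2
  · intro x hx hne
    have hxu : x ≠ u := by rintro rfl; exact hne hmateu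
    have hxS : x ∈ S := (hS x).mpr ⟨hlM x hx, hxu, fun h => hτul (h ▸ hx)⟩
    have hxS' : l.mate x ∈ S := (hS _).mpr ⟨hlM _ (hmate_mem x hx), hmate_ne x hxu,
      fun h => hτul (h ▸ hmate_mem x hx)⟩
    rw [hfS x hxS, hfS _ hxS']
    exact (hf₁ x hxS).2 hne
  · intro _
    rw [hlast, hfS _ h0S, hf u hMu, if_pos rfl]
    simp

theorem exists_coloring_of_few_odd_cycles {W ι : Type*} [Fintype W] [DecidableEq W]
    {G : SimpleGraph W} (hG : DegreeLeTwo G) (e : W ≃ ι × Fin 4)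
    (hodd : ∀ l l', IsCycleList G l → IsCycleList G l' → Odd l.length → Odd l'.length →
      3 < l.length → 3 < l'.length → ∀ x, x ∈ l → x ∈ l') :
    ∃ c : W → Fin 4, (∀ x y, G.Adj x y → c x ≠ c y) ∧
      ∀ x y, (e x).1 = (e y).1 → c x = c y → x = y := by
  classical
  let σ : Fin 4 → Fin 4 := ![1, 0, 3, 2]
  have hσ : ∀ k, σ (σ k) = k ∧ σ k ≠ k := by decide
  let P : W → W := fun x => e.symm ((e x).1, σ (e x).2)
  have hP : ∀ x, P (P x) = x ∧ P x ≠ x := by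
    intro x
    refine ⟨by simp [P, hσ], fun h => (hσ (e x).2).2 ?_⟩
    rw [Equiv.symm_apply_eq] at h
    exact congrArg Prod.snd h
  have hPf : ∀ f : W → Bool, (∀ x, f (P x) ≠ f x) →
      (∀ i, f (e.symm (i, 0)) ≠ f (e.symm (i, 1))) ∧
      ∀ i, f (e.symm (i, 2)) ≠ f (e.symm (i, 3)) := by
    intro f hf
    refine ⟨fun i => ?_, fun i => ?_⟩
    · have := hf (e.symm (i, 1))
      simpa [P, σ] using this
    · have := hf (e.symm (i, 3))
      simpa [P, σ] using this
  choose L hL hLm using exists_isPathList_component hG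
  have hcc : ∀ x y, G.Adj x y → y ∈ L (G.connectedComponentMk x) := fun x y h =>
    (hLm _ _).mpr (SimpleGraph.ConnectedComponent.connectedComponentMk_eq_of_adj h).symm
  by_cases hex : ∃ c₀, IsCycleList G (L c₀) ∧ Odd (L c₀).length ∧ 3 < (L c₀).length
  · obtain ⟨c₀, hc₀, hc₀odd, hc₀3⟩ := hex
    obtain ⟨l, f, hl, hlm, hfP, hf1, hf2, hf3⟩ :=
      exists_alternating_of_odd_cycle P hP L hL hLm c₀ hc₀ hc₀odd
    refine exists_coloring_of_bool e f (hPf f hfP).1 (hPf f hfP).2 fun x y z hxy hxz => ?_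
    by_cases hx : G.connectedComponentMk x = c₀
    · refine eq_of_alternating hG hl.toIsPathList f hf2 (fun h _ _ => hf3 h.three_le) ?_ ?_ ?_ hxy hxz
      · rw [hlm, hLm, hx]
      · rw [hlm, ← hx]; exact hcc x y hxy
      · rw [hlm, ← hx]; exact hcc x z hxz
    · refine eq_of_alternating hG (hL (G.connectedComponentMk x)) f (hf1 _ hx) (fun h ho h3 => ?_)
        ((hLm _ _).mpr rfl) (hcc x y hxy) (hcc x z hxz) hxy hxz
      exact absurd ((hLm _ _).mp (hodd _ _ h hc₀ ho hc₀odd h3 hc₀3 x ((hLm _ _).mpr rfl))) hx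
  · obtain ⟨f, hfP, hf⟩ := exists_alternating_of_listing P hP L (fun c => (hL c).nodup) hLm
    refine exists_coloring_of_bool e f (hPf f hfP).1 (hPf f hfP).2 fun x y z hxy hxz => ?_
    exact eq_of_alternating hG (hL (G.connectedComponentMk x)) f (hf _)
      (fun h ho h3 => absurd ⟨_, h, ho, h3⟩ hex)
      ((hLm _ _).mpr rfl) (hcc x y hxy) (hcc x z hxz) hxy hxz

theorem IsCycleList.isCycleSet {V : Type} [DecidableEq V] {H : SimpleGraph V} {l : List V}
    (hl : IsCycleList H l) : IsCycleSet H l.toFinset := by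
  have h3 := hl.three_le
  have hne : l ≠ [] := List.ne_nil_of_length_pos (by omega)
  let p := Walk.ofSupport l hne (List.isChain_iff_getElem.mpr hl.adj)
  have hp : p.support = l := Walk.support_ofSupport hne _
  have hadj : H.Adj (l.getLast hne) (l.head hne) := by
    rw [List.getLast_eq_getElem, List.head_eq_getElem]
    exact hl.adj_last
  refine ⟨_, Walk.cons hadj p, Walk.isCycle_iff_isPath_tail_and_le_length.mpr ⟨?_, ?_⟩, ?_⟩
  · rw [Walk.isPath_def]
    simpa [hp] using hl.nodup
  · rw [Walk.length_cons, ← Walk.length_support, hp]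
    exact h3
  · rw [Walk.support_cons, hp, List.toFinset_cons]
    exact Finset.insert_eq_of_mem (List.mem_toFinset.mpr (List.getLast_mem hne))

theorem IsCycleList.exists_map_eq {V W : Type*} {H : SimpleGraph V} {φ : V ↪ W} {l : List W}
    (hl : IsCycleList (H.map φ) l) : ∃ l', IsCycleList H l' ∧ l'.map φ = l := by
  have hmem : l ∈ Set.range (List.map φ) := by
    rw [Set.range_list_map]
    intro x hx
    obtain ⟨i, hi, rfl⟩ := List.getElem_of_mem hx
    have := hl.adj_mod i
    simp only [Nat.mod_eq_of_lt hi] at this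
    obtain ⟨u, v, -, hu, -⟩ := (map_adj _ _ _ _).mp this
    exact ⟨u, hu⟩
  obtain ⟨l', rfl⟩ := hmem
  refine ⟨l', ⟨⟨hl.nodup.of_map _, fun i hi => ?_⟩, by simpa using hl.three_le, ?_⟩, rfl⟩
  · have h := hl.adj i (by simpa using hi)
    rw [List.getElem_map, List.getElem_map] at h
    exact (map_adj_apply ..).mp h
  · have h := hl.adj_last
    rw [List.getElem_map, List.getElem_map] at h
    simpa only [map_adj_apply, List.length_map] using h

theorem DegreeLeTwo.map {V W : Type*} {H : SimpleGraph V} (hH : DegreeLeTwo H) (φ : V ↪ W) :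
    DegreeLeTwo (H.map φ) := by
  intro x a b c ha hb hc
  rw [map_adj] at ha hb hc
  obtain ⟨x, a, ha, rfl, rfl⟩ := ha
  obtain ⟨x', b, hb, hx, rfl⟩ := hb
  obtain rfl := φ.injective hx
  obtain ⟨x', c, hc, hx, rfl⟩ := hc
  obtain rfl := φ.injective hx
  simpa only [φ.injective.eq_iff] using hH _ _ _ _ ha hb hc

theorem degreeLeTwo_of_degree_le {V : Type*} [Fintype V] {H : SimpleGraph V} [DecidableRel H.Adj]
    (hH : ∀ v, H.degree v ≤ 2) : DegreeLeTwo H := by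
  intro x a b c ha hb hc
  by_contra! h
  refine absurd (hH x) (not_le.mpr (Finset.two_lt_card_iff.mpr ⟨a, b, c, ?_⟩))
  simpa [ha, hb, hc] using h

theorem exists_proper_coloring {V W ι : Type} [Fintype V] [DecidableEq V] [Fintype W]
    [DecidableEq W] [Fintype ι] [DecidableEq ι] (H : SimpleGraph V) (hH : DegreeLeTwo H)
    (hcond :
      {s : Finset V | IsCycleSet H s ∧ Odd s.card ∧ 3 < s.card}.ncard ≤ 1 ∨
      {s : Finset V | IsCycleSet H s ∧ s.card = 3}.ncard ≤ 3)
    (φ : V ↪ W) (P : W → ι) (hP : ∀ i, (Finset.univ.filter fun v => P v = i).card = 4) :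
    ∃ c : W → Fin 4, (∀ x y, (H.map φ).Adj x y → c x ≠ c y) ∧
      ∀ x y, P x = P y → c x = c y → x = y := by
  rcases hcond with hcond | hcond
  · let k : ∀ i, {x // P x = i} ≃ Fin 4 := fun i =>
      Fintype.equivFinOfCardEq (by rw [Fintype.card_subtype, hP])
    let e : W ≃ ι × Fin 4 := (Equiv.sigmaFiberEquiv P).symm.trans
      ((Equiv.sigmaCongrRight k).trans (Equiv.sigmaEquivProd ι (Fin 4)))
    refine exists_coloring_of_few_odd_cycles (hH.map φ) e ?_
    intro l l' hl hl' ho ho' h3 h3' x hx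
    obtain ⟨l, hm, rfl⟩ := hl.exists_map_eq
    obtain ⟨l', hm', rfl⟩ := hl'.exists_map_eq
    rw [List.length_map] at ho ho' h3 h3'
    have hmem : ∀ m, IsCycleList H m → Odd m.length → 3 < m.length →
        m.toFinset ∈ {s : Finset V | IsCycleSet H s ∧ Odd s.card ∧ 3 < s.card} := by
      intro m hm h1 h2
      rw [Set.mem_ofPred_eq, List.toFinset_card_of_nodup hm.nodup]
      exact ⟨hm.isCycleSet, h1, h2⟩
    have heq := (Set.ncard_le_one (Set.toFinite _)).mp hcond _ (hmem l hm ho h3) _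
      (hmem l' hm' ho' h3')
    obtain ⟨v, hv, rfl⟩ := List.mem_map.mp hx
    refine List.mem_map.mpr ⟨v, ?_, rfl⟩
    rwa [← List.mem_toFinset, ← heq, List.mem_toFinset]
  · refine exists_coloring_of_few_triangles (hH.map φ) P hP fun S hS => ?_
    refine le_trans ?_ hcond
    rw [← Set.ncard_image_of_injective _ (Finset.map_injective φ), ← Set.ncard_coe_finset]
    refine Set.ncard_le_ncard ?_ (Set.toFinite _)
    intro s hs
    obtain ⟨hs3, l, hl, rfl⟩ := hS s hs
    obtain ⟨l, hm, rfl⟩ := hl.exists_map_eq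
    have hmap : l.toFinset.map φ = (l.map φ).toFinset := by ext; simp
    refine ⟨l.toFinset, ⟨hm.isCycleSet, ?_⟩, hmap⟩
    rw [← hs3, ← hmap, Finset.card_map]

theorem card_filter_eq_one_of_injOn {W ι : Type*} [Fintype W] [DecidableEq ι] {t : ℕ} {P : W → ι}
    (hP : ∀ i, (Finset.univ.filter fun v => P v = i).card = t) {c : W → Fin t}
    (hc : ∀ x y, P x = P y → c x = c y → x = y) (i : ι) (k : Fin t) :
    (Finset.univ.filter fun w => P w = i ∧ c w = k).card = 1 := by
  have himg : (Finset.univ.filter fun v => P v = i).image c = Finset.univ := by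
    rw [← Finset.card_eq_iff_eq_univ, Finset.card_image_of_injOn, hP, Fintype.card_fin]
    intro x hx y hy h
    simp only [Finset.coe_filter, Finset.mem_univ, true_and, Set.mem_ofPred_eq] at hx hy
    exact hc x y (hx.trans hy.symm) h
  obtain ⟨x, hx, hxk⟩ := Finset.mem_image.mp (himg ▸ Finset.mem_univ k)
  rw [Finset.mem_filter] at hx
  refine Finset.card_eq_one.mpr ⟨x, ?_⟩
  ext y
  simp only [Finset.mem_filter, Finset.mem_univ, true_and, Finset.mem_singleton]
  refine ⟨fun h => hc y x (h.1.trans hx.2.symm) (h.2.trans hxk.symm), ?_⟩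
  rintro rfl
  exact ⟨hx.2, hxk⟩

theorem stmt_2 {V : Type} [Fintype V] [DecidableEq V]
    (H : SimpleGraph V) [DecidableRel H.Adj]
    (hΔ : ∀ v, H.degree v ≤ 2)
    (hcond :
      {s : Finset V | IsCycleSet H s ∧ Odd s.card ∧ 3 < s.card}.ncard ≤ 1 ∨
      {s : Finset V | IsCycleSet H s ∧ s.card = 3}.ncard ≤ 3) :
    StronglyColorable H 4 := by
  intro P hP
  obtain ⟨c, hc, hc'⟩ := exists_proper_coloring H (degreeLeTwo_of_degree_le hΔ) hcond
    Function.Embedding.inl P hP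
  exact ⟨c, fun u v h => hc _ _ ((map_adj _ _ _ _).mpr ⟨u, v, h, rfl, rfl⟩),
    card_filter_eq_one_of_injOn hP hc'⟩
end

section
/- If H is a (finite simple) graph with maximum degree at most 2 and V_1, ..., V_n are pairwise disjoint subsets of V(H) with |V_i| ≥ 4 for every i, then the family (V_1, ..., V_n) has an independent set of representatives in H. -/
open SimpleGraph

/-- `t` picks one vertex `t i ∈ f i` for each `i ∈ s`, and no two of the chosen vertices
are adjacent in `H`. -/
def IsIndepTransversal {V ι : Type*} (H : SimpleGraph V) (f : ι → Finset V) (s : Finset ι)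
    (t : ι → V) : Prop :=
  (∀ i ∈ s, t i ∈ f i) ∧ ∀ i ∈ s, ∀ j ∈ s, i ≠ j → ¬ H.Adj (t i) (t j)

lemma IsIndepTransversal.anti {V ι : Type*} {H G : SimpleGraph V} {f : ι → Finset V}
    {s : Finset ι} {t : ι → V} (h : IsIndepTransversal H f s t) (hGH : G ≤ H) :
    IsIndepTransversal G f s t :=
  ⟨h.1, fun i hi j hj hij hadj => h.2 i hi j hj hij (hGH hadj)⟩

/-- In a graph without an independent transversal of `s` that is edge-minimal with this property,
every class `f A` such that `s.erase A` has an independent transversal is empty or meets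
an edge whose deletion creates an independent transversal through both its ends. -/
lemma exists_critical_edge {V ι : Type*} [DecidableEq ι] {H : SimpleGraph V}
    {f : ι → Finset V} {s : Finset ι} {A : ι} (hA : A ∈ s)
    (hf : (s : Set ι).PairwiseDisjoint f)
    (hmin : Minimal (fun G : SimpleGraph V => ¬ ∃ t, IsIndepTransversal G f s t) H)
    (herase : ∃ t, IsIndepTransversal H f (s.erase A) t) (hne : (f A).Nonempty) :
    ∃ B ∈ s, B ≠ A ∧ ∃ t : ι → V, (∀ i ∈ s, t i ∈ f i) ∧ H.Adj (t A) (t B) ∧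
      ∀ i ∈ s, ∀ j ∈ s, H.Adj (t i) (t j) → i = j ∨ (i = A ∧ j = B) ∨ (i = B ∧ j = A) := by
  obtain ⟨x, hx⟩ := hne
  obtain ⟨t, ht⟩ := herase
  obtain ⟨k, hk, hxk⟩ : ∃ k ∈ s.erase A, H.Adj x (t k) := by
    by_contra! hcon
    refine hmin.prop ⟨Function.update t A x, fun i hi => ?_, fun i hi j hj hij => ?_⟩
    · by_cases h : i = A
      · subst h; simpa using hx
      · simpa [h] using ht.1 i (Finset.mem_erase.2 ⟨h, hi⟩)
    · by_cases h : i = A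
      · subst h
        simpa [hij.symm] using hcon j (Finset.mem_erase.2 ⟨hij.symm, hj⟩)
      · by_cases h' : j = A
        · subst h'
          simpa [hij] using fun h'' => hcon i (Finset.mem_erase.2 ⟨hij, hi⟩) h''.symm
        · simpa [h, h'] using ht.2 i (Finset.mem_erase.2 ⟨h, hi⟩) j
            (Finset.mem_erase.2 ⟨h', hj⟩) hij
  obtain ⟨hkA, hks⟩ := Finset.mem_erase.1 hk
  have hy := ht.1 k hk
  obtain ⟨T, hT⟩ : ∃ T, IsIndepTransversal (H.deleteEdges {s(x, t k)}) f s T := by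
    by_contra hcon
    have := hmin.le_of_le hcon (H.deleteEdges_le _) hxk
    simp at this
  have hinj : ∀ i ∈ s, ∀ j ∈ s, ∀ v, v ∈ f i → v ∈ f j → i = j := fun i hi j hj v hvi hvj =>
    hf.elim_finset hi hj v hvi hvj
  have hend : ∀ i ∈ s, ∀ j ∈ s, H.Adj (T i) (T j) → i = j ∨
      (i = A ∧ j = k ∧ T i = x ∧ T j = t k) ∨ (i = k ∧ j = A ∧ T j = x ∧ T i = t k) := by
    intro i hi j hj hadj
    by_contra! hcon
    have := hT.2 i hi j hj hcon.1
    simp only [deleteEdges_adj, Set.mem_singleton_iff, Sym2.eq_iff, not_and, not_not] at this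
    rcases this hadj with ⟨h₁, h₂⟩ | ⟨h₁, h₂⟩
    · exact hcon.2.1 (hinj i hi A hA _ (hT.1 i hi) (h₁ ▸ hx))
        (hinj j hj k hks _ (hT.1 j hj) (h₂ ▸ hy)) h₁ h₂
    · exact hcon.2.2 (hinj i hi k hks _ (hT.1 i hi) (h₁ ▸ hy))
        (hinj j hj A hA _ (hT.1 j hj) (h₂ ▸ hx)) h₂ h₁
  refine ⟨k, hks, hkA, T, hT.1, ?_, fun i hi j hj hadj => by grind⟩
  obtain ⟨i, hi, j, hj, hij, hadj⟩ : ∃ i ∈ s, ∃ j ∈ s, i ≠ j ∧ H.Adj (T i) (T j) := by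
    by_contra! hcon
    exact hmin.prop ⟨T, hT.1, hcon⟩
  rcases hend i hi j hj hadj with h | ⟨rfl, rfl, -⟩ | ⟨rfl, rfl, -⟩
  · exact absurd h hij
  · exact hadj
  · exact hadj.symm

/-- If `s` has no independent transversal but `s.erase A` has one, then some subfamily
containing `A` has a union of size at most `2 * d * (#S - 1)`. -/
lemma exists_small_subfamily {V ι : Type*} [Finite V] [DecidableEq V] [DecidableEq ι] {d : ℕ}
    (H : SimpleGraph V) (hH : ∀ v, (H.neighborSet v).ncard ≤ d)
    (f : ι → Finset V) (s : Finset ι) {A : ι} (hA : A ∈ s)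
    (hf : (s : Set ι).PairwiseDisjoint f)
    (hno : ¬ ∃ t, IsIndepTransversal H f s t)
    (herase : ∃ t, IsIndepTransversal H f (s.erase A) t) :
    ∃ S ⊆ s, A ∈ S ∧ (S.biUnion f).card + 2 * d ≤ 2 * d * S.card := by
  induction hm : s.card generalizing H f s with
  | zero => simp_all
  | succ m ih =>
    obtain ⟨G, hGH, hG⟩ := exists_minimal_le_of_wellFoundedLT
      (fun G : SimpleGraph V => ¬ ∃ t, IsIndepTransversal G f s t) H hno
    have hGd : ∀ v, (G.neighborSet v).ncard ≤ d := fun v =>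
      (Set.ncard_le_ncard (fun w hw => hGH hw) (Set.toFinite _)).trans (hH v)
    rcases (f A).eq_empty_or_nonempty with hempty | hne
    · exact ⟨{A}, by simpa using hA, by simp, by simp [hempty]⟩
    obtain ⟨B, hB, hBA, T, hTf, hTAB, hT⟩ := exists_critical_edge hA hf hG
      (herase.imp fun t ht => ht.anti hGH) hne
    have hfin : (G.neighborSet (T A) ∪ G.neighborSet (T B)).Finite := Set.toFinite _
    set D : Finset V := hfin.toFinset with hD
    have hmemD : ∀ v, v ∈ D ↔ G.Adj (T A) v ∨ G.Adj (T B) v := by simp [hD]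
    have hDcard : D.card ≤ 2 * d := by
      rw [hD, ← Set.ncard_eq_toFinset_card]
      exact (Set.ncard_union_le _ _).trans (by linarith [hGd (T A), hGd (T B)])
    set g : ι → Finset V := Function.update (fun i => f i \ D) A ((f A ∪ f B) \ D) with hg
    have hgA : g A = (f A ∪ f B) \ D := by simp [hg]
    have hgi : ∀ i, i ≠ A → g i = f i \ D := fun i hi => by simp [hg, hi]
    have hinj : ∀ i ∈ s, ∀ j ∈ s, ∀ v, v ∈ f i → v ∈ f j → i = j :=
      fun i hi j hj v hvi hvj => hf.elim_finset hi hj v hvi hvj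
    obtain ⟨S, hSs, hAS, hScard⟩ : ∃ S ⊆ s.erase B, A ∈ S ∧
        (S.biUnion g).card + 2 * d ≤ 2 * d * S.card := by
      refine ih G hGd g (s.erase B) (Finset.mem_erase.2 ⟨hBA.symm, hA⟩) ?_ ?_ ?_ ?_
      · intro i hi j hj hij
        rw [Function.onFun, Finset.disjoint_left]
        intro v hvi hvj
        have hi' := Finset.mem_erase.1 hi
        have hj' := Finset.mem_erase.1 hj
        by_cases hiA : i = A <;> by_cases hjA : j = A <;> grind
      · rintro ⟨t, htg, ht⟩
        have hnD : ∀ i ∈ s.erase B, t i ∉ D := fun i hi => by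
          have := htg i hi
          by_cases hiA : i = A <;> grind
        simp only [hmemD, not_or] at hnD
        have hAB : A ∈ s.erase B := Finset.mem_erase.2 ⟨hBA.symm, hA⟩
        have htA := htg A hAB
        rw [hgA, Finset.mem_sdiff, Finset.mem_union] at htA
        have hmem : ∀ i ∈ s, i ≠ A → i ≠ B → t i ∈ f i := fun i hi hiA hiB => by
          have := htg i (Finset.mem_erase.2 ⟨hiB, hi⟩)
          rw [hgi i hiA] at this
          exact (Finset.mem_sdiff.1 this).1
        have hsymm : ∀ u v, G.Adj u v → G.Adj v u := fun u v h => h.symm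
        have hTB := hTf B hB
        have hTA := hTf A hA
        refine hG.prop ?_
        rcases htA.1 with h | h
        · refine ⟨Function.update t B (T B), fun i hi => ?_, fun i hi j hj hij => ?_⟩
          · by_cases hiB : i = B <;> by_cases hiA : i = A <;> grind
          · by_cases hiB : i = B <;> by_cases hjB : j = B <;> grind
        · refine ⟨Function.update (Function.update t B (t A)) A (T A), fun i hi => ?_,
            fun i hi j hj hij => ?_⟩
          · by_cases hiB : i = B <;> by_cases hiA : i = A <;> grind
          · by_cases hiB : i = B <;> by_cases hjB : j = B <;> by_cases hiA : i = A <;>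
              by_cases hjA : j = A <;> grind
      · refine ⟨T, fun i hi => ?_, fun i hi j hj hij hadj => ?_⟩
        · simp only [Finset.mem_erase] at hi
          have h₁ := hT A hA i hi.2.2
          have h₂ := hT B hB i hi.2.2
          rw [hgi i hi.1, Finset.mem_sdiff, hmemD]
          exact ⟨hTf i hi.2.2, by grind⟩
        · simp only [Finset.mem_erase] at hi hj
          have := hT i hi.2.2 j hj.2.2 hadj
          grind
      · rw [Finset.card_erase_of_mem hB, hm, Nat.add_sub_cancel]
    have hBS : B ∉ S := fun h => by simpa using hSs h
    refine ⟨insert B S, ?_, Finset.mem_insert_of_mem hAS, ?_⟩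
    · exact Finset.insert_subset hB (hSs.trans (Finset.erase_subset _ _))
    · have hsub : (insert B S).biUnion f ⊆ S.biUnion g ∪ D := by
        intro v hv
        simp only [Finset.mem_biUnion, Finset.mem_insert, Finset.mem_union] at hv ⊢
        by_cases hvD : v ∈ D
        · exact Or.inr hvD
        · left
          obtain ⟨i, rfl | hi, hvi⟩ := hv
          · exact ⟨A, hAS, by simp [hgA, hvi, hvD]⟩
          · by_cases hiA : i = A
            · exact ⟨A, hAS, by subst hiA; simp [hgA, hvi, hvD]⟩
            · exact ⟨i, hi, by simp [hgi i hiA, hvi, hvD]⟩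
      have h₁ := Finset.card_le_card hsub
      have h₂ := Finset.card_union_le (S.biUnion g) D
      rw [Finset.card_insert_of_notMem hBS]
      linarith

/-- **Haxell's theorem**: disjoint classes of size at least `2 * d` in a graph of maximum degree
at most `d` have an independent transversal. -/
theorem exists_isIndepTransversal {V ι : Type*} [Finite V] [Fintype ι] {d : ℕ} (hd : 0 < d)
    (H : SimpleGraph V) (hH : ∀ v, (H.neighborSet v).ncard ≤ d)
    (f : ι → Finset V) (hf : Pairwise (Function.onFun Disjoint f))
    (hcard : ∀ i, 2 * d ≤ (f i).card) :
    ∃ t, IsIndepTransversal H f Finset.univ t := by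
  classical
  suffices h : ∀ s, ∃ t, IsIndepTransversal H f s t from h _
  intro s
  induction s using Finset.induction_on with
  | empty =>
    have hne : ∀ i, (f i).Nonempty := fun i => Finset.card_pos.1 (by linarith [hcard i])
    choose t _ using hne
    exact ⟨t, by simp [IsIndepTransversal]⟩
  | insert A s hAs ih =>
    by_contra hno
    obtain ⟨S, -, -, hScard⟩ := exists_small_subfamily H hH f (insert A s)
      (Finset.mem_insert_self A s) (hf.set_pairwise _) hno (by rwa [Finset.erase_insert hAs])
    rw [Finset.card_biUnion fun i _ j _ hij => hf hij] at hScard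
    have := Finset.card_nsmul_le_sum S (fun i => (f i).card) (2 * d) fun i _ => hcard i
    rw [smul_eq_mul, mul_comm] at this
    linarith

theorem stmt_3 {V : Type} [Fintype V] [DecidableEq V]
    (H : SimpleGraph V) [DecidableRel H.Adj]
    (hΔ : ∀ v, H.degree v ≤ 2)
    {n : ℕ} (Vs : Fin n → Finset V)
    (hdisj : ∀ i j, i ≠ j → Disjoint (Vs i) (Vs j))
    (hcard : ∀ i, 4 ≤ (Vs i).card) :
    ∃ R : Finset V,
      (∀ u ∈ R, ∀ v ∈ R, ¬ H.Adj u v) ∧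
      (∀ i, (R ∩ Vs i).card = 1) ∧
      R ⊆ Finset.univ.biUnion Vs := by
  obtain ⟨t, htf, ht⟩ := exists_isIndepTransversal (d := 2) two_pos H
    (fun v => by
      rw [Set.ncard_eq_toFinset_card', Set.toFinset_card, card_neighborSet_eq_degree]
      exact hΔ v)
    Vs (fun i j hij => hdisj i j hij) hcard
  refine ⟨Finset.univ.image t, ?_, fun i => ?_, ?_⟩
  · simp only [Finset.mem_image, Finset.mem_univ, true_and]
    rintro _ ⟨i, rfl⟩ _ ⟨j, rfl⟩ hadj
    by_cases hij : i = j
    · subst hij; exact H.irrefl hadj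
    · exact ht i (Finset.mem_univ i) j (Finset.mem_univ j) hij hadj
  · rw [Finset.card_eq_one]
    refine ⟨t i, Finset.ext fun v => ?_⟩
    simp only [Finset.mem_inter, Finset.mem_image, Finset.mem_univ, true_and,
      Finset.mem_singleton]
    constructor
    · rintro ⟨⟨j, rfl⟩, hv⟩
      by_contra hne
      have hij : j ≠ i := fun h => hne (by rw [h])
      exact Finset.disjoint_left.1 (hdisj j i hij) (htf j (Finset.mem_univ j)) hv
    · rintro rfl
      exact ⟨⟨i, rfl⟩, htf i (Finset.mem_univ i)⟩
  · intro v hv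
    obtain ⟨i, -, rfl⟩ := Finset.mem_image.1 hv
    exact Finset.mem_biUnion.2 ⟨i, Finset.mem_univ i, htf i (Finset.mem_univ i)⟩
end

section
/- If H is a (finite simple) graph with maximum degree at most 2 and V_1, ..., V_n are pairwise disjoint subsets of V(H) with |V_i| = 4 for every i, then the family (V_1, ..., V_n) has two disjoint independent sets of representatives in H. -/
open SimpleGraph

/-- The boundary of a mod 2 chain, a chain being a function on finite vertex sets. -/
def chainBoundary {V : Type} [Fintype V] [DecidableEq V] (z : Finset V → ZMod 2) :
    Finset V → ZMod 2 :=
  fun s => ∑ v ∈ sᶜ, z (insert v s)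

/-- The cone with apex `v` over a chain. -/
def chainCone {V : Type} [DecidableEq V] (v : V) (z : Finset V → ZMod 2) :
    Finset V → ZMod 2 :=
  fun s => if v ∈ s then z (s.erase v) else 0

/-- `z` is a chain on the independent subsets of `A` with exactly `j` elements. -/
def IsIndepChain {V : Type} (H : SimpleGraph V) (A : Finset V) (j : ℕ)
    (z : Finset V → ZMod 2) : Prop :=
  ∀ s, z s ≠ 0 → s ⊆ A ∧ (∀ u ∈ s, ∀ v ∈ s, ¬ H.Adj u v) ∧ s.card = j

/-- The reduced mod 2 homology of the independence complex of `H[A]` vanishes in all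
dimensions at most `k - 2`. -/
def EtaGE {V : Type} [Fintype V] [DecidableEq V] (H : SimpleGraph V) (A : Finset V) (k : ℕ) :
    Prop :=
  ∀ j < k, ∀ z, IsIndepChain H A j z → chainBoundary z = 0 →
    ∃ w, IsIndepChain H A (j + 1) w ∧ chainBoundary w = z

theorem IsIndepChain.add {V : Type} {H : SimpleGraph V} {A : Finset V} {j : ℕ}
    {z w : Finset V → ZMod 2} (hz : IsIndepChain H A j z) (hw : IsIndepChain H A j w) :
    IsIndepChain H A j (z + w) := by
  intro s hs
  by_cases h : z s = 0
  · refine hw s fun h' => hs ?_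
    simp [h, h']
  · exact hz s h

theorem IsIndepChain.mono {V : Type} {H : SimpleGraph V} {A B : Finset V} {j : ℕ}
    {z : Finset V → ZMod 2} (hz : IsIndepChain H A j z) (hAB : A ⊆ B) : IsIndepChain H B j z :=
  fun s hs => ⟨(hz s hs).1.trans hAB, (hz s hs).2⟩

theorem IsIndepChain.sum {V ι : Type} {H : SimpleGraph V} {A : Finset V} {j : ℕ} (I : Finset ι)
    {c : ι → Finset V → ZMod 2} (hc : ∀ i ∈ I, IsIndepChain H A j (c i)) :
    IsIndepChain H A j (∑ i ∈ I, c i) := by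
  intro s hs
  rw [Finset.sum_apply] at hs
  obtain ⟨i, hi, h⟩ := Finset.exists_ne_zero_of_sum_ne_zero hs
  exact hc i hi s h

theorem sum_sum_erase_eq_zero {α : Type} [DecidableEq α] (s : Finset α) (f : α → α → ZMod 2)
    (hf : ∀ a b, f a b = f b a) : ∑ a ∈ s, ∑ b ∈ s.erase a, f a b = 0 := by
  rw [Finset.sum_sigma']
  refine Finset.sum_involution (fun x _ => ⟨x.2, x.1⟩) ?_ ?_ ?_ ?_
  · rintro ⟨a, b⟩ _
    simp only
    rw [hf b a]
    exact CharTwo.add_self_eq_zero _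
  · rintro ⟨a, b⟩ h _ heq
    simp only [Finset.mem_sigma, Finset.mem_erase, Sigma.mk.injEq, heq_eq_eq] at h heq
    exact h.2.1 heq.1
  · rintro ⟨a, b⟩ h
    simp only [Finset.mem_sigma, Finset.mem_erase] at h ⊢
    exact ⟨h.2.2, h.2.1.symm, h.1⟩
  · intros
    rfl

section Chains

variable {V : Type} [DecidableEq V]

theorem IsIndepChain.chainCone {H : SimpleGraph V} {A B : Finset V} {j : ℕ} {v : V}
    {a : Finset V → ZMod 2} (ha : IsIndepChain H B j a) (hv : v ∈ A) (hB : B ⊆ A)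
    (hvB : ∀ u ∈ B, ¬ H.Adj v u) : IsIndepChain H A (j + 1) (chainCone v a) := by
  intro s hs
  rw [_root_.chainCone] at hs
  split_ifs at hs with hvs
  · obtain ⟨h1, h2, h3⟩ := ha _ hs
    have hmem : ∀ u ∈ s, u = v ∨ u ∈ s.erase v := fun u hu => by
      simp only [Finset.mem_erase]; tauto
    refine ⟨fun u hu => ?_, fun u hu w hw => ?_, ?_⟩
    · rcases hmem u hu with rfl | h
      · exact hv
      · exact hB (h1 h)
    · rcases hmem u hu with rfl | h <;> rcases hmem w hw with rfl | h'
      · exact H.loopless.irrefl _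
      · exact hvB w (h1 h')
      · exact fun hadj => hvB u (h1 h) hadj.symm
      · exact h2 u h w h'
    · rw [← Finset.card_erase_add_one hvs, h3]
  · exact absurd rfl hs

/-- The chain of faces of `z` opposite to `v`. -/
def chainLink (v : V) (z : Finset V → ZMod 2) : Finset V → ZMod 2 :=
  fun s => if v ∈ s then 0 else z (insert v s)

/-- The part of `z` avoiding `v`. -/
def chainDelete (v : V) (z : Finset V → ZMod 2) : Finset V → ZMod 2 :=
  fun s => if v ∈ s then 0 else z s

theorem chainCone_chainLink_add_chainDelete (v : V) (z : Finset V → ZMod 2) :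
    chainCone v (chainLink v z) + chainDelete v z = z := by
  ext s
  by_cases hv : v ∈ s <;> simp [chainCone, chainLink, chainDelete, hv, Finset.insert_erase]

theorem IsIndepChain.chainDelete {H : SimpleGraph V} {A : Finset V} {j : ℕ} {v : V}
    {z : Finset V → ZMod 2} (hz : IsIndepChain H A j z) :
    IsIndepChain H (A.erase v) j (chainDelete v z) := by
  intro s hs
  rw [_root_.chainDelete] at hs
  split_ifs at hs with hv
  · exact absurd rfl hs
  · exact ⟨Finset.subset_erase.2 ⟨(hz s hs).1, hv⟩, (hz s hs).2⟩

variable [Fintype V]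

theorem chainBoundary_add (z w : Finset V → ZMod 2) :
    chainBoundary (z + w) = chainBoundary z + chainBoundary w := by
  ext s
  simp [chainBoundary, Finset.sum_add_distrib]

theorem chainBoundary_sum {ι : Type} (I : Finset ι) (c : ι → Finset V → ZMod 2) :
    chainBoundary (∑ i ∈ I, c i) = ∑ i ∈ I, chainBoundary (c i) := by
  ext s
  simp only [chainBoundary, Finset.sum_apply]
  exact Finset.sum_comm

theorem chainBoundary_chainBoundary (z : Finset V → ZMod 2) :
    chainBoundary (chainBoundary z) = 0 := by
  ext s
  simp only [chainBoundary, Pi.zero_apply]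
  rw [← sum_sum_erase_eq_zero sᶜ (fun a b => z (insert b (insert a s)))
    (fun a b => by rw [Finset.insert_comm])]
  refine Finset.sum_congr rfl fun a _ => ?_
  rw [Finset.compl_insert]

theorem chainBoundary_chainCone (v : V) (a : Finset V → ZMod 2) (ha : ∀ s, v ∈ s → a s = 0) :
    chainBoundary (chainCone v a) = a + chainCone v (chainBoundary a) := by
  ext s
  by_cases hv : v ∈ s
  · simp only [chainBoundary, chainCone, Pi.add_apply, hv, ha s hv, if_true, zero_add,
      Finset.mem_insert, or_true]
    rw [Finset.compl_erase, Finset.sum_insert (by simpa using hv), Finset.insert_erase hv,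
      ha s hv, zero_add]
    refine Finset.sum_congr rfl fun w hw => ?_
    rw [Finset.erase_insert_of_ne]
    rintro rfl
    simp [hv] at hw
  · simp only [chainBoundary, chainCone, Pi.add_apply, hv, if_false, add_zero,
      Finset.mem_insert, or_false]
    rw [Finset.sum_ite_eq' sᶜ v (fun w => a ((insert w s).erase v)) |> fun h =>
      (Finset.sum_congr rfl fun w _ => by simp [eq_comm]).trans h]
    simp [hv]

theorem chainBoundary_chainDelete {v : V} {z : Finset V → ZMod 2} (hz : chainBoundary z = 0) :
    chainBoundary (chainDelete v z) = chainLink v z := by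
  ext s
  by_cases hv : v ∈ s
  · simp [chainBoundary, chainDelete, chainLink, hv]
  · have h := congrFun hz s
    simp only [chainBoundary, Pi.zero_apply] at h
    have hv' : v ∈ sᶜ := by simpa using hv
    rw [← Finset.add_sum_erase _ _ hv', CharTwo.add_eq_zero] at h
    simp only [chainBoundary, chainDelete, chainLink, hv, if_false]
    rw [← Finset.add_sum_erase _ _ hv', h]
    simp only [Finset.mem_insert_self, if_true, zero_add]
    refine Finset.sum_congr rfl fun w hw => ?_
    rw [if_neg]
    simp only [Finset.mem_erase] at hw
    simp only [Finset.mem_insert, not_or]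
    exact ⟨hw.1.symm, hv⟩

theorem chainBoundary_chainLink {v : V} {z : Finset V → ZMod 2} (hz : chainBoundary z = 0) :
    chainBoundary (chainLink v z) = 0 := by
  rw [← chainBoundary_chainDelete hz, chainBoundary_chainBoundary]

end Chains

section Eta

variable {V : Type} [Fintype V] [DecidableEq V] {H : SimpleGraph V}

theorem etaGE_of_isolated {A : Finset V} {v : V} (hv : v ∈ A) (hiso : ∀ u ∈ A, ¬ H.Adj v u)
    (k : ℕ) : EtaGE H A k := by
  intro j _ z hz hbz
  refine ⟨chainCone v (chainDelete v z),
    hz.chainDelete.chainCone hv (A.erase_subset v)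
      fun u hu => hiso u (Finset.mem_of_mem_erase hu), ?_⟩
  rw [chainBoundary_chainCone _ _ (fun s hs => by simp [chainDelete, hs]),
    chainBoundary_chainDelete hbz, add_comm, chainCone_chainLink_add_chainDelete]

variable [DecidableRel H.Adj]

theorem IsIndepChain.chainLink {A : Finset V} {j : ℕ} {v : V}
    {z : Finset V → ZMod 2} (hz : IsIndepChain H A (j + 1) z) :
    IsIndepChain H (A \ insert v (H.neighborFinset v)) j (chainLink v z) := by
  intro s hs
  rw [_root_.chainLink] at hs
  split_ifs at hs with hv
  · exact absurd rfl hs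
  · obtain ⟨h1, h2, h3⟩ := hz _ hs
    refine ⟨fun u hu => ?_, fun u hu w hw => h2 u (by simp [hu]) w (by simp [hw]), ?_⟩
    · simp only [Finset.mem_sdiff, Finset.mem_insert, mem_neighborFinset, not_or]
      refine ⟨h1 (by simp [hu]), ?_, h2 v (by simp) u (by simp [hu])⟩
      rintro rfl
      exact hv hu
    · rw [Finset.card_insert_of_notMem hv] at h3
      omega

theorem EtaGE.of_erase {A : Finset V} {k : ℕ} {v : V} (hdel : EtaGE H (A.erase v) (k + 1))
    (hlink : EtaGE H (A \ insert v (H.neighborFinset v)) k) : EtaGE H A (k + 1) := by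
  by_cases hv : v ∈ A
  swap
  · rwa [Finset.erase_eq_of_notMem hv] at hdel
  intro j hj z hz hbz
  rcases j with _ | j
  · have hz' : IsIndepChain H (A.erase v) 0 z := fun s hs => by
      obtain ⟨_, h2, h3⟩ := hz s hs
      rw [Finset.card_eq_zero] at h3
      subst h3
      simp
    obtain ⟨w, hw, hbw⟩ := hdel 0 hj z hz' hbz
    exact ⟨w, hw.mono (A.erase_subset v), hbw⟩
  · obtain ⟨a, ha, hba⟩ := hlink j (by omega) _ hz.chainLink (chainBoundary_chainLink hbz)
    have hsub : A \ insert v (H.neighborFinset v) ⊆ A.erase v := fun u hu => by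
      simp only [Finset.mem_sdiff, Finset.mem_insert, not_or] at hu
      exact Finset.mem_erase.2 ⟨hu.2.1, hu.1⟩
    have hav : ∀ s, v ∈ s → a s = 0 := fun s hs => by
      by_contra h
      exact Finset.notMem_erase v A (hsub ((ha s h).1 hs))
    have hcone : chainBoundary (chainCone v a) = a + chainCone v (chainLink v z) := by
      rw [chainBoundary_chainCone v a hav, hba]
    have hz' : z + chainBoundary (chainCone v a) = chainDelete v z + a := by
      rw [hcone]
      nth_rewrite 1 [← chainCone_chainLink_add_chainDelete v z]
      ext s
      simp only [Pi.add_apply]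
      linear_combination CharTwo.add_self_eq_zero (chainCone v (chainLink v z) s)
    obtain ⟨w, hw, hbw⟩ := hdel (j + 1) hj (z + chainBoundary (chainCone v a))
      (hz' ▸ hz.chainDelete.add (ha.mono hsub))
      (by rw [chainBoundary_add, hbz, chainBoundary_chainBoundary, add_zero])
    refine ⟨w + chainCone v a, (hw.mono (A.erase_subset v)).add
      (ha.chainCone hv (hsub.trans (A.erase_subset v)) fun u hu hadj => ?_), ?_⟩
    · simp [hadj] at hu
    · rw [chainBoundary_add, hbw, add_assoc]
      ext s
      simp [CharTwo.add_self_eq_zero]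

/-- A lower bound on the connectivity of an independence complex: it suffices that in every
induced subgraph some vertex can be isolated by deleting at most two vertices, at a cost of at
most `c` vertices for each. -/
theorem etaGE_of_forall_subset {c : ℕ} (hc : 0 < c) (A : Finset V)
    (hA : ∀ B ⊆ A, B.Nonempty → ∃ x ∈ B, (∀ w ∈ B, ¬ H.Adj x w) ∨
      ∃ y z, y ≠ x ∧ z ≠ x ∧ (∀ w ∈ B, H.Adj x w → w = y ∨ w = z) ∧
        B.card ≤ (B \ insert y (H.neighborFinset y)).card + c ∧
        B.card ≤ (B.erase y \ insert z (H.neighborFinset z)).card + c)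
    (k : ℕ) (hk : c * k ≤ A.card) : EtaGE H A k := by
  induction k generalizing A with
  | zero => exact fun j hj => absurd hj (by omega)
  | succ k ih =>
    by_cases hne : A.Nonempty
    swap
    · have : 0 < c * (k + 1) := Nat.mul_pos hc k.succ_pos
      rw [Finset.not_nonempty_iff_eq_empty] at hne
      simp only [hne, Finset.card_empty] at hk
      omega
    have hrec : ∀ B ⊆ A, A.card ≤ B.card + c → EtaGE H B k := fun B hB hcard =>
      ih B (fun C hC => hA C (hC.trans hB)) (by rw [mul_add] at hk; omega)
    obtain ⟨x, hx, hiso | ⟨y, z, hy, hz, hxyz, hcy, hcz⟩⟩ := hA A subset_rfl hne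
    · exact etaGE_of_isolated hx hiso _
    · refine .of_erase (v := y) (.of_erase (v := z) ?_ (hrec _ ?_ hcz))
        (hrec _ Finset.sdiff_subset hcy)
      · refine etaGE_of_isolated (v := x) (by simp [hx, hy.symm, hz.symm]) (fun w hw hadj => ?_) _
        simp only [Finset.mem_erase] at hw
        rcases hxyz w hw.2.2 hadj with h | h
        · exact hw.2.1 h
        · exact hw.1 h
      · exact Finset.sdiff_subset.trans (A.erase_subset y)

end Eta

section Sperner

variable {V : Type} [DecidableEq V] {ι : Type} [DecidableEq ι]

/-- The number of ways to delete one vertex from `t` leaving a set that meets exactly the parts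
in `I.erase i` is odd if and only if `t` meets exactly the parts in `I`. -/
theorem card_filter_image_erase (p : V → ι) {I : Finset ι} {i : ι} (hi : i ∈ I) {t : Finset V}
    (hcard : t.card = I.card) (ht : t.image p ⊆ I) :
    (((t.filter fun v => (t.erase v).image p = I.erase i).card : ℕ) : ZMod 2) =
      if t.image p = I then 1 else 0 := by
  split_ifs with himg
  · have hinj : Set.InjOn p t := Finset.card_image_iff.1 (by rw [himg, hcard])
    obtain ⟨v, hv, rfl⟩ := Finset.mem_image.1 (himg ▸ hi)
    have : (t.filter fun u => (t.erase u).image p = I.erase (p v)) = {v} := by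
      ext u
      simp only [Finset.mem_filter, Finset.mem_singleton]
      constructor
      · rintro ⟨hu, h⟩
        by_contra hne
        have : p v ∈ (t.erase u).image p :=
          Finset.mem_image_of_mem p (Finset.mem_erase.2 ⟨Ne.symm hne, hv⟩)
        rw [h] at this
        exact Finset.notMem_erase _ _ this
      · rintro rfl
        refine ⟨hv, ?_⟩
        rw [← himg]
        ext j
        simp only [Finset.mem_image, Finset.mem_erase]
        constructor
        · rintro ⟨w, ⟨hwu, hw⟩, rfl⟩
          exact ⟨fun h => hwu (hinj hw hv h), w, hw, rfl⟩
        · rintro ⟨hj, w, hw, rfl⟩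
          exact ⟨w, ⟨fun h => hj (h ▸ rfl), hw⟩, rfl⟩
    rw [this]
    simp
  · by_cases hex : ∃ v ∈ t, (t.erase v).image p = I.erase i
    swap
    · rw [Finset.filter_false_of_mem fun v hv h => hex ⟨v, hv, h⟩]
      simp
    obtain ⟨v, hv, hvI⟩ := hex
    have hinsert : insert (p v) (I.erase i) = t.image p := by
      rw [← hvI, ← Finset.image_insert, Finset.insert_erase hv]
    have hpv : p v ∈ I.erase i := by
      refine Finset.mem_erase.2 ⟨fun h => himg ?_, ht (Finset.mem_image_of_mem p hv)⟩
      rw [← hinsert, h, Finset.insert_erase hi]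
    have hinj : Set.InjOn p (t.erase v) := Finset.card_image_iff.1 (by
      rw [hvI, Finset.card_erase_of_mem hi, Finset.card_erase_of_mem hv, hcard])
    obtain ⟨u, hu, huv⟩ := Finset.mem_image.1 (hvI ▸ hpv)
    obtain ⟨huv', hut⟩ := Finset.mem_erase.1 hu
    have : (t.filter fun w => (t.erase w).image p = I.erase i) = {u, v} := by
      have himg' : t.image p = I.erase i := by rw [← hinsert, Finset.insert_eq_of_mem hpv]
      ext w
      simp only [Finset.mem_filter, Finset.mem_singleton, Finset.mem_insert]
      constructor
      · rintro ⟨hw, h⟩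
        by_contra! hne
        have : p w ∈ (t.erase w).image p := by
          rw [h, ← himg']
          exact Finset.mem_image_of_mem p hw
        obtain ⟨x, hx, hxw⟩ := Finset.mem_image.1 this
        obtain ⟨hxw', hxt⟩ := Finset.mem_erase.1 hx
        by_cases hxv : x = v
        · subst hxv
          exact hne.1 (hinj (by simp [hne.2, hw]) (by simp [huv', hut]) (by rw [huv, hxw]))
        · exact hxw' (hinj (by simp [hxv, hxt]) (by simp [hne.2, hw]) hxw)
      · rintro (rfl | rfl)
        · refine ⟨hut, ?_⟩
          rw [← himg']
          refine (Finset.image_subset_image (t.erase_subset w)).antisymm fun j hj => ?_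
          obtain ⟨x, hx, rfl⟩ := Finset.mem_image.1 hj
          by_cases hxw : x = w
          · rw [hxw, huv]
            exact Finset.mem_image_of_mem p (Finset.mem_erase.2 ⟨Ne.symm huv', hv⟩)
          · exact Finset.mem_image_of_mem p (Finset.mem_erase.2 ⟨hxw, hx⟩)
        · exact ⟨hv, hvI⟩
    rw [this, Finset.card_pair huv']
    rfl

variable [Fintype V]

/-- Chains `c I` on the independent sets meeting only the parts in `I`, whose boundaries are
those of the faces of a simplex. -/
theorem exists_simplex_chains {H : SimpleGraph V} (p : V → ι) (A : Finset V)
    (h : ∀ I : Finset ι, EtaGE H (A.filter (p · ∈ I)) I.card) (m : ℕ) :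
    ∃ c : Finset ι → Finset V → ZMod 2, c ∅ ∅ = 1 ∧ ∀ I : Finset ι, I.card ≤ m →
      IsIndepChain H (A.filter (p · ∈ I)) I.card (c I) ∧
        chainBoundary (c I) = ∑ i ∈ I, c (I.erase i) := by
  induction m with
  | zero =>
    refine ⟨fun _ s => if s = ∅ then 1 else 0, by simp, fun I hI => ?_⟩
    obtain rfl : I = ∅ := by simpa using hI
    refine ⟨fun s hs => ?_, ?_⟩
    · obtain rfl : s = ∅ := by
        by_contra h
        simp [h] at hs
      simp
    · ext s
      simp [chainBoundary]
  | succ m ih =>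
    obtain ⟨c, hc0, hc⟩ := ih
    have hnew : ∀ I : Finset ι, ∃ w, I.card = m + 1 →
        IsIndepChain H (A.filter (p · ∈ I)) I.card w ∧
          chainBoundary w = ∑ i ∈ I, c (I.erase i) := fun I => by
      by_cases hI : I.card = m + 1
      swap
      · exact ⟨0, fun h => absurd h hI⟩
      have hcard : ∀ i ∈ I, (I.erase i).card = m := fun i hi => by
        rw [Finset.card_erase_of_mem hi, hI, Nat.add_sub_cancel]
      obtain ⟨w, hw⟩ := h I m (by omega) (∑ i ∈ I, c (I.erase i))
        (IsIndepChain.sum I fun i hi => by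
          have := (hc (I.erase i) (hcard i hi).le).1
          rw [hcard i hi] at this
          exact this.mono (Finset.monotone_filter_right A
            fun v _ hv => Finset.mem_of_mem_erase hv))
        (by
          rw [chainBoundary_sum]
          ext s
          simp only [Finset.sum_apply, Pi.zero_apply]
          rw [← sum_sum_erase_eq_zero I (fun a b => c ((I.erase a).erase b) s)
            (fun a b => by rw [Finset.erase_right_comm])]
          refine Finset.sum_congr rfl fun i hi => ?_
          rw [(hc (I.erase i) (hcard i hi).le).2, Finset.sum_apply])
      exact ⟨w, fun _ => by rwa [hI]⟩
    choose w hw using hnew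
    refine ⟨fun I => if I.card = m + 1 then w I else c I, by simpa using hc0, fun I hI => ?_⟩
    have herase : ∑ i ∈ I, (if (I.erase i).card = m + 1 then w (I.erase i) else c (I.erase i)) =
        ∑ i ∈ I, c (I.erase i) := by
      refine Finset.sum_congr rfl fun i hi => ?_
      rw [if_neg]
      rw [Finset.card_erase_of_mem hi]
      omega
    rw [herase]
    by_cases hIm : I.card = m + 1
    · simpa only [if_pos hIm] using hw I hIm
    · simpa only [if_neg hIm] using hc I (by omega)

theorem sum_chainBoundary_erase (p : V → ι) {I : Finset ι} {i : ι} (hi : i ∈ I)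
    {z : Finset V → ZMod 2} (hz : ∀ t, z t ≠ 0 → t.image p ⊆ I ∧ t.card = I.card) :
    ∑ s with s.card = (I.erase i).card ∧ s.image p = I.erase i, chainBoundary z s =
      ∑ t with t.card = I.card ∧ t.image p = I, z t := by
  have hpos : 0 < I.card := Finset.card_pos.2 ⟨i, hi⟩
  have hright : ∑ t with t.card = I.card ∧ t.image p = I, z t =
      ∑ t, ∑ _v ∈ t.filter (fun v => (t.erase v).image p = I.erase i), z t := by
    rw [Finset.sum_filter]
    refine Finset.sum_congr rfl fun t _ => ?_
    rw [Finset.sum_const, nsmul_eq_mul]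
    by_cases ht : z t = 0
    · simp [ht]
    · obtain ⟨h1, h2⟩ := hz t ht
      rw [card_filter_image_erase p hi h2 h1]
      simp [h2]
  rw [hright]
  simp only [chainBoundary]
  rw [Finset.sum_sigma', Finset.sum_sigma', ← Finset.sum_filter_ne_zero,
    ← Finset.sum_filter_ne_zero (s := Finset.sigma Finset.univ _)]
  refine Finset.sum_bij' (fun x _ => ⟨insert x.2 x.1, x.2⟩) (fun x _ => ⟨x.1.erase x.2, x.2⟩)
    ?_ ?_ ?_ ?_ ?_
  · rintro ⟨s, v⟩ h
    simp only [Finset.mem_filter, Finset.mem_sigma, Finset.mem_univ, true_and,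
      Finset.mem_compl] at h ⊢
    exact ⟨⟨Finset.mem_insert_self v s, by rw [Finset.erase_insert h.1.2, h.1.1.2]⟩, h.2⟩
  · rintro ⟨t, v⟩ h
    simp only [Finset.mem_filter, Finset.mem_sigma, Finset.mem_univ, true_and,
      Finset.mem_compl] at h ⊢
    refine ⟨⟨⟨?_, h.1.2⟩, Finset.notMem_erase v t⟩, by rw [Finset.insert_erase h.1.1]; exact h.2⟩
    rw [Finset.card_erase_of_mem h.1.1, Finset.card_erase_of_mem hi, (hz t h.2).2]
  · rintro ⟨s, v⟩ h
    simp only [Finset.mem_filter, Finset.mem_sigma, Finset.mem_compl] at h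
    simp [Finset.erase_insert h.1.2]
  · rintro ⟨t, v⟩ h
    simp only [Finset.mem_filter, Finset.mem_sigma] at h
    simp [Finset.insert_erase h.1.2.1]
  · intros
    rfl

/-- The topological Hall theorem for independence complexes, over `ZMod 2`. -/
theorem exists_transversal_of_etaGE [Fintype ι] {H : SimpleGraph V} (p : V → ι) (A : Finset V)
    (h : ∀ I : Finset ι, EtaGE H (A.filter (p · ∈ I)) I.card) :
    ∃ R ⊆ A, (∀ u ∈ R, ∀ v ∈ R, ¬ H.Adj u v) ∧ R.image p = Finset.univ ∧
      R.card = Fintype.card ι := by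
  obtain ⟨c, hc0, hc⟩ := exists_simplex_chains p A h (Fintype.card ι)
  replace hc := fun I : Finset ι => hc I I.card_le_univ
  have hcimg : ∀ I t, c I t ≠ 0 → t.image p ⊆ I ∧ t.card = I.card := fun I t ht => by
    obtain ⟨h1, _, h3⟩ := (hc I).1 t ht
    refine ⟨fun i hi => ?_, h3⟩
    obtain ⟨v, hv, rfl⟩ := Finset.mem_image.1 hi
    exact (Finset.mem_filter.1 (h1 hv)).2
  have hodd : ∀ I : Finset ι, ∑ t with t.card = I.card ∧ t.image p = I, c I t = 1 := by
    intro I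
    induction I using Finset.induction_on with
    | empty =>
      rw [Finset.sum_eq_single ∅]
      · exact hc0
      · intro t ht hne
        simp [hne] at ht
      · simp
    | insert i I hi ih =>
      rw [← sum_chainBoundary_erase p (Finset.mem_insert_self i I) (hcimg _), ← ih,
        (hc (insert i I)).2, Finset.erase_insert hi]
      refine Finset.sum_congr rfl fun s hs => ?_
      rw [Finset.sum_apply, Finset.sum_eq_single i]
      · rw [Finset.erase_insert hi]
      · intro j hj hji
        by_contra hne
        have hsub := (hcimg _ s hne).1
        rw [(Finset.mem_filter.1 hs).2.2] at hsub
        exact Finset.notMem_erase j _ (hsub (Finset.mem_of_mem_insert_of_ne hj hji))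
      · exact fun h => absurd (Finset.mem_insert_self i I) h
  obtain ⟨R, hR, hne⟩ := Finset.exists_ne_zero_of_sum_ne_zero
    ((hodd Finset.univ).trans_ne one_ne_zero)
  obtain ⟨h1, h2, _⟩ := (hc Finset.univ).1 R hne
  obtain ⟨_, hcard, himg⟩ := Finset.mem_filter.1 hR
  exact ⟨R, h1.trans (Finset.filter_subset _ _), h2, himg, hcard⟩

end Sperner

theorem connectedComponent_supp_subset {V : Type} [Fintype V] {H : SimpleGraph V}
    [DecidableRel H.Adj] {B : Finset V} (hB : ∀ v ∈ B, H.neighborFinset v ⊆ B) {x : V}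
    (hx : x ∈ B) : (H.connectedComponentMk x).supp ⊆ B := by
  intro w hw
  rw [ConnectedComponent.mem_supp_iff, ConnectedComponent.eq] at hw
  obtain ⟨q⟩ := hw.symm
  clear hw
  induction q with
  | nil => exact hx
  | cons hadj _ ih => exact ih (hB _ hx (by simpa using hadj))

section MaxDegreeTwo

variable {V : Type} [Fintype V] [DecidableEq V] {H : SimpleGraph V} [DecidableRel H.Adj]

theorem card_le_card_sdiff_closedNbhd (hΔ : ∀ v, H.degree v ≤ 2) (B : Finset V) (y : V) :
    B.card ≤ (B \ insert y (H.neighborFinset y)).card + 3 := by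
  have h1 := Finset.card_le_card_sdiff_add_card (s := B) (t := insert y (H.neighborFinset y))
  have h2 := Finset.card_insert_le y (H.neighborFinset y)
  have h3 := hΔ y
  rw [← card_neighborFinset_eq_degree] at h3
  omega

theorem exists_neighbors_of_degree_le_two (hΔ : ∀ v, H.degree v ≤ 2) (B : Finset V) (x : V) :
    (∀ w ∈ B, ¬ H.Adj x w) ∨
      ∃ y z, H.neighborFinset x ∩ B = {y, z} ∧ y ≠ x ∧ z ≠ x ∧
        ∀ w ∈ B, H.Adj x w → w = y ∨ w = z := by
  have hle : (H.neighborFinset x ∩ B).card ≤ 2 :=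
    (Finset.card_le_card Finset.inter_subset_left).trans
      (by rw [card_neighborFinset_eq_degree]; exact hΔ x)
  have hpair : ∀ y z, H.neighborFinset x ∩ B = {y, z} →
      y ≠ x ∧ z ≠ x ∧ ∀ w ∈ B, H.Adj x w → w = y ∨ w = z := fun y z h => by
    have hmem : ∀ w, w ∈ H.neighborFinset x ∩ B ↔ w = y ∨ w = z := fun w => by rw [h]; simp
    simp only [Finset.mem_inter, mem_neighborFinset] at hmem
    exact ⟨((hmem y).2 (.inl rfl)).1.ne', ((hmem z).2 (.inr rfl)).1.ne',
      fun w hw hadj => (hmem w).1 ⟨hadj, hw⟩⟩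
  rcases Nat.lt_or_ge (H.neighborFinset x ∩ B).card 1 with h | h
  · left
    intro w hw hadj
    have : H.neighborFinset x ∩ B = ∅ := Finset.card_eq_zero.1 (by omega)
    exact Finset.notMem_empty w (this ▸ by simp [hw, hadj])
  · right
    obtain h | h : (H.neighborFinset x ∩ B).card = 1 ∨ (H.neighborFinset x ∩ B).card = 2 := by
      omega
    · obtain ⟨y, hy⟩ := Finset.card_eq_one.1 h
      have hyy : H.neighborFinset x ∩ B = {y, y} := by simpa using hy
      exact ⟨y, y, hyy, hpair y y hyy⟩
    · obtain ⟨y, z, _, hyz⟩ := Finset.card_eq_two.1 h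
      exact ⟨y, z, hyz, hpair y z hyz⟩

theorem etaGE_of_four_mul_le_card (hΔ : ∀ v, H.degree v ≤ 2) (A : Finset V) (k : ℕ)
    (hk : 4 * k ≤ A.card) : EtaGE H A k := by
  refine etaGE_of_forall_subset (by norm_num) A (fun B _ ⟨x, hx⟩ => ⟨x, hx, ?_⟩) k hk
  rcases exists_neighbors_of_degree_le_two hΔ B x with h | ⟨y, z, _, hy, hz, hyz⟩
  · exact .inl h
  · have h1 := card_le_card_sdiff_closedNbhd hΔ B y
    have h2 := card_le_card_sdiff_closedNbhd hΔ (B.erase y) z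
    have h3 := Finset.pred_card_le_card_erase (s := B) (a := y)
    exact .inr ⟨y, z, hy, hz, hyz, by omega, by omega⟩

theorem etaGE_of_three_mul_le_card (hΔ : ∀ v, H.degree v ≤ 2) (A : Finset V)
    (hA : ∀ C : H.ConnectedComponent, C.supp ⊆ A → C.supp.ncard ≤ 3) (k : ℕ)
    (hk : 3 * k ≤ A.card) : EtaGE H A k := by
  refine etaGE_of_forall_subset (by norm_num) A (fun B hBA hne => ?_) k hk
  by_cases hdeg : ∀ x ∈ B, (H.neighborFinset x ∩ B).card = 2
  · have hclosed : ∀ v ∈ B, H.neighborFinset v ⊆ B := fun v hv => by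
      refine Finset.inter_eq_left.1 (Finset.eq_of_subset_of_card_le Finset.inter_subset_left ?_)
      rw [hdeg v hv, card_neighborFinset_eq_degree]
      exact hΔ v
    have hcard : ∀ v ∈ B, (H.neighborFinset v).card = 2 := fun v hv => by
      rw [← hdeg v hv, Finset.inter_eq_left.2 (hclosed v hv)]
    obtain ⟨x, hx⟩ := hne
    obtain ⟨y, z, hne, hxN⟩ := Finset.card_eq_two.1 (hcard x hx)
    have hxy : H.Adj x y := by rw [← mem_neighborFinset, hxN]; simp
    have hxz : H.Adj x z := by rw [← mem_neighborFinset, hxN]; simp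
    have hzB : z ∈ B := hclosed x hx (by simpa using hxz)
    have hsupp : (↑({x, y, z} : Finset V) : Set V) = (H.connectedComponentMk x).supp := by
      refine Set.eq_of_subset_of_ncard_le ?_ ?_ (Set.toFinite _)
      · intro w hw
        simp only [Finset.coe_insert, Finset.coe_singleton, Set.mem_insert_iff,
          Set.mem_singleton_iff] at hw
        rw [ConnectedComponent.mem_supp_iff, ConnectedComponent.eq]
        rcases hw with rfl | rfl | rfl
        · exact .refl _
        · exact hxy.symm.reachable
        · exact hxz.symm.reachable
      · rw [Set.ncard_coe_finset, Finset.card_eq_three.2 ⟨x, y, z, hxy.ne, hxz.ne, hne, rfl⟩]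
        exact hA _ ((connectedComponent_supp_subset hclosed hx).trans (by exact_mod_cast hBA))
    have hzN : H.neighborFinset z = {x, y} := by
      refine Finset.eq_of_subset_of_card_le (fun w hw => ?_) ?_
      · rw [mem_neighborFinset] at hw
        have hw' : w ∈ (H.connectedComponentMk x).supp := by
          rw [ConnectedComponent.mem_supp_iff, ConnectedComponent.eq]
          exact (hxz.reachable.trans hw.reachable).symm
        rw [← hsupp] at hw'
        have := hw.ne'
        simp only [Finset.coe_insert, Finset.coe_singleton, Set.mem_insert_iff,
          Set.mem_singleton_iff] at hw'
        simp only [Finset.mem_insert, Finset.mem_singleton]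
        tauto
      · rw [hcard z hzB]
        exact Finset.card_le_two
    refine ⟨x, hx, .inr ⟨y, z, hxy.ne', hxz.ne', fun w _ hadj => ?_,
      card_le_card_sdiff_closedNbhd hΔ B y, ?_⟩⟩
    · rw [← mem_neighborFinset, hxN] at hadj
      simpa using hadj
    · have : B.erase y \ insert z (H.neighborFinset z) = B \ insert z (H.neighborFinset z) := by
        ext w
        simp only [Finset.mem_sdiff, Finset.mem_erase, hzN, Finset.mem_insert,
          Finset.mem_singleton]
        tauto
      rw [this]
      exact card_le_card_sdiff_closedNbhd hΔ B z
  · push Not at hdeg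
    obtain ⟨x, hx, hdeg⟩ := hdeg
    refine ⟨x, hx, ?_⟩
    rcases exists_neighbors_of_degree_le_two hΔ B x with h | ⟨y, z, hN, hy, hz, hyz⟩
    · exact .inl h
    · obtain rfl : y = z := by
        by_contra hne
        exact hdeg (by rw [hN, Finset.card_pair hne])
      have : B.erase y \ insert y (H.neighborFinset y) = B \ insert y (H.neighborFinset y) := by
        ext w
        simp only [Finset.mem_sdiff, Finset.mem_erase, Finset.mem_insert]
        tauto
      have hcard := card_le_card_sdiff_closedNbhd hΔ B y
      exact .inr ⟨y, y, hy, hz, hyz, hcard, by rwa [this]⟩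

end MaxDegreeTwo

theorem card_filter_mem_of_card_fibers {V ι : Type} [DecidableEq ι] (p : V → ι) (A : Finset V)
    (d : ℕ) (hd : ∀ i, (A.filter (p · = i)).card = d) (I : Finset ι) :
    (A.filter (p · ∈ I)).card = d * I.card := by
  have hmaps : Set.MapsTo p (A.filter (p · ∈ I)) I := fun v hv => (Finset.mem_filter.1 hv).2
  rw [Finset.card_eq_sum_card_fiberwise hmaps, mul_comm, ← smul_eq_mul, ← Finset.sum_const]
  refine Finset.sum_congr rfl fun i hi => ?_
  rw [← hd i, Finset.filter_filter]
  congr 1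
  ext v
  simp only [Finset.mem_filter]
  constructor
  · rintro ⟨h1, _, h2⟩
    exact ⟨h1, h2⟩
  · rintro ⟨h1, rfl⟩
    exact ⟨h1, hi, rfl⟩

theorem card_fiber_eq_one {V ι : Type} [DecidableEq ι] [Fintype ι] {p : V → ι} {R : Finset V}
    (himg : R.image p = Finset.univ) (hcard : R.card = Fintype.card ι) (i : ι) :
    (R.filter (p · = i)).card = 1 := by
  have hinj : Set.InjOn p R := Finset.card_image_iff.1 (by rw [himg, hcard, Finset.card_univ])
  obtain ⟨r, hr, rfl⟩ := Finset.mem_image.1 (himg ▸ Finset.mem_univ i)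
  refine Finset.card_eq_one.2 ⟨r, ?_⟩
  ext v
  simp only [Finset.mem_filter, Finset.mem_singleton]
  constructor
  · rintro ⟨hv, h⟩
    exact hinj hv hr h
  · rintro rfl
    exact ⟨hr, rfl⟩

section Transversals

variable {V : Type} [Fintype V] [DecidableEq V] {ι : Type} [DecidableEq ι]

/-- A partial transversal meeting all components of size at least `d`. -/
theorem exists_partial_transversal (H : SimpleGraph V) (p : V → ι) (U : Finset V) {d : ℕ}
    (hd0 : 0 < d) (hd : ∀ i, (U.filter (p · = i)).card = d) :
    ∃ T : Finset V, Set.InjOn p T ∧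
      ∀ C : H.ConnectedComponent, C.supp ⊆ U → d ≤ C.supp.ncard → ∃ x ∈ T, x ∈ C.supp := by
  classical
  let D := {C : H.ConnectedComponent // C.supp ⊆ U ∧ d ≤ C.supp.ncard}
  let S : D → Finset V := fun C => C.1.supp.toFinset
  have hS : ∀ C v, v ∈ S C ↔ H.connectedComponentMk v = C.1 := fun C v => by
    simp [S, ConnectedComponent.mem_supp_iff]
  obtain ⟨f, hf, hfS⟩ := (Finset.all_card_le_biUnion_card_iff_exists_injective
    (fun C : D => (S C).image p)).1 (fun s => by
      have h1 : d * s.card ≤ (s.biUnion S).card := by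
        rw [Finset.card_biUnion]
        · rw [mul_comm, ← smul_eq_mul, ← Finset.sum_const]
          refine Finset.sum_le_sum fun C _ => ?_
          rw [← Set.ncard_eq_toFinset_card']
          exact C.2.2
        · intro C _ C' _ hne
          refine Finset.disjoint_left.2 fun v hv hv' => hne (Subtype.ext ?_)
          rw [hS] at hv hv'
          exact hv.symm.trans hv'
      have h2 : s.biUnion S ⊆ U.filter (p · ∈ s.biUnion fun C => (S C).image p) := by
        intro v hv
        obtain ⟨C, hC, hvC⟩ := Finset.mem_biUnion.1 hv
        refine Finset.mem_filter.2 ⟨?_, Finset.mem_biUnion.2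
          ⟨C, hC, Finset.mem_image_of_mem p hvC⟩⟩
        exact_mod_cast C.2.1 (by simpa [S] using hvC)
      have h3 := Finset.card_le_card h2
      rw [card_filter_mem_of_card_fibers p U d hd] at h3
      exact Nat.le_of_mul_le_mul_left (h1.trans h3) hd0)
  choose x hxS hxf using fun C => Finset.mem_image.1 (hfS C)
  refine ⟨Finset.univ.image x, ?_, fun C hC hCd => ⟨x ⟨C, hC, hCd⟩, by simp, ?_⟩⟩
  · intro v hv w hw h
    simp only [Finset.coe_image, Finset.coe_univ, Set.image_univ, Set.mem_range] at hv hw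
    obtain ⟨C, rfl⟩ := hv
    obtain ⟨C', rfl⟩ := hw
    rw [hxf, hxf] at h
    rw [hf h]
  · simpa [S] using hxS ⟨C, hC, hCd⟩

/-- A transversal that shares as many vertices as possible with a given partial transversal `T`
meets every component that `T` meets. -/
theorem exists_transversal_meeting_components [Fintype ι] {H : SimpleGraph V} (p : V → ι)
    (U T R₀ : Finset V) (hT : Set.InjOn p T) (hR₀U : R₀ ⊆ U)
    (hR₀ : ∀ u ∈ R₀, ∀ v ∈ R₀, ¬ H.Adj u v) (himg : R₀.image p = Finset.univ)
    (hcard : R₀.card = Fintype.card ι) :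
    ∃ R ⊆ U, (∀ u ∈ R, ∀ v ∈ R, ¬ H.Adj u v) ∧ R.image p = Finset.univ ∧
      R.card = Fintype.card ι ∧ ∀ C : H.ConnectedComponent, C.supp ⊆ U →
        (∃ x ∈ T, x ∈ C.supp) → ∃ r ∈ R, r ∈ C.supp := by
  classical
  let F : Finset (Finset V) := Finset.univ.filter fun R => R ⊆ U ∧
    (∀ u ∈ R, ∀ v ∈ R, ¬ H.Adj u v) ∧ R.image p = Finset.univ ∧ R.card = Fintype.card ι
  obtain ⟨R, hRF, hmax⟩ := F.exists_max_image (fun R => (R ∩ T).card)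
    ⟨R₀, by simp only [F, Finset.mem_filter, Finset.mem_univ, true_and]; tauto⟩
  obtain ⟨hRU, hind, hRimg, hRcard⟩ := (Finset.mem_filter.1 hRF).2
  refine ⟨R, hRU, hind, hRimg, hRcard, ?_⟩
  rintro C hCU ⟨x, hxT, hxC⟩
  by_contra! hC
  have hxR : x ∉ R := fun h => hC x h hxC
  obtain ⟨r, hr, hrx⟩ := Finset.mem_image.1 (hRimg ▸ Finset.mem_univ (p x))
  have hrT : r ∉ T := fun h => hxR (hT h hxT hrx ▸ hr)
  have hxadj : ∀ v ∈ R, ¬ H.Adj x v := fun v hv hadj => hC v hv (by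
    rw [ConnectedComponent.mem_supp_iff] at hxC ⊢
    rw [← hxC, ConnectedComponent.eq]
    exact hadj.symm.reachable)
  have hmem : insert x (R.erase r) ∈ F := by
    refine Finset.mem_filter.2 ⟨Finset.mem_univ _, ?_, ?_, ?_, ?_⟩
    · exact Finset.insert_subset (by exact_mod_cast hCU hxC) ((R.erase_subset r).trans hRU)
    · intro u hu v hv
      rcases Finset.mem_insert.1 hu with rfl | hu' <;>
        rcases Finset.mem_insert.1 hv with rfl | hv'
      · exact H.loopless.irrefl _
      · exact hxadj v (Finset.mem_of_mem_erase hv')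
      · exact fun h => hxadj u (Finset.mem_of_mem_erase hu') h.symm
      · exact hind u (Finset.mem_of_mem_erase hu') v (Finset.mem_of_mem_erase hv')
    · rw [Finset.image_insert, ← hrx, ← Finset.image_insert, Finset.insert_erase hr, hRimg]
    · rw [Finset.card_insert_of_notMem (fun h => hxR (Finset.mem_of_mem_erase h)),
        Finset.card_erase_add_one hr, hRcard]
  have hinter : insert x (R.erase r) ∩ T = insert x (R ∩ T) := by
    ext v
    simp only [Finset.mem_inter, Finset.mem_insert, Finset.mem_erase]
    constructor
    · tauto
    · rintro (rfl | ⟨h1, h2⟩)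
      · exact ⟨.inl rfl, hxT⟩
      · exact ⟨.inr ⟨fun h => hrT (h ▸ h2), h1⟩, h2⟩
  have := hmax _ hmem
  rw [hinter, Finset.card_insert_of_notMem (by simp [hxR])] at this
  omega

end Transversals

theorem stmt_4 {V : Type} [Fintype V] [DecidableEq V]
    (H : SimpleGraph V) [DecidableRel H.Adj]
    (hΔ : ∀ v, H.degree v ≤ 2)
    {n : ℕ} (Vs : Fin n → Finset V)
    (hdisj : ∀ i j, i ≠ j → Disjoint (Vs i) (Vs j))
    (hcard : ∀ i, (Vs i).card = 4) :
    ∃ R₁ R₂ : Finset V, Disjoint R₁ R₂ ∧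
      ((∀ u ∈ R₁, ∀ v ∈ R₁, ¬ H.Adj u v) ∧
        (∀ i, (R₁ ∩ Vs i).card = 1) ∧ R₁ ⊆ Finset.univ.biUnion Vs) ∧
      ((∀ u ∈ R₂, ∀ v ∈ R₂, ¬ H.Adj u v) ∧
        (∀ i, (R₂ ∩ Vs i).card = 1) ∧ R₂ ⊆ Finset.univ.biUnion Vs) := by
  rcases Nat.eq_zero_or_pos n with rfl | hn
  · exact ⟨∅, ∅, by simp, ⟨by simp, fun i => i.elim0, by simp⟩,
      by simp, fun i => i.elim0, by simp⟩
  set U := Finset.univ.biUnion Vs with hU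
  have hp : ∀ v, ∃ i, ∀ j, v ∈ Vs j → i = j := fun v => by
    by_cases h : ∃ i, v ∈ Vs i
    · obtain ⟨i, hi⟩ := h
      refine ⟨i, fun j hj => ?_⟩
      by_contra hij
      exact Finset.disjoint_left.1 (hdisj i j hij) hi hj
    · exact ⟨⟨0, hn⟩, fun j hj => absurd ⟨j, hj⟩ h⟩
  choose p hp using hp
  have hpU : ∀ v ∈ U, ∀ i, v ∈ Vs i ↔ p v = i := fun v hv i => by
    obtain ⟨j, _, hj⟩ := Finset.mem_biUnion.1 hv
    constructor
    · exact hp v i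
    · rintro rfl
      rwa [hp v j hj]
  have hinter : ∀ R ⊆ U, ∀ i, R ∩ Vs i = R.filter (p · = i) := fun R hR i => by
    ext v
    simp only [Finset.mem_inter, Finset.mem_filter]
    exact and_congr_right fun hv => hpU v (hR hv) i
  have hVsU : ∀ i, U.filter (p · = i) = Vs i := fun i => by
    rw [← hinter U subset_rfl i, Finset.inter_eq_right]
    exact Finset.subset_biUnion_of_mem Vs (Finset.mem_univ i)
  have hfour : ∀ i, (U.filter (p · = i)).card = 4 := fun i => by rw [hVsU, hcard]
  obtain ⟨T, hT, hTC⟩ := exists_partial_transversal H p U (by norm_num) hfour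
  obtain ⟨R₀, hR₀U, hR₀, hR₀img, hR₀card⟩ := exists_transversal_of_etaGE (H := H) p U fun I =>
    etaGE_of_four_mul_le_card hΔ _ _ (card_filter_mem_of_card_fibers p U 4 hfour I).ge
  obtain ⟨R₁, hR₁U, hR₁, hR₁img, hR₁card, hR₁C⟩ :=
    exists_transversal_meeting_components p U T R₀ hT hR₀U hR₀ hR₀img hR₀card
  have hone := card_fiber_eq_one hR₁img hR₁card
  have hthree : ∀ i, ((U \ R₁).filter (p · = i)).card = 3 := fun i => by
    have hsub : R₁.filter (p · = i) ⊆ U.filter (p · = i) := Finset.filter_subset_filter _ hR₁U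
    have hsdiff : (U \ R₁).filter (p · = i) = U.filter (p · = i) \ R₁.filter (p · = i) := by
      ext v
      simp only [Finset.mem_filter, Finset.mem_sdiff]
      tauto
    rw [hsdiff, Finset.card_sdiff_of_subset hsub, hfour, hone]
  obtain ⟨R₂, hR₂U, hR₂, hR₂img, hR₂card⟩ :=
    exists_transversal_of_etaGE (H := H) p (U \ R₁) fun I =>
      etaGE_of_three_mul_le_card hΔ _ (fun C hC => by
        have hCU : C.supp ⊆ (U \ R₁ : Finset V) :=
          hC.trans (by exact_mod_cast Finset.filter_subset _ _)
        have hCU' : C.supp ⊆ U := hCU.trans (by exact_mod_cast Finset.sdiff_subset)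
        by_contra! hlt
        obtain ⟨r, hr, hrC⟩ := hR₁C C hCU' (hTC C hCU' hlt)
        exact (Finset.mem_sdiff.1 (Finset.mem_coe.1 (hCU hrC))).2 hr) _
        (card_filter_mem_of_card_fibers p (U \ R₁) 3 hthree I).ge
  have hR₂U' : R₂ ⊆ U := hR₂U.trans Finset.sdiff_subset
  refine ⟨R₁, R₂, ?_, ⟨hR₁, fun i => ?_, hR₁U⟩, hR₂, fun i => ?_, hR₂U'⟩
  · exact Finset.disjoint_of_subset_right hR₂U Finset.disjoint_sdiff
  · rw [hinter R₁ hR₁U, hone]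
  · rw [hinter R₂ hR₂U', card_fiber_eq_one hR₂img hR₂card]
end

section
/- Let H be a (finite simple) graph with maximum degree at most 2, and let G be obtained from H by gluing in vertex-disjoint copies of K_4. Let C be the set of odd cycles in H of length exceeding 3, and let V(C) be the set of vertices contained in these cycles. Then there is a set of vertices Z ⊆ V(C) containing at most one vertex from each cycle in C, with |Z| ≤ |C|/2, such that G − Z is 4-colorable; moreover |V(G) \ Z| ≥ (9/10)|V(G)|. -/
open SimpleGraph

/-- `G` is obtained from `H` by gluing in vertex-disjoint copies of `K₄`. -/
def GluedK4 {V : Type} [DecidableEq V] (H G : SimpleGraph V) : Prop :=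
  ∃ (q : ℕ) (Y : Fin q → Finset V),
    (∀ j, (Y j).card = 4) ∧
    (∀ i j, i ≠ j → Disjoint (Y i) (Y j)) ∧
    ∀ u v, G.Adj u v ↔ H.Adj u v ∨ (u ≠ v ∧ ∃ j, u ∈ Y j ∧ v ∈ Y j)

/-- `f` gives different colors to the two ends of each pair `{x, m x}` with `m x ≠ x`. -/
def Splits {V : Type} (m : V → V) (f : V → Bool) : Prop :=
  ∀ x, m x ≠ x → f (m x) ≠ f x

lemma exists_splits_of_fixedPointFree {W : Type} (p q : Equiv.Perm W)
    (hp : ∀ x, p (p x) = x) (hq : ∀ x, q (q x) = x)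
    (hp' : ∀ x, p x ≠ x) (hq' : ∀ x, q x ≠ x) :
    ∃ f : W → Bool, Splits p f ∧ Splits q f := by
  classical
  set r : Equiv.Perm W := p * q with hr
  have hpp : p⁻¹ = p := by ext x; rw [Equiv.Perm.inv_eq_iff_eq]; exact (hp x).symm
  have hqq : q⁻¹ = q := by ext x; rw [Equiv.Perm.inv_eq_iff_eq]; exact (hq x).symm
  have hconj : ∀ k : ℤ, p * r ^ k * p⁻¹ = r ^ (-k) := by
    intro k
    rw [← conj_zpow, zpow_neg, ← inv_zpow]
    congr 1
    rw [hr, mul_inv_rev, hqq, hpp]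
    ext x; simp [hp]
  have hconj' : ∀ (k : ℤ) (x : W), p ((r ^ k) x) = (r ^ (-k)) (p x) := by
    intro k x
    have := congrArg (fun s : Equiv.Perm W => s (p x)) (hconj k)
    simpa using this
  have hqr : ∀ x, q x = p (r x) := by intro x; simp [hr, hp]
  let c : W → Quotient (Equiv.Perm.SameCycle.setoid r) := fun x => Quotient.mk _ x
  have hc : ∀ x y, c x = c y ↔ r.SameCycle x y := fun x y => Quotient.eq
  have hcp : ∀ x y, c x = c y → c (p x) = c (p y) := by
    intro x y h
    rw [hc] at h ⊢
    obtain ⟨k, rfl⟩ := h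
    exact ⟨-k, (hconj' k x).symm⟩
  have hcr : ∀ x, c (r x) = c x := by
    intro x; rw [hc]; exact ⟨-1, by simp⟩
  have hne : ∀ x, c x ≠ c (p x) := by
    intro x h
    rw [hc] at h
    obtain ⟨k, hk⟩ := h
    rcases Int.even_or_odd' k with ⟨j, rfl | rfl⟩
    · apply hp' ((r ^ j) x)
      rw [hconj', ← hk, ← Equiv.Perm.mul_apply, ← zpow_add]
      congr 2; ring
    · apply hq' ((r ^ j) x)
      rw [hqr]
      rw [← Equiv.Perm.mul_apply r, ← zpow_one_add, hconj', ← hk, ← Equiv.Perm.mul_apply,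
        ← zpow_add]
      congr 2; ring
  have hcq : ∀ x, c (q x) = c (p x) := by
    intro x; rw [hqr]; exact hcp _ _ (hcr x)
  have hcpq : ∀ x, c (p (q x)) = c x := fun x => hcr x
  refine ⟨fun x => decide (WellOrderingRel (c x) (c (p x))), ?_, ?_⟩
  · intro x _ h
    simp only [hp, decide_eq_decide] at h
    rcases trichotomous_of WellOrderingRel (c x) (c (p x)) with h1 | h1 | h1
    · exact asymm h1 (h.2 h1)
    · exact hne x h1
    · exact asymm h1 (h.1 h1)
  · intro x _ h
    simp only [hcq, hcpq, decide_eq_decide] at h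
    rcases trichotomous_of WellOrderingRel (c x) (c (p x)) with h1 | h1 | h1
    · exact asymm h1 (h.2 h1)
    · exact hne x h1
    · exact asymm h1 (h.1 h1)

/-- The union of two matchings is bipartite. -/
lemma exists_splits {V : Type} {p q : V → V} (hp : Function.Involutive p)
    (hq : Function.Involutive q) : ∃ f : V → Bool, Splits p f ∧ Splits q f := by
  classical
  have key : ∀ p : V → V, Function.Involutive p → ∃ P : Equiv.Perm (V × Bool),
      (∀ x, P (P x) = x) ∧ (∀ x, P x ≠ x) ∧ ∀ x, p x ≠ x → P (x, true) = (p x, true) := by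
    intro p hp
    let F : V × Bool → V × Bool := fun x => if p x.1 = x.1 then (x.1, !x.2) else (p x.1, x.2)
    have hF : Function.Involutive F := by
      rintro ⟨x, b⟩
      by_cases h : p x = x
      · simp [F, h]
      · have : p (p x) ≠ p x := fun h' => h (hp.injective h')
        simp [F, h, hp x, Ne.symm h]
    refine ⟨hF.toPerm, hF, ?_, ?_⟩
    · rintro ⟨x, b⟩
      by_cases h : p x = x <;> simp [F, h]
    · intro x h
      simp [F, h]
  obtain ⟨P, hP, hP', hP''⟩ := key p hp
  obtain ⟨Q, hQ, hQ', hQ''⟩ := key q hq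
  obtain ⟨f, hf, hf'⟩ := exists_splits_of_fixedPointFree P Q hP hQ hP' hQ'
  refine ⟨fun x => f (x, true), fun x hx => ?_, fun x hx => ?_⟩
  · simpa [hP'' x hx] using hf (x, true) (hP' _)
  · simpa [hQ'' x hx] using hf' (x, true) (hQ' _)

/-- If `C` has odd size and every element of `C` is fixed by the involution `m`, then some
orbit of the group generated by `p` and `m` meets `C` in exactly one element. -/
lemma exists_isolating_orbit {V : Type} {p m : V → V} (hp : Function.Involutive p)
    (hm : Function.Involutive m) (C : Finset V) (hC : Odd C.card) (hfix : ∀ c ∈ C, m c = c) :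
    ∃ t ∈ C, ∃ d : V → Bool, (∀ x, d (p x) = d x) ∧ (∀ x, d (m x) = d x) ∧ d t = true ∧
      ∀ c ∈ C, c ≠ t → d c = false := by
  classical
  set P := hp.toPerm with hP
  set M := hm.toPerm with hM
  have hPa : ∀ x, P x = p x := fun x => rfl
  have hMa : ∀ x, M x = m x := fun x => rfl
  have hpp : P⁻¹ = P := by ext x; rw [Equiv.Perm.inv_eq_iff_eq]; exact (hp x).symm
  have hmm : M⁻¹ = M := by ext x; rw [Equiv.Perm.inv_eq_iff_eq]; exact (hm x).symm
  set r : Equiv.Perm V := P * M with hr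
  have hra : ∀ x, r x = p (m x) := fun x => rfl
  have hconj : ∀ k : ℤ, M * r ^ k * M⁻¹ = r ^ (-k) := by
    intro k
    rw [← conj_zpow, zpow_neg, ← inv_zpow]
    congr 1
    rw [hr, mul_inv_rev, hmm, hpp]
    ext x; simp [hMa, hm x]
  have hconj' : ∀ (k : ℤ) (x : V), m ((r ^ k) x) = (r ^ (-k)) (m x) := by
    intro k x
    have := congrArg (fun s : Equiv.Perm V => s (m x)) (hconj k)
    simpa [hmm, hMa, hm x] using this
  have hdouble : ∀ t ∈ C, ∀ k : ℤ, (r ^ k) t ∈ C → (r ^ (2 * k)) t = t := by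
    intro t ht k hk
    have h := hfix _ hk
    rw [hconj', hfix t ht] at h
    rw [two_mul, zpow_add, Equiv.Perm.mul_apply, ← h, ← Equiv.Perm.mul_apply, ← zpow_add]
    simp
  have hdvd : ∀ (t : V) (k : ℤ), (r ^ k) t = t ↔ (Function.minimalPeriod (r • ·) t : ℤ) ∣ k := by
    intro t k
    exact MulAction.zpow_smul_eq_iff_minimalPeriod_dvd (a := r) (b := t)
  have huniq : ∀ t ∈ C, ∀ a ∈ C, ∀ b ∈ C, a ≠ t → b ≠ t → r.SameCycle t a →
      r.SameCycle t b → a = b := by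
    rintro t ht _ ha _ hb hat hbt ⟨k, rfl⟩ ⟨l, rfl⟩
    have h1 := (hdvd _ _).1 (hdouble t ht k ha)
    have h2 := (hdvd _ _).1 (hdouble t ht l hb)
    have h3 := (hdvd t k).not.1 hat
    have h4 := (hdvd t l).not.1 hbt
    obtain ⟨a, ha'⟩ := h1
    obtain ⟨b, hb'⟩ := h2
    have h5 : (r ^ (k - l)) t = t := by
      rw [hdvd]
      rcases Int.even_or_odd' a with ⟨a, rfl | rfl⟩
      · exact absurd ⟨a, by linarith⟩ h3
      rcases Int.even_or_odd' b with ⟨b, rfl | rfl⟩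
      · exact absurd ⟨b, by linarith⟩ h4
      exact ⟨a - b, by linarith⟩
    have : k = l + (k - l) := by ring
    rw [this, zpow_add, Equiv.Perm.mul_apply, h5]
  have hex : ∃ t ∈ C, ∀ c ∈ C, c ≠ t → ¬ r.SameCycle t c := by
    by_contra! hcon
    choose! φ hφ1 hφ2 hφ3 using hcon
    have hsum : ∑ c ∈ C, (1 : ZMod 2) = 0 := by
      refine Finset.sum_involution (fun c _ => φ c) (fun _ _ => by decide)
        (fun c hc _ => hφ2 c hc) (fun c hc => hφ1 c hc) (fun c hc => ?_)
      exact huniq (φ c) (hφ1 c hc) _ (hφ1 _ (hφ1 c hc)) _ hc (hφ2 _ (hφ1 c hc))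
        (hφ2 c hc).symm (hφ3 _ (hφ1 c hc)) (hφ3 c hc).symm
    rw [Finset.sum_const, nsmul_one, ZMod.natCast_eq_zero_iff_even] at hsum
    exact (Nat.not_even_iff_odd.2 hC) hsum
  obtain ⟨t, ht, hiso⟩ := hex
  have hm1 : ∀ x, r.SameCycle t x → r.SameCycle t (m x) := by
    rintro _ ⟨k, rfl⟩
    exact ⟨-k, by rw [hconj', hfix t ht]⟩
  have hm2 : ∀ x, r.SameCycle t (m x) ↔ r.SameCycle t x :=
    fun x => ⟨fun h => by simpa [hm x] using hm1 _ h, hm1 x⟩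
  have hp2 : ∀ x, r.SameCycle t (p x) ↔ r.SameCycle t x := by
    intro x
    have : p x = r (m x) := by rw [hra, hm x]
    rw [this, Equiv.Perm.sameCycle_apply_right, hm2]
  refine ⟨t, ht, fun x => decide (r.SameCycle t x), fun x => ?_, fun x => ?_, ?_, ?_⟩
  · simp only [hp2]
  · simp only [hm2]
  · simpa using Equiv.Perm.SameCycle.refl r t
  · intro c hc hct
    simpa using hiso c hc hct

/-- No vertex has three distinct neighbors. -/
def AtMostTwoNeighbors {V : Type} (H : SimpleGraph V) : Prop :=
  ∀ ⦃x a b c⦄, H.Adj x a → H.Adj x b → H.Adj x c → a = b ∨ a = c ∨ b = c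

/-- The vertex `x` has at least two neighbors. -/
def IsBranch {V : Type} (H : SimpleGraph V) (x : V) : Prop :=
  ∃ a b, a ≠ b ∧ H.Adj x a ∧ H.Adj x b

/-- The involution `m` encodes a matching of `H`: its edges are the pairs `{x, m x}` with
`m x ≠ x`. -/
structure IsMatchingMap {V : Type} (H : SimpleGraph V) (m : V → V) : Prop where
  invol : Function.Involutive m
  adj : ∀ x, m x ≠ x → H.Adj x (m x)

/-- Replace the matching edge `{u, m u}` by `{x, u}`. -/
def shift {V : Type} [DecidableEq V] (m : V → V) (x u : V) : V → V :=
  fun z => if z = x then u else if z = u then x else if z = m u then m u else m z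

open Classical in
/-- The vertices with at least two neighbors that are not covered by the matching `m`. -/
noncomputable def exposed {V : Type} [Fintype V] (H : SimpleGraph V) (m : V → V) : Finset V :=
  Finset.univ.filter fun x => m x = x ∧ IsBranch H x

lemma mem_exposed {V : Type} [Fintype V] {H : SimpleGraph V} {m : V → V} {x : V} :
    x ∈ exposed H m ↔ m x = x ∧ IsBranch H x := by
  simp [exposed]

/-- The matching `m` exposes as few vertices as possible. -/
def IsOptimal {V : Type} [Fintype V] (H : SimpleGraph V) (m : V → V) : Prop :=
  IsMatchingMap H m ∧ ∀ m', IsMatchingMap H m' → (exposed H m).card ≤ (exposed H m').card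

lemma shift_involutive {V : Type} [DecidableEq V] {m : V → V} {x u : V}
    (hm : Function.Involutive m) (hx : m x = x) (hxu : x ≠ u) :
    Function.Involutive (shift m x u) := by
  intro z
  have h1 := hm z
  have h2 := hm u
  simp only [shift]
  grind

lemma IsMatchingMap.shift {V : Type} [DecidableEq V] {H : SimpleGraph V} {m : V → V} {x u : V}
    (hm : IsMatchingMap H m) (hx : m x = x) (hxu : H.Adj x u) :
    IsMatchingMap H (shift m x u) := by
  refine ⟨shift_involutive hm.invol hx hxu.ne, fun z hz => ?_⟩
  have h1 := hm.adj z
  have h2 := hxu.symm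
  simp only [_root_.shift] at hz ⊢
  grind

lemma IsOptimal.apply_ne_self {V : Type} [Fintype V] {H : SimpleGraph V} {m : V → V}
    {x u : V} (hm : IsOptimal H m) (hx : x ∈ exposed H m)
    (hxu : H.Adj x u) :
    m u ≠ x := by
  intro h
  have h1 := hm.1.invol u
  rw [h, (mem_exposed.1 hx).1] at h1
  exact hxu.ne h1

section
variable {V : Type} [Fintype V] [DecidableEq V] {H : SimpleGraph V} {m : V → V} {x u : V}

lemma IsOptimal.apply_ne (hm : IsOptimal H m) (hx : x ∈ exposed H m) (hxu : H.Adj x u) :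
    m u ≠ u := by
  intro hu
  rw [mem_exposed] at hx
  have h := hm.2 _ (hm.1.shift hx.1 hxu)
  have hsub : exposed H (shift m x u) ⊆ (exposed H m).erase x := by
    intro z hz
    rw [Finset.mem_erase, mem_exposed]
    rw [mem_exposed] at hz
    have := hxu.ne
    simp only [shift] at hz
    grind
  have h2 := Finset.card_le_card hsub
  have h3 := Finset.card_erase_lt_of_mem (mem_exposed.2 hx)
  omega

lemma exposed_shift_subset (hxu : x ≠ u) :
    exposed H (shift m x u) ⊆ insert (m u) ((exposed H m).erase x) := by
  intro z hz
  rw [Finset.mem_insert, Finset.mem_erase, mem_exposed]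
  rw [mem_exposed] at hz
  simp only [shift] at hz
  grind

lemma IsOptimal.isBranch_apply (hm : IsOptimal H m) (hx : x ∈ exposed H m) (hxu : H.Adj x u) :
    IsBranch H (m u) := by
  by_contra hb
  have hx' := hx
  rw [mem_exposed] at hx'
  have h := hm.2 _ (hm.1.shift hx'.1 hxu)
  have hsub : exposed H (shift m x u) ⊆ (exposed H m).erase x := by
    intro z hz
    rcases Finset.mem_insert.1 (exposed_shift_subset hxu.ne hz) with rfl | h
    · exact absurd (mem_exposed.1 hz).2 hb
    · exact h
  have h2 := Finset.card_le_card hsub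
  have h3 := Finset.card_erase_lt_of_mem hx
  omega

lemma IsOptimal.exposed_shift (hm : IsOptimal H m) (hx : x ∈ exposed H m) (hxu : H.Adj x u) :
    exposed H (shift m x u) = insert (m u) ((exposed H m).erase x) := by
  have hx' := hx
  rw [mem_exposed] at hx'
  refine (exposed_shift_subset hxu.ne).antisymm ?_
  have h1 := hm.apply_ne hx hxu
  have h2 := hm.isBranch_apply hx hxu
  have h3 := hm.1.invol u
  intro z hz
  rw [Finset.mem_insert, Finset.mem_erase, mem_exposed] at hz
  rw [mem_exposed]
  simp only [shift]
  grind

lemma IsOptimal.shift (hm : IsOptimal H m) (hx : x ∈ exposed H m) (hxu : H.Adj x u) :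
    IsOptimal H (shift m x u) := by
  refine ⟨hm.1.shift (mem_exposed.1 hx).1 hxu, fun m' hm' => le_trans ?_ (hm.2 m' hm')⟩
  rw [hm.exposed_shift hx hxu]
  have := Finset.card_erase_add_one hx
  have := Finset.card_insert_le (m u) ((exposed H m).erase x)
  omega

/-- The second neighbor of `u` is its partner in the matching. -/
lemma IsOptimal.eq_apply (hH : AtMostTwoNeighbors H) (hm : IsOptimal H m)
    (hx : x ∈ exposed H m) (hxu : H.Adj x u) {w : V} (huw : H.Adj u w) (hw : w ≠ x) :
    w = m u := by
  have h1 := hm.1.adj u (hm.apply_ne hx hxu)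
  have h2 := hm.apply_ne_self hx hxu
  rcases hH huw h1 hxu.symm with h | h | h
  · exact h
  · exact absurd h hw
  · exact absurd h h2

/-- An optimal matching exposes at most one vertex in each connected component. -/
lemma IsOptimal.eq_of_reachable (hH : AtMostTwoNeighbors H) (hm : IsOptimal H m) {x' : V}
    (hx : x ∈ exposed H m) (hx' : x' ∈ exposed H m) (h : H.Reachable x x') : x = x' := by
  obtain ⟨p⟩ := h
  induction hn : p.length using Nat.strong_induction_on generalizing m x x' with
  | _ n ih =>
  subst hn
  by_contra hne
  cases p with
  | nil => exact hne rfl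
  | @cons _ u _ h p =>
    cases p with
    | nil => exact hm.apply_ne hx h (mem_exposed.1 hx').1
    | @cons _ w _ h' p =>
      by_cases hw : w = x
      · subst hw
        exact hne (ih p.length (by simp) hm hx hx' p rfl)
      · have hwu := hm.eq_apply hH hx h h' hw
        have h1 := hm.exposed_shift hx h
        have h2 : w = x' := by
          refine ih p.length (by simp) (hm.shift hx h) ?_ ?_ p rfl
          · rw [h1, hwu]; exact Finset.mem_insert_self _ _
          · rw [h1]
            exact Finset.mem_insert_of_mem (Finset.mem_erase.2 ⟨Ne.symm hne, hx'⟩)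
        have h3 := hm.1.invol u
        rw [← hwu, h2, (mem_exposed.1 hx').1] at h3
        exact h'.ne (h2.trans h3).symm

lemma IsOptimal.isBranch_of_reachable (hH : AtMostTwoNeighbors H) (hm : IsOptimal H m)
    (hx : x ∈ exposed H m) {z : V} (h : H.Reachable x z) : IsBranch H z := by
  have key : (∃ m', IsOptimal H m' ∧ z ∈ exposed H m') ∨
      ∃ y, H.Adj y z ∧ ∃ m', IsOptimal H m' ∧ y ∈ exposed H m' := by
    rw [reachable_iff_reflTransGen] at h
    induction h with
    | refl => exact Or.inl ⟨m, hm, hx⟩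
    | @tail z w _ hzw ih =>
      rcases ih with h | ⟨y, hyz, m', hm', hy⟩
      · exact Or.inr ⟨z, hzw, h⟩
      · left
        by_cases hwy : w = y
        · subst hwy; exact ⟨m', hm', hy⟩
        · refine ⟨_, hm'.shift hy hyz, ?_⟩
          rw [hm'.exposed_shift hy hyz, ← hm'.eq_apply hH hy hyz hzw hwy]
          exact Finset.mem_insert_self _ _
  rcases key with ⟨m', _, h⟩ | ⟨y, hyz, m', hm', hy⟩
  · exact (mem_exposed.1 h).2
  · exact ⟨y, m' z, (hm'.apply_ne_self hy hyz).symm, hyz.symm,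
      hm'.1.adj z (hm'.apply_ne hy hyz)⟩

end

/-- A connected component all of whose vertices have two neighbors is a cycle. -/
lemma exists_isCycle_of_isBranch {V : Type} [Finite V] {H : SimpleGraph V}
    (hH : AtMostTwoNeighbors H) {x : V} (hx : ∀ z, H.Reachable x z → IsBranch H z) :
    ∃ p : H.Walk x x, p.IsCycle ∧ ∀ z, z ∈ p.support ↔ H.Reachable x z := by
  let K : SimpleGraph V :=
    { Adj := fun a b => H.Adj a b ∧ H.Reachable x a
      symm := ⟨fun a b h => ⟨h.1.symm, h.2.trans h.1.reachable⟩⟩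
      loopless := ⟨fun a h => h.1.ne rfl⟩ }
  have hle : K ≤ H := fun a b h => h.1
  have hreach : ∀ z, K.Reachable x z ↔ H.Reachable x z := by
    refine fun z => ⟨fun h => h.mono hle, fun h => ?_⟩
    rw [reachable_iff_reflTransGen] at h
    induction h with
    | refl => rfl
    | tail h1 h2 ih =>
      have h3 := (reachable_iff_reflTransGen _ _).2 h1
      exact ih.trans (Adj.reachable (G := K) ⟨h2, h3⟩)
  have hcyc : K.IsCycles := by
    rintro v ⟨w, hvw⟩
    obtain ⟨a, b, hab, ha, hb⟩ := hx v hvw.2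
    rw [Set.ncard_eq_two]
    refine ⟨a, b, hab, ?_⟩
    ext c
    simp only [mem_neighborSet, Set.mem_insert_iff, Set.mem_singleton_iff]
    constructor
    · intro hc
      rcases hH hc.1 ha hb with h | h | h
      · exact Or.inl h
      · exact Or.inr h
      · exact absurd h hab
    · rintro (rfl | rfl)
      · exact ⟨ha, hvw.2⟩
      · exact ⟨hb, hvw.2⟩
  obtain ⟨a, b, hab, ha, hb⟩ := hx x (Reachable.refl x)
  obtain ⟨p, hp, hp'⟩ := hcyc.exists_cycle_toSubgraph_verts_eq_connectedComponentSupp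
    (c := K.connectedComponentMk x) (v := x) rfl ⟨a, ha, Reachable.refl x⟩
  refine ⟨p.mapLe hle, hp.mapLe hle, fun z => ?_⟩
  rw [Walk.support_mapLe_eq_support, ← Walk.mem_verts_toSubgraph, hp', ← hreach,
    ConnectedComponent.mem_supp_iff, ConnectedComponent.eq]
  exact ⟨Reachable.symm, Reachable.symm⟩

lemma SimpleGraph.Walk.IsCycle.card_support_toFinset {V : Type} [DecidableEq V]
    {H : SimpleGraph V} {x : V} {p : H.Walk x x} (hp : p.IsCycle) :
    p.support.toFinset.card = p.length := by
  have h1 : p.support.toFinset = p.support.tail.toFinset := by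
    have : x ∈ p.support.tail := p.end_mem_tail_support hp.not_nil
    ext z
    rw [List.mem_toFinset, List.mem_toFinset, Walk.mem_support_iff]
    constructor
    · rintro (rfl | h)
      · exact this
      · exact h
    · exact Or.inr
  rw [h1, List.toFinset_card_of_nodup hp.support_nodup, List.length_tail, Walk.length_support]
  simp

open Classical in
/-- The proper two-colorings of the union of the matchings `p` and `m`. -/
noncomputable def splitsSet {V : Type} [Fintype V] (p m : V → V) : Finset (V → Bool) :=
  Finset.univ.filter fun f => Splits p f ∧ Splits m f

lemma mem_splitsSet {V : Type} [Fintype V] {p m : V → V} {f : V → Bool} :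
    f ∈ splitsSet p m ↔ Splits p f ∧ Splits m f := by
  simp [splitsSet]

lemma splitsSet_nonempty {V : Type} [Fintype V] {p m : V → V} (hp : Function.Involutive p)
    (hm : Function.Involutive m) : (splitsSet p m).Nonempty := by
  obtain ⟨f, hf⟩ := exists_splits hp hm
  exact ⟨f, mem_splitsSet.2 hf⟩

/-- Pointwise exclusive or of three colorings. -/
def xorThree {V : Type} (a b f : V → Bool) : V → Bool := fun z => xor (f z) (xor (a z) (b z))

lemma xorThree_involutive {V : Type} (a b : V → Bool) : Function.Involutive (xorThree a b) := by
  intro f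
  ext z
  simp [xorThree]

lemma xorThree_eq_iff {V : Type} (a b f : V → Bool) (x y : V) :
    xorThree a b f x = xorThree a b f y ↔ (f x = f y ↔ (a x = a y ↔ b x = b y)) := by
  simp only [xorThree]
  generalize f x = f₁, f y = f₂, a x = a₁, a y = a₂, b x = b₁, b y = b₂
  revert f₁ f₂ a₁ a₂ b₁ b₂
  decide

lemma Splits.xorThree {V : Type} {m : V → V} {a b f : V → Bool} (ha : Splits m a)
    (hb : Splits m b) (hf : Splits m f) : Splits m (xorThree a b f) := by
  intro x hx
  have h1 := ha x hx
  have h2 := hb x hx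
  have h3 := hf x hx
  rw [ne_eq, xorThree_eq_iff]
  tauto

lemma xorThree_mem_splitsSet {V : Type} [Fintype V] {p m : V → V} {a b f : V → Bool}
    (ha : a ∈ splitsSet p m) (hb : b ∈ splitsSet p m) (hf : f ∈ splitsSet p m) :
    xorThree a b f ∈ splitsSet p m := by
  rw [mem_splitsSet] at *
  exact ⟨ha.1.xorThree hb.1 hf.1, ha.2.xorThree hb.2 hf.2⟩

/-- If some coloring in `splitsSet p m` separates `x` and `u`, then at least half of them do. -/
lemma two_mul_card_filter_le {V : Type} [Fintype V] {p m : V → V} {x u : V}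
    (h : ∃ f ∈ splitsSet p m, f x ≠ f u) :
    2 * ((splitsSet p m).filter fun f => f x = f u).card ≤ (splitsSet p m).card := by
  obtain ⟨a, ha, hau⟩ := h
  have hle : ((splitsSet p m).filter fun f => f x = f u).card ≤
      ((splitsSet p m).filter fun f => ¬ f x = f u).card := by
    rcases ((splitsSet p m).filter fun f => f x = f u).eq_empty_or_nonempty with h | ⟨b, hb⟩
    · simp [h]
    · rw [Finset.mem_filter] at hb
      refine Finset.card_le_card_of_injOn (xorThree a b) ?_
        (xorThree_involutive a b).injective.injOn
      intro f hf
      simp only [Finset.coe_filter, Set.mem_ofPred_eq] at hf ⊢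
      refine ⟨xorThree_mem_splitsSet ha hb.1 hf.1, ?_⟩
      rw [xorThree_eq_iff]
      tauto
  have := Finset.card_filter_add_card_filter_not (s := splitsSet p m) (fun f => f x = f u)
  omega

/-- `f` properly colors the edges of `m` other than `{u, m u}`. -/
def SplitsAway {V : Type} (m : V → V) (x u : V) (f : V → Bool) : Prop :=
  ∀ z, z ≠ x → z ≠ u → z ≠ m u → m z ≠ z → f (m z) ≠ f z

lemma SplitsAway.xorThree {V : Type} {m : V → V} {x u : V} {a b f : V → Bool}
    (ha : SplitsAway m x u a) (hb : SplitsAway m x u b) (hf : SplitsAway m x u f) :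
    SplitsAway m x u (xorThree a b f) := by
  intro z h1 h2 h3 h4
  have h5 := ha z h1 h2 h3 h4
  have h6 := hb z h1 h2 h3 h4
  have h7 := hf z h1 h2 h3 h4
  rw [ne_eq, xorThree_eq_iff]
  tauto

lemma splits_iff_away {V : Type} {m : V → V} {x u : V} (hm : Function.Involutive m)
    (hx : m x = x) (hu : m u ≠ u) {f : V → Bool} :
    Splits m f ↔ f u ≠ f (m u) ∧ SplitsAway m x u f := by
  have h1 := hm u
  constructor
  · exact fun h => ⟨(h u hu).symm, fun z _ _ _ => h z⟩
  · rintro ⟨h2, h3⟩ z hz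
    by_cases hzx : z = x
    · exact absurd (hzx ▸ hx) hz
    by_cases hzu : z = u
    · rw [hzu]; exact h2.symm
    by_cases hzm : z = m u
    · rw [hzm, h1]; exact h2
    exact h3 z hzx hzu hzm hz

lemma splits_shift_iff {V : Type} [DecidableEq V] {m : V → V} {x u : V}
    (hm : Function.Involutive m) (hxu : x ≠ u) {f : V → Bool} :
    Splits (shift m x u) f ↔ f x ≠ f u ∧ SplitsAway m x u f := by
  have h1 := hm u
  constructor
  · refine fun h => ⟨?_, fun z h2 h3 h4 h5 => ?_⟩
    · have := h x
      simp only [shift] at this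
      grind
    · have := h z
      simp only [shift] at this
      grind
  · rintro ⟨h2, h3⟩ z hz
    have h4 := h3 z
    simp only [shift] at hz ⊢
    grind

section
variable {V : Type} [Fintype V] [DecidableEq V] {p m : V → V} {x u : V}

lemma card_splitsSet_le_shift (hp : Function.Involutive p) (hm : Function.Involutive m)
    (hx : m x = x) (hxu : x ≠ u) (hu : m u ≠ u) (h : ∀ f ∈ splitsSet p m, f x = f u) :
    (splitsSet p m).card ≤ (splitsSet p (shift m x u)).card := by
  obtain ⟨a, ha⟩ := splitsSet_nonempty hp hm
  obtain ⟨b, hb⟩ := splitsSet_nonempty hp (shift_involutive hm hx hxu)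
  have ha' := h a ha
  rw [mem_splitsSet, splits_iff_away hm hx hu] at ha
  rw [mem_splitsSet, splits_shift_iff hm hxu] at hb
  refine Finset.card_le_card_of_injOn (xorThree a b) ?_
        (xorThree_involutive a b).injective.injOn
  intro f hf
  have hf' := h f hf
  rw [Finset.mem_coe, mem_splitsSet, splits_iff_away hm hx hu] at hf
  rw [Finset.mem_coe, mem_splitsSet, splits_shift_iff hm hxu]
  refine ⟨ha.1.xorThree hb.1 hf.1, ?_, ha.2.2.xorThree hb.2.2 hf.2.2⟩
  have := hb.2.1
  rw [ne_eq, xorThree_eq_iff]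
  tauto

lemma card_splitsSet_lt_shift (hp : Function.Involutive p) (hm : Function.Involutive m)
    (hx : m x = x) (hxu : x ≠ u) (hu : m u ≠ u) (h : ∀ f ∈ splitsSet p m, f x ≠ f u) :
    (splitsSet p m).card < (splitsSet p (shift m x u)).card := by
  refine Finset.card_lt_card (Finset.ssubset_iff_subset_ne.2 ⟨fun f hf => ?_, fun heq => ?_⟩)
  · have hf' := h f hf
    rw [mem_splitsSet, splits_iff_away hm hx hu] at hf
    rw [mem_splitsSet, splits_shift_iff hm hxu]
    exact ⟨hf.1, hf', hf.2.2⟩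
  · have hxy : x ≠ m u := by
      intro h1
      have := hm u
      rw [← h1, hx] at this
      exact hxu this
    obtain ⟨f, hf⟩ := splitsSet_nonempty hp (shift_involutive hm hx hxy)
    rw [mem_splitsSet, splits_shift_iff hm hxy] at hf
    have haway : SplitsAway m x u f := by
      intro z h1 h2 h3
      exact hf.2.2 z h1 h3 (by rwa [hm u])
    by_cases hfu : f u = f (m u)
    · have h1 : f ∈ splitsSet p (shift m x u) := by
        rw [mem_splitsSet, splits_shift_iff hm hxu]
        exact ⟨hf.1, by rw [hfu]; exact hf.2.1, haway⟩
      rw [← heq, mem_splitsSet, splits_iff_away hm hx hu] at h1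
      exact h1.2.1 hfu
    · have h1 : f ∈ splitsSet p m := by
        rw [mem_splitsSet, splits_iff_away hm hx hu]
        exact ⟨hf.1, hfu, haway⟩
      have h2 := h f h1
      have h3 := hf.2.1
      revert h2 h3 hfu
      cases f x <;> cases f u <;> cases f (m u) <;> decide

/-- Among the matchings exposing as few vertices as possible, `m` maximizes the number of
two-colorings of its union with `p`. -/
def IsSplitMaximal (H : SimpleGraph V) (p m : V → V) : Prop :=
  IsOptimal H m ∧ ∀ m', IsOptimal H m' → (splitsSet p m').card ≤ (splitsSet p m).card

open Classical in
/-- The exposed vertices which get the color of all their neighbors in every two-coloring. -/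
noncomputable def frozen (H : SimpleGraph V) (p m : V → V) : Finset V :=
  (exposed H m).filter fun x => ∀ u, H.Adj x u → ∀ f ∈ splitsSet p m, f x = f u

/-- Among the matchings satisfying `IsSplitMaximal`, `m` has as few frozen vertices as
possible. -/
def IsBest (H : SimpleGraph V) (p m : V → V) : Prop :=
  IsSplitMaximal H p m ∧
    ∀ m', IsSplitMaximal H p m' → (frozen H p m).card ≤ (frozen H p m').card

variable {H : SimpleGraph V}

lemma mem_frozen : x ∈ frozen H p m ↔
    x ∈ exposed H m ∧ ∀ u, H.Adj x u → ∀ f ∈ splitsSet p m, f x = f u := by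
  simp [frozen]

lemma exists_isBest (H : SimpleGraph V) (p : V → V) : ∃ m, IsBest H p m := by
  have hid : IsMatchingMap H id := ⟨fun _ => rfl, fun x h => absurd rfl h⟩
  obtain ⟨m₁, h₁, h₁'⟩ := Set.exists_min_image {m | IsMatchingMap H m}
    (fun m => (exposed H m).card) (Set.toFinite _) ⟨id, hid⟩
  obtain ⟨m₂, h₂, h₂'⟩ := Set.exists_max_image {m | IsOptimal H m}
    (fun m => (splitsSet p m).card) (Set.toFinite _) ⟨m₁, h₁, h₁'⟩
  obtain ⟨m₃, h₃, h₃'⟩ := Set.exists_min_image {m | IsSplitMaximal H p m}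
    (fun m => (frozen H p m).card) (Set.toFinite _) ⟨m₂, h₂, h₂'⟩
  exact ⟨m₃, h₃, h₃'⟩

lemma IsBest.shift (hp : Function.Involutive p) (hm : IsBest H p m)
    (hx : x ∈ frozen H p m) (hxu : H.Adj x u) :
    IsBest H p (shift m x u) ∧ m u ∈ frozen H p (shift m x u) := by
  obtain ⟨hxe, hxf⟩ := mem_frozen.1 hx
  have hopt := hm.1.1
  have hinv := hopt.1.invol
  have hxx := (mem_exposed.1 hxe).1
  have hu := hopt.apply_ne hxe hxu
  have hmax : IsSplitMaximal H p (_root_.shift m x u) :=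
    ⟨hopt.shift hxe hxu, fun m' hm' => (hm.1.2 m' hm').trans
      (card_splitsSet_le_shift hp hinv hxx hxu.ne hu (hxf u hxu))⟩
  have hsub : (frozen H p (_root_.shift m x u)).erase (m u) ⊆ (frozen H p m).erase x := by
    intro y hy
    rw [Finset.mem_erase, mem_frozen, hopt.exposed_shift hxe hxu, Finset.mem_insert,
      Finset.mem_erase] at hy
    obtain ⟨hy1, hy2, hy3⟩ := hy
    obtain ⟨hyx, hye⟩ := hy2.resolve_left hy1
    rw [Finset.mem_erase, mem_frozen]
    refine ⟨hyx, hye, fun w hyw f hf => ?_⟩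
    by_contra hfy
    have hall : ∀ g ∈ splitsSet p m, g y ≠ g w := by
      intro g hg hgy
      obtain ⟨b, hb⟩ := splitsSet_nonempty hp (shift_involutive hinv hxx hxu.ne)
      have hby := hy3 w hyw b hb
      have hfx := hxf u hxu f hf
      have hgx := hxf u hxu g hg
      have hmem : xorThree f g b ∈ splitsSet p (_root_.shift m x u) := by
        rw [mem_splitsSet, splits_iff_away hinv hxx hu] at hf hg
        rw [mem_splitsSet, splits_shift_iff hinv hxu.ne] at hb ⊢
        refine ⟨hf.1.xorThree hg.1 hb.1, ?_, hf.2.2.xorThree hg.2.2 hb.2.2⟩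
        have := hb.2.1
        rw [ne_eq, xorThree_eq_iff]
        tauto
      have := hy3 w hyw _ hmem
      rw [xorThree_eq_iff] at this
      tauto
    have h1 := card_splitsSet_lt_shift hp hinv (mem_exposed.1 hye).1 hyw.ne
      (hopt.apply_ne hye hyw) hall
    have h2 := hm.1.2 _ (hopt.shift hye hyw)
    omega
  have hcard := Finset.card_le_card hsub
  have h1 := Finset.card_erase_add_one hx
  have h2 := hm.2 _ hmax
  have hmem : m u ∈ frozen H p (_root_.shift m x u) := by
    by_contra h
    rw [Finset.erase_eq_of_notMem h] at hcard
    omega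
  refine ⟨⟨hmax, fun m' hm' => le_trans ?_ (hm.2 m' hm')⟩, hmem⟩
  have h3 := Finset.card_erase_add_one hmem
  omega

end

/-- The exposed vertices that `f` gives the same color as all their neighbors. -/
noncomputable def monochromatic {V : Type} [Fintype V] (H : SimpleGraph V) (m : V → V)
    (f : V → Bool) : Finset V :=
  open Classical in (exposed H m).filter fun x => ∀ u, H.Adj x u → f x = f u

lemma mem_monochromatic {V : Type} [Fintype V] {H : SimpleGraph V} {m : V → V} {x : V}
    {f : V → Bool} :
    x ∈ monochromatic H m f ↔ x ∈ exposed H m ∧ ∀ u, H.Adj x u → f x = f u := by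
  simp [monochromatic]

open Classical in
/-- The vertex set of the connected component of `x`. -/
noncomputable def componentSet {V : Type} [Fintype V] (H : SimpleGraph V) (x : V) : Finset V :=
  Finset.univ.filter fun z => H.Reachable x z

lemma mem_componentSet {V : Type} [Fintype V] {H : SimpleGraph V} {x z : V} :
    z ∈ componentSet H x ↔ H.Reachable x z := by
  simp [componentSet]

lemma IsMatchingMap.reachable {V : Type} {H : SimpleGraph V} {m : V → V} (hm : IsMatchingMap H m)
    (x : V) : H.Reachable x (m x) := by
  by_cases h : m x = x
  · rw [h]
  · exact (hm.adj x h).reachable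

/-- A set of vertices of an odd cycle closed under going two steps contains the whole cycle as
soon as it contains the base point. -/
lemma SimpleGraph.Walk.IsCycle.forall_mem_support_of_odd {V : Type}
    {H : SimpleGraph V} {x : V} {w : H.Walk x x} (hw : w.IsCycle)
    (hodd : Odd w.length) (B : V → Prop) (hx : B x)
    (hB : ∀ y u z, B y → H.Adj y u → H.Adj u z → z ≠ y → B z) : ∀ z ∈ w.support, B z := by
  obtain ⟨k, hk⟩ := hodd
  have h3 := hw.three_le_length
  have hne : ∀ i, i + 2 ≤ w.length → w.getVert (i + 2) ≠ w.getVert i := by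
    intro i hi h
    by_cases h0 : i = 0
    · subst h0
      replace h := h.trans (w.getVert_zero.trans w.getVert_length.symm)
      have := hw.getVert_injOn (by simp; omega) (by simp; omega) h
      omega
    · have := hw.getVert_injOn (by simp; omega) (by simp; omega) h
      omega
  have hstep : ∀ i, i + 2 ≤ w.length → B (w.getVert i) → B (w.getVert (i + 2)) :=
    fun i hi h => hB _ _ _ h (w.adj_getVert_succ (by omega)) (w.adj_getVert_succ (by omega))
      (hne i hi)
  have heven : ∀ j, 2 * j ≤ w.length → B (w.getVert (2 * j)) := by
    intro j
    induction j with
    | zero => intro _; simpa using hx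
    | succ j ih => exact fun h => hstep _ (by omega) (ih (by omega))
  have hone : B (w.getVert 1) := by
    have h1 : w.getVert (2 * k + 1) = w.getVert 0 := by
      rw [← hk, w.getVert_length, w.getVert_zero]
    refine hB (w.getVert (2 * k)) (w.getVert (2 * k + 1)) (w.getVert 1) (heven k (by omega))
      (w.adj_getVert_succ (by omega)) ?_ ?_
    · rw [h1]
      exact w.adj_getVert_succ (by omega)
    · intro h
      have := hw.getVert_injOn (by simp; omega) (by simp; omega) h
      omega
  have hoddv : ∀ j, 2 * j + 1 ≤ w.length → B (w.getVert (2 * j + 1)) := by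
    intro j
    induction j with
    | zero => intro _; exact hone
    | succ j ih => exact fun h => hstep _ (by omega) (ih (by omega))
  intro z hz
  obtain ⟨i, rfl, hi⟩ := Walk.mem_support_iff_exists_getVert.1 hz
  rcases Nat.even_or_odd' i with ⟨j, rfl | rfl⟩
  · exact heven j hi
  · exact hoddv j hi

section
variable {V : Type} [Fintype V] [DecidableEq V] {H : SimpleGraph V} {p m : V → V} {x u : V}

lemma IsOptimal.exists_isCycle (hH : AtMostTwoNeighbors H) (hm : IsOptimal H m)
    (hx : x ∈ exposed H m) :
    ∃ w : H.Walk x x, w.IsCycle ∧ w.support.toFinset = componentSet H x := by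
  obtain ⟨w, hw, hw'⟩ := exists_isCycle_of_isBranch hH
    fun z hz => hm.isBranch_of_reachable hH hx hz
  refine ⟨w, hw, ?_⟩
  ext z
  rw [List.mem_toFinset, hw', mem_componentSet]

lemma IsOptimal.odd_card_componentSet (hH : AtMostTwoNeighbors H) (hm : IsOptimal H m)
    (hx : x ∈ exposed H m) : Odd (componentSet H x).card := by
  have hxC : x ∈ componentSet H x := mem_componentSet.2 (Reachable.refl x)
  have hsum : ∑ c ∈ (componentSet H x).erase x, (1 : ZMod 2) = 0 := by
    refine Finset.sum_involution (fun c _ => m c) (fun _ _ => by decide) (fun c hc _ h => ?_)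
      (fun c hc => ?_) (fun c _ => hm.1.invol c)
    · rw [Finset.mem_erase, mem_componentSet] at hc
      refine hc.1 (hm.eq_of_reachable hH hx ?_ hc.2).symm
      exact mem_exposed.2 ⟨h, hm.isBranch_of_reachable hH hx hc.2⟩
    · rw [Finset.mem_erase, mem_componentSet] at hc ⊢
      refine ⟨fun h => hc.1 ?_, hc.2.trans (hm.1.reachable c)⟩
      rw [← hm.1.invol c, h, (mem_exposed.1 hx).1]
  rw [Finset.sum_const, nsmul_one, ZMod.natCast_eq_zero_iff_even] at hsum
  rw [← Finset.card_erase_add_one hxC]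
  exact hsum.add_one

lemma IsBest.frozen_eq_empty (hH : AtMostTwoNeighbors H) (hp : Function.Involutive p)
    (hm : IsBest H p m) : frozen H p m = ∅ := by
  rw [Finset.eq_empty_iff_forall_notMem]
  intro x hx
  have hxe := (mem_frozen.1 hx).1
  have hopt := hm.1.1
  set C := componentSet H x with hC
  have hodd := hopt.odd_card_componentSet hH hxe
  obtain ⟨w, hw, hwC⟩ := hopt.exists_isCycle hH hxe
  have hstable : ∀ {m' : V → V}, IsMatchingMap H m' → ∀ z ∈ C, m' z ∈ C :=
    fun hm' z hz => mem_componentSet.2 ((mem_componentSet.1 hz).trans (hm'.reachable z))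
  let o : V → V := fun z => if z ∈ C then z else m z
  have ho : Function.Involutive o := by
    intro z
    by_cases hz : z ∈ C
    · simp [o, hz]
    · have : m z ∉ C := fun h => hz (by simpa [hopt.1.invol z] using hstable hopt.1 _ h)
      simp [o, hz, this, hopt.1.invol z]
  obtain ⟨t, htC, d, hdp, hdo, hdt, hd⟩ :=
    exists_isolating_orbit hp ho C hodd (fun c hc => by simp [o, hc])
  have hBt := hw.forall_mem_support_of_odd
    (by rw [← hw.card_support_toFinset, hwC]; exact hodd)
    (fun y => y ∈ C ∧ ∃ m', IsBest H p m' ∧ y ∈ frozen H p m' ∧ ∀ z ∉ C, m' z = m z)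
    ⟨mem_componentSet.2 (Reachable.refl x), m, hm, hx, fun _ _ => rfl⟩
    (by
      rintro y u z ⟨hyC, m', hm', hy, hag⟩ hyu huz hzy
      have huC : u ∈ C := mem_componentSet.2 ((mem_componentSet.1 hyC).trans hyu.reachable)
      have hz := hm'.1.1.eq_apply hH (mem_frozen.1 hy).1 hyu huz hzy
      have hzC : z ∈ C := mem_componentSet.2 ((mem_componentSet.1 huC).trans huz.reachable)
      obtain ⟨h1, h2⟩ := hm'.shift hp hy hyu
      refine ⟨hzC, _, h1, hz ▸ h2, fun v hv => ?_⟩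
      have hvy : v ≠ y := fun h => hv (h ▸ hyC)
      have hvu : v ≠ u := fun h => hv (h ▸ huC)
      have hvz : v ≠ m' u := fun h => hv (h ▸ hz ▸ hzC)
      simp [_root_.shift, hvy, hvu, hvz, hag v hv])
    t (by rw [← List.mem_toFinset, hwC]; exact htC)
  obtain ⟨-, m', hm', ht, hag⟩ := hBt
  obtain ⟨hte, htf⟩ := mem_frozen.1 ht
  have hopt' := hm'.1.1
  obtain ⟨htt, u, -, -, htu, -⟩ := mem_exposed.1 hte
  obtain ⟨f, hf⟩ := splitsSet_nonempty hp hopt'.1.invol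
  have huC : u ∈ C := mem_componentSet.2 ((mem_componentSet.1 htC).trans htu.reachable)
  have hdu := hd u huC htu.ne'
  have hdm : ∀ z, m' z ≠ z → d (m' z) = d z := by
    intro z hz
    by_cases hzC : z ∈ C
    · have hzt : z ≠ t := fun h => hz (h ▸ htt)
      have hmt : m' z ≠ t := by
        intro h
        have := hopt'.1.invol z
        rw [h, htt] at this
        exact hzt this.symm
      rw [hd z hzC hzt, hd _ (hstable hopt'.1 z hzC) hmt]
    · have := hdo z
      simpa [o, hzC, hag z hzC] using this
  have hg : (fun z => xor (f z) (d z)) ∈ splitsSet p m' := by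
    rw [mem_splitsSet] at hf ⊢
    refine ⟨fun z hz => ?_, fun z hz => ?_⟩
    · simpa [hdp z] using hf.1 z hz
    · simpa [hdm z hz] using hf.2 z hz
  have h1 := htf u htu f hf
  have h2 := htf u htu _ hg
  simp [hdt, hdu, h1] at h2

lemma IsOptimal.three_lt_card_componentSet (hm : IsOptimal H m)
    {f : V → Bool} (hf : Splits m f) (hx : x ∈ monochromatic H m f) :
    3 < (componentSet H x).card := by
  obtain ⟨hxe, hxf⟩ := mem_monochromatic.1 hx
  obtain ⟨hxx, a, b, hab, ha, hb⟩ := mem_exposed.1 hxe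
  have ha' := hm.apply_ne hxe ha
  have hfa := hf a ha'
  have hne : m a ≠ b := by
    intro h
    rw [h, ← hxf b hb, ← hxf a ha] at hfa
    exact hfa rfl
  have hsub : ({x, a, b, m a} : Finset V) ⊆ componentSet H x := by
    intro z hz
    rw [mem_componentSet]
    simp only [Finset.mem_insert, Finset.mem_singleton] at hz
    rcases hz with rfl | rfl | rfl | rfl
    · rfl
    · exact ha.reachable
    · exact hb.reachable
    · exact ha.reachable.trans (hm.1.reachable a)
  have hcard : ({x, a, b, m a} : Finset V).card = 4 := by
    have h1 := hm.apply_ne_self hxe ha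
    have h2 := ha.ne
    have h3 := hb.ne
    rw [Finset.card_insert_of_notMem, Finset.card_insert_of_notMem, Finset.card_insert_of_notMem,
      Finset.card_singleton] <;> grind
  have := Finset.card_le_card hsub
  omega

/-- Some two-coloring makes at most half of the exposed vertices in long odd cycles
monochromatic with their neighbors. -/
lemma IsBest.exists_coloring (hH : AtMostTwoNeighbors H) (hp : Function.Involutive p)
    (hm : IsBest H p m) :
    ∃ f ∈ splitsSet p m, 2 * (monochromatic H m f).card ≤
      ((exposed H m).filter fun x => 3 < (componentSet H x).card).card := by
  classical
  set L := (exposed H m).filter fun x => 3 < (componentSet H x).card with hL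
  set S := splitsSet p m with hS
  have hopt := hm.1.1
  have hSne : S.Nonempty := splitsSet_nonempty hp hopt.1.invol
  have hhalf : ∀ x ∈ L, 2 * (S.filter fun f => x ∈ monochromatic H m f).card ≤ S.card := by
    intro x hx
    have hxe := (Finset.mem_filter.1 hx).1
    have hnf : x ∉ frozen H p m := by rw [hm.frozen_eq_empty hH hp]; simp
    rw [mem_frozen] at hnf
    push Not at hnf
    obtain ⟨u, hxu, f, hf, hfu⟩ := hnf hxe
    refine le_trans (Nat.mul_le_mul_left 2 (Finset.card_le_card ?_))
      (two_mul_card_filter_le ⟨f, hf, hfu⟩)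
    intro g hg
    rw [Finset.mem_filter] at hg ⊢
    exact ⟨hg.1, (mem_monochromatic.1 hg.2).2 u hxu⟩
  have hcount : ∑ f ∈ S, 2 * (monochromatic H m f).card ≤ ∑ f ∈ S, L.card := by
    have h1 : ∀ f ∈ S, 2 * (monochromatic H m f).card
        = ∑ x ∈ L, if x ∈ monochromatic H m f then 2 else 0 := by
      intro f hf
      rw [← Finset.sum_filter, Finset.sum_const, smul_eq_mul, mul_comm]
      congr 2
      ext x
      rw [Finset.mem_filter, hL, Finset.mem_filter]
      refine ⟨fun h => ⟨⟨(mem_monochromatic.1 h).1, ?_⟩, h⟩, fun h => h.2⟩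
      exact hopt.three_lt_card_componentSet (mem_splitsSet.1 hf).2 h
    rw [Finset.sum_congr rfl h1, Finset.sum_comm, Finset.sum_const, smul_eq_mul, mul_comm,
      ← smul_eq_mul, ← Finset.sum_const]
    refine Finset.sum_le_sum fun x hx => ?_
    rw [← Finset.sum_filter, Finset.sum_const, smul_eq_mul, mul_comm]
    exact hhalf x hx
  exact Finset.exists_le_of_sum_le hSne hcount

end

lemma atMostTwoNeighbors_of_degree_le {V : Type} [Fintype V] {H : SimpleGraph V}
    [DecidableRel H.Adj] (hΔ : ∀ v, H.degree v ≤ 2) : AtMostTwoNeighbors H := by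
  classical
  intro x a b c ha hb hc
  by_contra! h
  have hsub : ({a, b, c} : Finset V) ⊆ H.neighborFinset x := by
    intro z hz
    simp only [Finset.mem_insert, Finset.mem_singleton] at hz
    rw [mem_neighborFinset]
    rcases hz with rfl | rfl | rfl <;> assumption
  have h1 := Finset.card_le_card hsub
  rw [card_neighborFinset_eq_degree,
    Finset.card_eq_three.2 ⟨a, b, c, h.1, h.2.1, h.2.2, rfl⟩] at h1
  have := hΔ x
  omega

lemma exists_involutive_of_card_eq_four {V : Type} {s : Finset V} (hs : s.card = 4) :
    ∃ p : V → V, Function.Involutive p ∧ ∀ x ∈ s, p x ∈ s ∧ p x ≠ x := by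
  classical
  obtain ⟨a, t, ha, rfl, ht⟩ := Finset.card_eq_succ.1 hs
  obtain ⟨b, c, d, hbc, hbd, hcd, rfl⟩ := Finset.card_eq_three.1 ht
  simp only [Finset.mem_insert, Finset.mem_singleton, not_or] at ha
  refine ⟨fun x => if x = a then b else if x = b then a else if x = c then d else
    if x = d then c else x, fun x => ?_, fun x hx => ?_⟩
  · grind
  · simp only [Finset.mem_insert, Finset.mem_singleton] at hx ⊢
    grind

/-- Disjoint four-element sets can be split into pairs simultaneously. -/
lemma exists_involutive_of_pairwise_disjoint {V ι : Type} {Y : ι → Finset V}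
    (hY : ∀ j, (Y j).card = 4) (hdisj : ∀ i j, i ≠ j → Disjoint (Y i) (Y j)) :
    ∃ p : V → V, Function.Involutive p ∧ ∀ j, ∀ x ∈ Y j, p x ∈ Y j ∧ p x ≠ x := by
  classical
  choose P hP hP' using fun j => exists_involutive_of_card_eq_four (hY j)
  have huniq : ∀ i j x, x ∈ Y i → x ∈ Y j → i = j := fun i j x hi hj => by
    by_contra h
    exact Finset.disjoint_left.1 (hdisj i j h) hi hj
  let p : V → V := fun x => if h : ∃ j, x ∈ Y j then P h.choose x else x
  have hp : ∀ j, ∀ x ∈ Y j, p x = P j x := by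
    intro j x hx
    have h : ∃ j, x ∈ Y j := ⟨j, hx⟩
    simp only [p, dif_pos h, huniq _ _ _ h.choose_spec hx]
  refine ⟨p, fun x => ?_, fun j x hx => ?_⟩
  · by_cases h : ∃ j, x ∈ Y j
    · obtain ⟨j, hx⟩ := h
      rw [hp j x hx, hp j _ (hP' j x hx).1, hP j x]
    · simp [p, h]
  · rw [hp j x hx]
    exact hP' j x hx

/-- A symmetric relation with unique partners is contained in the graph of an involution. -/
lemma exists_involutive_of_unique {V : Type} {R : V → V → Prop} (hsymm : ∀ x y, R x y → R y x)
    (huniq : ∀ x y z, R x y → R x z → y = z) :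
    ∃ q : V → V, Function.Involutive q ∧ ∀ x y, R x y → q x = y := by
  classical
  let q : V → V := fun x => if h : ∃ y, R x y then h.choose else x
  have hq : ∀ x y, R x y → q x = y := by
    intro x y hxy
    have h : ∃ y, R x y := ⟨y, hxy⟩
    simp only [q, dif_pos h]
    exact huniq _ _ _ h.choose_spec hxy
  refine ⟨q, fun x => ?_, hq⟩
  by_cases h : ∃ y, R x y
  · obtain ⟨y, hy⟩ := h
    rw [hq x y hy, hq y x (hsymm _ _ hy)]
  · simp [q, h]

lemma exists_bool_coloring_of_unique {V : Type} {R S : V → V → Prop}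
    (hR : ∀ x y, R x y → R y x) (hR' : ∀ x y z, R x y → R x z → y = z)
    (hS : ∀ x y, S x y → S y x) (hS' : ∀ x y z, S x y → S x z → y = z) :
    ∃ g : V → Bool, ∀ x y, x ≠ y → R x y ∨ S x y → g x ≠ g y := by
  obtain ⟨q, hq, hq'⟩ := exists_involutive_of_unique hR hR'
  obtain ⟨r, hr, hr'⟩ := exists_involutive_of_unique hS hS'
  obtain ⟨g, hg, hg'⟩ := exists_splits hq hr
  refine ⟨g, fun x y hxy h => ?_⟩
  rcases h with h | h
  · have h1 := hq' x y h
    have h2 := hg x (by rw [h1]; exact hxy.symm)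
    rw [h1] at h2
    exact h2.symm
  · have h1 := hr' x y h
    have h2 := hg' x (by rw [h1]; exact hxy.symm)
    rw [h1] at h2
    exact h2.symm

/-- In a four-element set with a fixed-point-free pairing, each class of a two-coloring
splitting the pairs has exactly two elements. -/
lemma eq_of_splits_of_card_eq_four {V : Type} {p : V → V} {f : V → Bool}
    (hp : Function.Involutive p) (hf : Splits p f) {s : Finset V} (hs : s.card = 4)
    (hps : ∀ x ∈ s, p x ∈ s ∧ p x ≠ x) {x y z : V} (hx : x ∈ s) (hy : y ∈ s) (hz : z ∈ s)
    (hxy : x ≠ y) (hxz : x ≠ z) (hfy : f x = f y) (hfz : f x = f z) : y = z := by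
  classical
  by_contra hyz
  have h1 := hf x (hps x hx).2
  have h2 := hf y (hps y hy).2
  have h3 : p x ≠ p y := hp.injective.ne hxy
  have hsub : ({p x, p y, x, y, z} : Finset V) ⊆ s := by
    intro w hw
    simp only [Finset.mem_insert, Finset.mem_singleton] at hw
    have := (hps x hx).1
    have := (hps y hy).1
    grind
  have h4 := Finset.card_le_card hsub
  have hpx : p x ≠ x ∧ p x ≠ y ∧ p x ≠ z := by grind
  have hpy : p y ≠ x ∧ p y ≠ y ∧ p y ≠ z := by grind
  rw [Finset.card_insert_of_notMem (by simp [*]), Finset.card_insert_of_notMem (by simp [*]),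
    Finset.card_eq_three.2 ⟨x, y, z, hxy, hxz, hyz, rfl⟩] at h4
  omega

lemma IsMatchingMap.eq_of_notMem_monochromatic {V : Type} [Fintype V] {H : SimpleGraph V}
    {m : V → V} {f : V → Bool} (hH : AtMostTwoNeighbors H) (hm : IsMatchingMap H m)
    (hf : Splits m f) {x y z : V} (hx : x ∉ monochromatic H m f) (hxy : H.Adj x y)
    (hxz : H.Adj x z) (hfy : f x = f y) (hfz : f x = f z) : y = z := by
  by_contra hyz
  have hnbr : ∀ u, H.Adj x u → f x = f u := by
    intro u hu
    rcases hH hu hxy hxz with h | h | h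
    · rwa [h]
    · rwa [h]
    · exact absurd h hyz
  refine hx (mem_monochromatic.2 ⟨mem_exposed.2 ⟨?_, y, z, hyz, hxy, hxz⟩, hnbr⟩)
  by_contra h
  exact hf x h (hnbr _ (hm.adj x h)).symm

lemma colorable_four_of_splits {V : Type} [Fintype V] [DecidableEq V] {H G : SimpleGraph V}
    {ι : Type} {Y : ι → Finset V} {p m : V → V} {f : V → Bool}
    (hH : AtMostTwoNeighbors H) (hY : ∀ j, (Y j).card = 4)
    (hdisj : ∀ i j, i ≠ j → Disjoint (Y i) (Y j))
    (hG : ∀ u v, G.Adj u v ↔ H.Adj u v ∨ (u ≠ v ∧ ∃ j, u ∈ Y j ∧ v ∈ Y j))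
    (hp : Function.Involutive p) (hpY : ∀ j, ∀ x ∈ Y j, p x ∈ Y j ∧ p x ≠ x)
    (hm : IsMatchingMap H m) (hpf : Splits p f) (hmf : Splits m f) :
    (G.induce ((↑(monochromatic H m f) : Set V)ᶜ)).Colorable 4 := by
  set Z := monochromatic H m f
  obtain ⟨g, hg⟩ := exists_bool_coloring_of_unique
    (R := fun x y => H.Adj x y ∧ x ∉ Z ∧ y ∉ Z ∧ f x = f y)
    (S := fun x y => x ≠ y ∧ f x = f y ∧ ∃ j, x ∈ Y j ∧ y ∈ Y j)
    (fun x y h => ⟨h.1.symm, h.2.2.1, h.2.1, h.2.2.2.symm⟩)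
    (fun x y z h h' => hm.eq_of_notMem_monochromatic hH hmf h.2.1 h.1 h'.1 h.2.2.2 h'.2.2.2)
    (fun x y ⟨h, h', j, hx, hy⟩ => ⟨h.symm, h'.symm, j, hy, hx⟩)
    (by
      rintro x y z ⟨hxy, hfy, i, hxi, hyi⟩ ⟨hxz, hfz, j, hxj, hzj⟩
      obtain rfl : i = j := by
        by_contra h
        exact Finset.disjoint_left.1 (hdisj i j h) hxi hxj
      exact eq_of_splits_of_card_eq_four hp hpf (hY i) (hpY i) hxi hyi hzj hxy hxz hfy hfz)
  let c : (G.induce ((↑Z : Set V)ᶜ)).Coloring (Bool × Bool) :=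
    Coloring.mk (fun v => (f v, g v)) (by
      rintro ⟨x, hx⟩ ⟨y, hy⟩ hxy h
      rw [comap_adj] at hxy
      simp only [Function.Embedding.subtype_apply] at hxy
      rw [Prod.mk.injEq] at h
      refine hg x y hxy.ne ?_ h.2
      rcases (hG x y).1 hxy with h' | h'
      · exact Or.inl ⟨h', fun h => hx h, fun h => hy h, h.1⟩
      · exact Or.inr ⟨h'.1, h.1, h'.2⟩)
  simpa using c.colorable

theorem stmt_5 {V : Type} [Fintype V] [DecidableEq V]
    (H G : SimpleGraph V) [DecidableRel H.Adj]
    (hΔ : ∀ v, H.degree v ≤ 2)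
    (hglue : GluedK4 H G) :
    ∃ Z : Finset V,
      -- Z is contained in the union of the vertex sets of the odd cycles of length > 3
      (∀ v ∈ Z, ∃ s : Finset V,
        (IsCycleSet H s ∧ Odd s.card ∧ 3 < s.card) ∧ v ∈ s) ∧
      -- Z contains at most one vertex from each such cycle
      (∀ s : Finset V, IsCycleSet H s → Odd s.card → 3 < s.card → (Z ∩ s).card ≤ 1) ∧
      -- |Z| ≤ |𝒞|/2
      (Z.card : ℚ) ≤
        ({s : Finset V | IsCycleSet H s ∧ Odd s.card ∧ 3 < s.card}.ncard : ℚ) / 2 ∧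
      -- G − Z is 4-colorable
      (G.induce ((↑Z : Set V)ᶜ)).Colorable 4 ∧
      -- |V(G) \ Z| ≥ (9/10)|V(G)|
      (9 : ℚ) / 10 * (Fintype.card V : ℚ) ≤ ((Zᶜ : Finset V).card : ℚ) := by
  have hH := atMostTwoNeighbors_of_degree_le hΔ
  obtain ⟨q, Y, hY, hdisj, hG⟩ := hglue
  obtain ⟨p, hp, hpY⟩ := exists_involutive_of_pairwise_disjoint hY hdisj
  obtain ⟨m, hm⟩ := exists_isBest H p
  obtain ⟨f, hf, hcard⟩ := hm.exists_coloring hH hp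
  rw [mem_splitsSet] at hf
  have hopt : IsOptimal H m := hm.1.1
  have hcyc : ∀ x ∈ exposed H m, IsCycleSet H (componentSet H x) := fun x hx =>
    ⟨x, hopt.exists_isCycle hH hx⟩
  have hodd : ∀ x ∈ exposed H m, Odd (componentSet H x).card := fun x hx =>
    hopt.odd_card_componentSet hH hx
  have hself : ∀ x, x ∈ componentSet H x := fun x => mem_componentSet.2 (Reachable.refl x)
  set X := (exposed H m).filter fun x => 3 < (componentSet H x).card with hX
  have hinj : ∀ x ∈ X, ∀ y ∈ X, ∀ z ∈ componentSet H x, z ∈ componentSet H y → x = y := by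
    intro x hx y hy z hzx hzy
    rw [mem_componentSet] at hzx hzy
    exact hopt.eq_of_reachable hH (Finset.mem_filter.1 hx).1 (Finset.mem_filter.1 hy).1
      (hzx.trans hzy.symm)
  refine ⟨monochromatic H m f, fun v hv => ?_, fun s hs _ _ => ?_, ?_, ?_, ?_⟩
  · have hv' := (mem_monochromatic.1 hv).1
    exact ⟨componentSet H v, ⟨hcyc v hv', hodd v hv', hopt.three_lt_card_componentSet hf.2 hv⟩,
      hself v⟩
  · obtain ⟨v, w, -, rfl⟩ := hs
    rw [Finset.card_le_one]
    intro x hx y hy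
    simp only [Finset.mem_inter, List.mem_toFinset, mem_monochromatic] at hx hy
    exact hopt.eq_of_reachable hH hx.1.1 hy.1.1
      ((w.takeUntil x hx.2).reachable.symm.trans (w.takeUntil y hy.2).reachable)
  · have h1 : X.card ≤ {s : Finset V | IsCycleSet H s ∧ Odd s.card ∧ 3 < s.card}.ncard := by
      rw [← Set.ncard_coe_finset]
      refine Set.ncard_le_ncard_of_injOn (componentSet H) (fun x hx => ?_)
        (fun x hx y hy hxy => hinj x hx y hy x (hself x) (hxy ▸ hself x)) (Set.toFinite _)
      have hx' := Finset.mem_filter.1 (Finset.mem_coe.1 hx)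
      exact ⟨hcyc x hx'.1, hodd x hx'.1, hx'.2⟩
    have h2 : ((2 * (monochromatic H m f).card : ℕ) : ℚ) ≤ _ := Nat.cast_le.2 (hcard.trans h1)
    push_cast at h2
    linarith
  · exact colorable_four_of_splits hH hY hdisj hG hp hpY hopt.1 hf.1 hf.2
  · have h1 : 5 * X.card ≤ Fintype.card V := by
      calc 5 * X.card = ∑ x ∈ X, 5 := by simp [mul_comm]
        _ ≤ ∑ x ∈ X, (componentSet H x).card := Finset.sum_le_sum fun x hx => by
            have hx' := Finset.mem_filter.1 hx
            obtain ⟨k, hk⟩ := hodd x hx'.1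
            omega
        _ = (X.biUnion (componentSet H)).card := (Finset.card_biUnion fun x hx y hy hxy =>
            Finset.disjoint_left.2 fun z hz hz' => hxy (hinj x hx y hy z hz hz')).symm
        _ ≤ Fintype.card V := Finset.card_le_univ _
    have h2 : 10 * (monochromatic H m f).card ≤ Fintype.card V := by omega
    have h3 : ((monochromatic H m f)ᶜ.card : ℚ) + (monochromatic H m f).card = Fintype.card V := by
      exact_mod_cast Finset.card_compl_add_card _
    have h4 : (10 * (monochromatic H m f).card : ℚ) ≤ Fintype.card V := by exact_mod_cast h2
    linarith
end
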